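/- arXiv:1407.2844 — 7 statements merged into one kernel-verified Lean document; each statement's English description precedes it below -/
import Mathlib

section
/- Let G be a connected simple graph on n vertices, let T be a spanning tree of G, and suppose there exists a simple cycle C_T in G whose vertex set contains every vertex that has odd degree in T. Then G has a TSP tour of length at most 4n/3. -/
namespace TSPAux
open SimpleGraph Classical

variable {V : Type*}

noncomputable def dg (F : Multiset (Sym2 V)) (x : V) : ZMod 2 :=
  ((F.countP (fun e => x ∈ e) : ℕ) : ZMod 2)

noncomputable def ind (a x : V) : ZMod 2 := if x = a then 1 else 0

lemma z2 (a : ZMod 2) : a + a = 0 := by revert a; decide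

lemma z2c (a : ZMod 2) : a = 0 ∨ a = 1 := by revert a; decide

lemma dg_add (F H : Multiset (Sym2 V)) (x : V) : dg (F + H) x = dg F x + dg H x := by
  simp [dg]

lemma dg_cons {a b : V} (h : a ≠ b) (F : Multiset (Sym2 V)) (x : V) :
    dg (s(a, b) ::ₘ F) x = ind a x + ind b x + dg F x := by
  unfold dg ind
  rw [Multiset.countP_cons]
  by_cases h1 : x = a
  · subst h1
    simp [h, add_comm]
  · by_cases h2 : x = b
    · subst h2
      simp [h1, add_comm]
    · simp [h1, h2]

lemma dg_walk {G : SimpleGraph V} {a b : V} (p : G.Walk a b) (x : V) :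
    dg (p.edges : Multiset (Sym2 V)) x = ind a x + ind b x := by
  induction p with
  | nil => rw [z2]; simp [dg]
  | @cons a a' b h p ih =>
    rw [Walk.edges_cons, ← Multiset.cons_coe, dg_cons h.ne, ih]
    have := z2 (ind a' x)
    linear_combination this

lemma path_of_parity {G : SimpleGraph V} (n : ℕ) : ∀ (F : Multiset (Sym2 V)) (a b : V),
    F.card = n → (∀ e ∈ F, e ∈ G.edgeSet) → (∀ x, dg F x = ind a x + ind b x) →
    ∃ w : G.Walk a b, (w.edges : Multiset (Sym2 V)) ≤ F := by
  induction n with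
  | zero =>
    intro F a b hn hF hd
    by_cases hab : a = b
    · subst hab; exact ⟨Walk.nil, by simp⟩
    · have := hd a
      rw [Multiset.card_eq_zero] at hn
      subst hn
      simp [dg, ind, hab] at this
  | succ n ih =>
    intro F a b hn hF hd
    by_cases hab : a = b
    · subst hab; exact ⟨Walk.nil, by simp⟩
    · have h1 := hd a
      have h2 : 0 < F.countP (fun e => a ∈ e) := by
        rw [Nat.pos_iff_ne_zero]
        intro h0
        simp [dg, ind, hab, h0] at h1
      obtain ⟨e, he, hae⟩ := Multiset.countP_pos.1 h2
      obtain ⟨a', rfl⟩ := Sym2.mem_iff_exists.1 hae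
      have hadj : G.Adj a a' := hF _ he
      obtain ⟨F', rfl⟩ := Multiset.exists_cons_of_mem he
      obtain ⟨w, hw⟩ := ih F' a' b (by simpa using hn)
        (fun e he => hF e (Multiset.mem_cons_of_mem he)) (by
          intro x
          have := hd x
          rw [dg_cons hadj.ne] at this
          have h3 := z2 (ind a' x)
          linear_combination this - h3)
      refine ⟨Walk.cons hadj w, ?_⟩
      rw [Walk.edges_cons, ← Multiset.cons_coe]
      exact Multiset.cons_le_cons _ hw

lemma boundary {G : SimpleGraph V} (hG : G.Connected) (S : Set V) {x y : V} (hx : x ∈ S)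
    (hy : y ∉ S) : ∃ a b, G.Adj a b ∧ a ∈ S ∧ b ∉ S := by
  obtain ⟨p⟩ := hG x y
  obtain ⟨d, _, h1, h2⟩ := p.exists_boundary_dart S hx hy
  exact ⟨d.fst, d.snd, d.adj, h1, h2⟩

lemma rot_edges {G : SimpleGraph V} {r a : V} (w : G.Walk r r) (ha : a ∈ w.support) :
    ((w.rotate a ha).edges : Multiset (Sym2 V)) = w.edges :=
  Multiset.coe_eq_coe.2 (w.rotate_edges a ha).perm

lemma euler {G T : SimpleGraph V} (hT : T.Connected) (E : Multiset (Sym2 V))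
    (hE : ∀ e ∈ E, e ∈ G.edgeSet) (hTE : ∀ e ∈ T.edgeSet, e ∈ E) (hd : ∀ x, dg E x = 0)
    (n : ℕ) : ∀ (r : V) (w : G.Walk r r), (w.edges : Multiset (Sym2 V)) ≤ E →
      E.card ≤ w.length + n →
      ∃ (r : V) (w : G.Walk r r), (∀ x, x ∈ w.support) ∧ w.length ≤ E.card := by
  induction n using Nat.strong_induction_on with
  | _ n ih =>
    intro r w hw hn
    by_cases hall : ∀ x, x ∈ w.support
    · refine ⟨r, w, hall, ?_⟩
      have := Multiset.card_le_card hw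
      simpa using this
    push Not at hall
    obtain ⟨y, hy⟩ := hall
    obtain ⟨a, b, hab, ha, hb⟩ := boundary hT {v | v ∈ w.support} w.start_mem_support hy
    simp only [Set.mem_ofPred_eq] at ha hb
    obtain ⟨F, rfl⟩ := Multiset.le_iff_exists_add.1 hw
    have hmem : s(a, b) ∈ F := by
      rcases Multiset.mem_add.1 (hTE s(a, b) hab) with h | h
      · exact absurd (w.snd_mem_support_of_mem_edges (by simpa using h)) hb
      · exact h
    obtain ⟨F', rfl⟩ := Multiset.exists_cons_of_mem hmem
    have hadj : G.Adj a b := hE s(a, b) (by simp)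
    obtain ⟨q, hq⟩ := path_of_parity (G := G) _ F' b a rfl
      (fun e he => hE e (by simp [he])) (by
        intro x
        have := hd x
        rw [dg_add, dg_walk, dg_cons hadj.ne] at this
        have h1 := z2 (ind r x)
        have h2 := z2 (ind a x)
        have h3 := z2 (ind b x)
        linear_combination this - h1 - h2 - h3)
    have hl : (w.rotate a ha).length = w.length := by
      have := congrArg Multiset.card (rot_edges w ha)
      simpa using this
    have hle : (((w.rotate a ha).append (Walk.cons hadj q)).edges : Multiset (Sym2 V)) ≤
        (w.edges : Multiset (Sym2 V)) + s(a, b) ::ₘ F' := by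
      rw [Walk.edges_append, ← Multiset.coe_add, rot_edges, Walk.edges_cons, ← Multiset.cons_coe]
      gcongr
      exact Multiset.cons_le_cons _ hq
    have hc := Multiset.card_le_card hle
    have hlen : ((w.rotate a ha).append (Walk.cons hadj q)).length = w.length + (q.length + 1) := by
      simp [hl]
    rw [Multiset.coe_card, Walk.length_edges, hlen] at hc
    refine ih (n - (q.length + 1)) (by omega) a _ hle ?_
    rw [hlen]
    omega

lemma tjoin [Fintype V] {G : SimpleGraph V} {a b : V} (p : G.Walk a b) : ∀ (f : V → ZMod 2),
    (∀ x, f x ≠ 0 → x ∈ p.support) →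
    ∃ J : Multiset (Sym2 V), J ≤ (p.edges : Multiset (Sym2 V)) ∧
      ∀ x, dg J x = f x + (∑ y, f y) * ind b x := by
  induction p with
  | @nil a =>
    intro f hf
    refine ⟨0, by simp, fun x => ?_⟩
    have h0 : ∀ y, y ≠ a → f y = 0 := by
      intro y hy
      by_contra h
      exact hy (by simpa using hf y h)
    rw [Finset.sum_eq_single a (fun y _ hy => h0 y hy) (by simp)]
    by_cases hx : x = a
    · subst hx; simp [dg, ind, z2]
    · simp [dg, ind, hx, h0 x hx]
  | @cons a a' b h p ih =>
    intro f hf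
    rcases z2c (f a) with h0 | h1
    · obtain ⟨J, hJ, hd⟩ := ih f (by
        intro x hx
        have := hf x hx
        rw [Walk.support_cons, List.mem_cons] at this
        rcases this with rfl | h
        · exact absurd h0 hx
        · exact h)
      refine ⟨J, hJ.trans ?_, hd⟩
      rw [Walk.edges_cons, ← Multiset.cons_coe]
      exact Multiset.le_cons_self _ _
    · obtain ⟨J, hJ, hd⟩ := ih (fun x => f x + ind a x + ind a' x) (by
        intro x hx
        by_cases hxa : x = a
        · subst hxa
          simp [h1, ind, h.ne, z2] at hx
        by_cases hxa' : x = a'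
        · subst hxa'; exact p.start_mem_support
        have := hf x (by simpa [ind, hxa, hxa'] using hx)
        simpa [hxa] using this)
      refine ⟨s(a, a') ::ₘ J, ?_, fun x => ?_⟩
      · rw [Walk.edges_cons, ← Multiset.cons_coe]
        exact Multiset.cons_le_cons _ hJ
      · have hs : ∑ y, (f y + ind a y + ind a' y) = ∑ y, f y := by
          simp [Finset.sum_add_distrib, ind, add_assoc, z2]
        rw [dg_cons h.ne, hd, hs]
        have h2 := z2 (ind a x)
        have h3 := z2 (ind a' x)
        linear_combination h2 + h3

lemma dg_sum [Fintype V] {G : SimpleGraph V} (F : Multiset (Sym2 V)) :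
    (∀ e ∈ F, e ∈ G.edgeSet) → ∑ x, dg F x = 0 := by
  induction F using Multiset.induction_on with
  | empty => simp [dg]
  | cons e F ih =>
    intro hF
    induction e using Sym2.ind with
    | _ a b =>
      have hadj : G.Adj a b := hF s(a, b) (by simp)
      simp_rw [dg_cons hadj.ne]
      rw [Finset.sum_add_distrib, ih (fun e he => hF e (by simp [he]))]
      simp [Finset.sum_add_distrib, ind, z2]

lemma dg_tree [Fintype V] (T : SimpleGraph V) (x : V) :
    dg T.edgeFinset.val x = (((T.neighborSet x).ncard : ℕ) : ZMod 2) := by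
  unfold dg
  congr 1
  rw [Multiset.countP_eq_card_filter, Set.ncard_eq_toFinset_card']
  have h : (T.edgeFinset.filter (fun e => x ∈ e)).card = T.degree x := by
    rw [← T.card_incidenceFinset_eq_degree, T.incidenceFinset_eq_filter]
  rw [Set.toFinset_card, T.card_neighborSet_eq_degree, ← h]
  rfl

lemma tour2 [Fintype V] {G : SimpleGraph V} (hG : G.Connected) (k n : ℕ) :
    ∀ (r : V) (w : G.Walk r r), Fintype.card V ≤ w.support.toFinset.card + n →
      w.length + k ≤ 2 * w.support.toFinset.card →
      ∃ (r : V) (w : G.Walk r r), (∀ x, x ∈ w.support) ∧ w.length + k ≤ 2 * Fintype.card V := by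
  induction n with
  | zero =>
    intro r w hn hk
    have h1 := Finset.card_le_univ w.support.toFinset
    have h2 : w.support.toFinset = Finset.univ := by
      rw [← Finset.card_eq_iff_eq_univ]; omega
    refine ⟨r, w, fun x => ?_, by omega⟩
    have := Finset.mem_univ x
    rw [← h2] at this
    simpa using this
  | succ n ih =>
    intro r w hn hk
    by_cases hall : ∀ x, x ∈ w.support
    · refine ⟨r, w, hall, ?_⟩
      have h1 := Finset.card_le_univ w.support.toFinset
      omega
    push Not at hall
    obtain ⟨y, hy⟩ := hall
    obtain ⟨a, b, hab, ha, hb⟩ := boundary hG {v | v ∈ w.support} w.start_mem_support hy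
    simp only [Set.mem_ofPred_eq] at ha hb
    let w' := (w.rotate a ha).append (Walk.cons hab (Walk.cons hab.symm Walk.nil))
    have hl : (w.rotate a ha).length = w.length := by
      have := congrArg Multiset.card (rot_edges w ha)
      simpa using this
    have hlen : w'.length = w.length + 2 := by simp [w', hl]
    have hsub : insert b w.support.toFinset ⊆ w'.support.toFinset := by
      intro x hx
      simp only [Finset.mem_insert, List.mem_toFinset] at hx
      simp only [w', List.mem_toFinset, Walk.mem_support_append_iff]
      rcases hx with rfl | hx
      · right; simp
      · left; simpa using hx
    have hc := Finset.card_le_card hsub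
    rw [Finset.card_insert_of_notMem (by simpa using hb)] at hc
    exact ih a w' (by omega) (by omega)

lemma tour1 [Fintype V] {G T : SimpleGraph V} (hTG : T ≤ G) (hT : T.IsTree)
    (u : V) (c : G.Walk u u)
    (hodd : ∀ v : V, Odd (T.neighborSet v).ncard → v ∈ c.support) :
    ∃ (r : V) (w : G.Walk r r), (∀ x, x ∈ w.support) ∧
      2 * w.length ≤ 2 * Fintype.card V + c.length := by
  have hTe : ∀ e ∈ T.edgeFinset.val, e ∈ T.edgeSet := fun e he => by simpa using he
  obtain ⟨J, hJ, hd⟩ := tjoin c (dg T.edgeFinset.val) (by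
    intro x hx
    apply hodd
    rw [dg_tree] at hx
    rw [← Nat.not_even_iff_odd]
    intro he
    exact hx ((ZMod.natCast_eq_zero_iff_even).2 he))
  rw [dg_sum (G := T) _ hTe] at hd
  have main : ∃ J : Multiset (Sym2 V), J ≤ (c.edges : Multiset (Sym2 V)) ∧
      (∀ x, dg J x = dg T.edgeFinset.val x) ∧ 2 * J.card ≤ c.length := by
    obtain ⟨K, hK⟩ := Multiset.le_iff_exists_add.1 hJ
    have hcard := congrArg Multiset.card hK
    rw [Multiset.coe_card, Walk.length_edges, Multiset.card_add] at hcard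
    by_cases h : 2 * J.card ≤ c.length
    · exact ⟨J, hJ, fun x => by simp [hd], h⟩
    · refine ⟨K, hK ▸ Multiset.le_add_left _ _, fun x => ?_, by omega⟩
      have h1 := dg_walk c x
      rw [hK, dg_add, hd, z2] at h1
      have h2 := z2 (dg T.edgeFinset.val x)
      linear_combination h1 - h2
  obtain ⟨J, hJ, hd, hc⟩ := main
  obtain ⟨r, w, hw, hl⟩ := euler (G := G) hT.connected (T.edgeFinset.val + J) (by
      intro e he
      rcases Multiset.mem_add.1 he with h | h
      · exact edgeSet_mono hTG (hTe e h)
      · exact c.edges_subset_edgeSet (by simpa using Multiset.mem_of_le hJ h))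
    (fun e he => Multiset.mem_add.2 (Or.inl (by simpa using he)))
    (fun x => by rw [dg_add, hd, z2]) _ u Walk.nil (by simp) (Nat.le_add_left _ _)
  refine ⟨r, w, hw, ?_⟩
  have h3 := hT.card_edgeFinset
  rw [Multiset.card_add] at hl
  have h4 : T.edgeFinset.val.card = T.edgeFinset.card := rfl
  omega

end TSPAux

/-- If `G` is a connected simple graph on `n` vertices, `T` is a
spanning tree of `G`, and there is a simple cycle of `G` whose vertex set contains
every vertex of odd degree in `T`, then `G` has a TSP tour (a closed walk visiting
every vertex) of length at most `4n/3`. -/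
theorem graphTSP_from_steiner_cycle {V : Type*} [Fintype V]
    (G : SimpleGraph V) (hG : G.Connected)
    (T : SimpleGraph V) (hTG : T ≤ G) (hT : T.IsTree)
    (u : V) (c : G.Walk u u) (hc : c.IsCycle)
    (hodd : ∀ v : V, Odd (T.neighborSet v).ncard → v ∈ c.support) :
    ∃ (r : V) (w : G.Walk r r), (∀ x : V, x ∈ w.support) ∧
      (w.length : ℚ) ≤ 4 * (Fintype.card V) / 3 := by
  classical
  by_cases hk : 3 * c.length ≤ 2 * Fintype.card V
  · obtain ⟨r, w, hw, hl⟩ := TSPAux.tour1 hTG hT u c hodd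
    refine ⟨r, w, hw, ?_⟩
    rw [le_div_iff₀ (by norm_num)]
    have : w.length * 3 ≤ 4 * Fintype.card V := by omega
    exact_mod_cast this
  · have hs : c.length ≤ c.support.toFinset.card := by
      have h1 : c.support.tail.toFinset.card = c.length := by
        rw [List.toFinset_card_of_nodup hc.support_nodup]
        simp
      rw [← h1]
      apply Finset.card_le_card
      intro x hx
      rw [List.mem_toFinset] at hx ⊢
      exact List.mem_of_mem_tail hx
    obtain ⟨r, w, hw, hl⟩ := TSPAux.tour2 hG c.length (Fintype.card V) u c (Nat.le_add_left _ _)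
      (by convert (show c.length + c.length ≤ 2 * c.support.toFinset.card by omega))
    refine ⟨r, w, hw, ?_⟩
    rw [le_div_iff₀ (by norm_num)]
    have : w.length * 3 ≤ 4 * Fintype.card V := by omega
    exact_mod_cast this
end

section
/- Let G be a connected simple graph on n vertices and let C be a simple cycle in G containing |C| vertices. Then G has a TSP tour of length at most 2n - |C|. In particular, if |C| > 2n/3 then G has a TSP tour of length at most 4n/3. -/
theorem tsp_extend_aux {V : Type*} [Fintype V] [DecidableEq V]
    (G : SimpleGraph V) (hG : G.Connected) (u : V) (k : ℕ) (m : ℕ) :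
    ∀ w : G.Walk u u, Fintype.card V - w.support.toFinset.card ≤ m →
      w.length + k ≤ 2 * w.support.toFinset.card →
      ∃ w' : G.Walk u u, (∀ x : V, x ∈ w'.support) ∧ w'.length + k ≤ 2 * Fintype.card V := by
  induction m with
  | zero =>
    intro w h1 h2
    have h3 := Finset.card_le_univ w.support.toFinset
    have h4 : w.support.toFinset = Finset.univ := by
      rw [← Finset.card_eq_iff_eq_univ]; omega
    refine ⟨w, fun x => ?_, by omega⟩
    rw [← List.mem_toFinset, h4]; exact Finset.mem_univ x
  | succ m ih =>
    intro w h1 h2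
    have h3 := Finset.card_le_univ w.support.toFinset
    by_cases hall : ∀ x : V, x ∈ w.support
    · exact ⟨w, hall, by omega⟩
    · push Not at hall
      obtain ⟨z, hz⟩ := hall
      obtain ⟨p⟩ := hG.preconnected u z
      obtain ⟨d, -, hd1, hd2⟩ := p.exists_boundary_dart {x | x ∈ w.support}
        (by simp) (by simpa using hz)
      obtain ⟨⟨x, y⟩, hxy⟩ := d
      simp only [Set.mem_setOf_eq] at hd1 hd2 hxy
      have hlen := congrArg SimpleGraph.Walk.length (w.take_spec hd1)
      rw [SimpleGraph.Walk.length_append] at hlen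
      let w' : G.Walk u u := (w.takeUntil x hd1).append
        (SimpleGraph.Walk.cons hxy (SimpleGraph.Walk.cons hxy.symm (w.dropUntil x hd1)))
      have hl : w'.length = w.length + 2 := by
        simp only [w', SimpleGraph.Walk.length_append, SimpleGraph.Walk.length_cons]; omega
      have hsub : insert y w.support.toFinset ⊆ w'.support.toFinset := by
        intro a ha
        rw [Finset.mem_insert, List.mem_toFinset] at ha
        rw [List.mem_toFinset]
        simp only [w', SimpleGraph.Walk.mem_support_append_iff, SimpleGraph.Walk.support_cons,
          List.mem_cons]
        rcases ha with rfl | ha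
        · tauto
        · rw [← w.take_spec hd1, SimpleGraph.Walk.mem_support_append_iff] at ha
          tauto
      have hcard := Finset.card_le_card hsub
      rw [Finset.card_insert_of_notMem (by simpa using hd2)] at hcard
      exact ih w' (by omega) (by omega)

/-- If `G` is a connected simple graph on `n` vertices and `C` is a
simple cycle in `G` (whose number of vertices equals its length), then `G` has a TSP
tour of length at most `2n - |C|`; in particular, if `|C| > 2n/3` then `G` has a
TSP tour of length at most `4n/3`. -/
theorem graphTSP_double_tree_with_cycle {V : Type*} [Fintype V]
    (G : SimpleGraph V) (hG : G.Connected)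
    (u : V) (c : G.Walk u u) (hc : c.IsCycle) :
    (∃ (r : V) (w : G.Walk r r), (∀ x : V, x ∈ w.support) ∧
      (w.length : ℤ) ≤ 2 * (Fintype.card V) - c.length) ∧
    (2 * (Fintype.card V : ℚ) / 3 < (c.length : ℚ) →
      ∃ (r : V) (w : G.Walk r r), (∀ x : V, x ∈ w.support) ∧
        (w.length : ℚ) ≤ 4 * (Fintype.card V) / 3) := by
  classical
  have hle : c.length ≤ c.support.toFinset.card := by
    have h1 : c.support.tail.toFinset.card = c.length := by
      rw [List.toFinset_card_of_nodup hc.support_nodup]; simp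
    rw [← h1]
    apply Finset.card_le_card
    intro a ha
    rw [List.mem_toFinset] at ha ⊢
    exact List.mem_of_mem_tail ha
  obtain ⟨w, hw, hl⟩ := tsp_extend_aux G hG u c.length _ c le_rfl (by omega)
  refine ⟨⟨u, w, hw, by omega⟩, fun h => ⟨u, w, hw, ?_⟩⟩
  have hl' : (w.length : ℚ) + c.length ≤ 2 * Fintype.card V := by exact_mod_cast hl
  linarith
end

section
/- Let G be a connected simple graph on n vertices, let T be a spanning tree of G, and let C be a simple cycle in G whose vertex set contains every vertex of odd degree in T. Then G has a TSP tour of length at most (n - 1) + |C|/2. In particular, if |C| ≤ 2n/3 then G has a TSP tour of length at most 4n/3. -/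
open Classical in
noncomputable def edgeInd {V : Type*} (x : V) (e : Sym2 V) : ZMod 2 := if x ∈ e then 1 else 0

noncomputable def parityDeg {V : Type*} (M : Multiset (Sym2 V)) (x : V) : ZMod 2 :=
  (M.map (edgeInd x)).sum

open Classical in
theorem edgeInd_mk {V : Type*} {a b : V} (h : a ≠ b) (x : V) :
    edgeInd x s(a, b) = (if x = a then 1 else 0) + (if x = b then 1 else 0) := by
  unfold edgeInd
  by_cases h1 : x = a <;> by_cases h2 : x = b <;> simp_all

theorem parityDeg_add {V : Type*} (M N : Multiset (Sym2 V)) (x : V) :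
    parityDeg (M + N) x = parityDeg M x + parityDeg N x := by
  simp [parityDeg]

theorem parityDeg_cons {V : Type*} (e : Sym2 V) (N : Multiset (Sym2 V)) (x : V) :
    parityDeg (e ::ₘ N) x = edgeInd x e + parityDeg N x := by
  simp [parityDeg]

theorem zmod2_add_self (a : ZMod 2) : a + a = 0 := by
  revert a; decide

open Classical in
theorem parityDeg_walk {V : Type*} {G : SimpleGraph V} {a b : V} (p : G.Walk a b) (x : V) :
    parityDeg (p.edges : Multiset (Sym2 V)) x
      = (if x = a then 1 else 0) + (if x = b then 1 else 0) := by
  induction p with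
  | nil => simp [parityDeg, zmod2_add_self]
  | @cons u v w h p ih =>
    rw [SimpleGraph.Walk.edges_cons, ← Multiset.cons_coe, parityDeg_cons, ih, edgeInd_mk h.ne]
    have := zmod2_add_self (if x = v then 1 else 0)
    linear_combination this

open Classical in
theorem parityDeg_sum {V : Type*} [Fintype V] (M : Multiset (Sym2 V))
    (hM : ∀ e ∈ M, ¬ e.IsDiag) : ∑ x, parityDeg M x = 0 := by
  induction M using Multiset.induction_on with
  | empty => simp [parityDeg]
  | cons e M ih =>
    simp only [parityDeg_cons, Finset.sum_add_distrib]
    rw [ih (fun e he => hM e (Multiset.mem_cons_of_mem he))]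
    have h := hM e (Multiset.mem_cons_self _ _)
    induction e with
    | h a b =>
      simp only [Sym2.mk_isDiag_iff] at h
      simp [edgeInd_mk h, Finset.sum_add_distrib, zmod2_add_self]

open Classical in
theorem join_walk {V : Type*} {G : SimpleGraph V} {a b : V} (p : G.Walk a b) :
    ∀ f : V → ZMod 2, (∀ x, f x ≠ 0 → x ∈ p.support) →
    ∃ J : Multiset (Sym2 V), J ≤ (p.edges : Multiset (Sym2 V)) ∧
      ∀ x, x ≠ b → parityDeg J x = f x := by
  induction p with
  | nil =>
    intro f hf
    refine ⟨0, by simp, fun x hx => ?_⟩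
    by_contra h
    exact hx (by simpa using hf x (fun h' => h (by simp [h', parityDeg])))
  | @cons u v w h p ih =>
    intro f hf
    by_cases hu : f u = 0
    · obtain ⟨J, hJ, hx⟩ := ih f (fun x hx => by
        have := hf x hx
        rw [SimpleGraph.Walk.support_cons, List.mem_cons] at this
        rcases this with rfl | h
        · exact absurd hu hx
        · exact h)
      exact ⟨J, hJ.trans (by
        rw [SimpleGraph.Walk.edges_cons, ← Multiset.cons_coe]
        exact Multiset.le_cons_self _ _), hx⟩
    · have hu1 : f u = 1 := by
        generalize f u = t at hu
        revert t; decide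
      obtain ⟨J, hJ, hx⟩ := ih (fun x => f x + edgeInd x s(u, v)) (fun x hx => by
        by_cases hxu : x = u
        · subst hxu
          exact absurd (by simp [hu1, edgeInd, zmod2_add_self]) hx
        by_cases hxv : x = v
        · subst hxv; simp
        have := hf x (by simpa [edgeInd, hxu, hxv] using hx)
        simpa [hxu] using this)
      refine ⟨s(u, v) ::ₘ J, ?_, fun x hxw => ?_⟩
      · rw [SimpleGraph.Walk.edges_cons, ← Multiset.cons_coe]
        exact Multiset.cons_le_cons _ hJ
      · rw [parityDeg_cons, hx x hxw]
        linear_combination zmod2_add_self (edgeInd x s(u, v))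

theorem join_closed {V : Type*} [Fintype V] {G : SimpleGraph V} {a : V} (p : G.Walk a a)
    (f : V → ZMod 2) (hf : ∀ x, f x ≠ 0 → x ∈ p.support) (hs : ∑ x, f x = 0) :
    ∃ J : Multiset (Sym2 V), J ≤ (p.edges : Multiset (Sym2 V)) ∧
      (∀ x, parityDeg J x = f x) ∧ 2 * J.card ≤ p.length := by
  classical
  obtain ⟨J, hJ, hx⟩ := join_walk p f hf
  have hJG : ∀ e ∈ J, ¬ e.IsDiag := fun e he =>
    G.not_isDiag_of_mem_edgeSet (p.edges_subset_edgeSet (Multiset.mem_of_le hJ he))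
  have hall : ∀ x, parityDeg J x = f x := by
    intro x
    by_cases hxa : x = a
    · subst hxa
      have h1 := parityDeg_sum J hJG
      rw [← Finset.add_sum_erase _ _ (Finset.mem_univ x)] at h1 hs
      rw [Finset.sum_congr rfl (fun y hy => hx y (Finset.ne_of_mem_erase hy))] at h1
      linear_combination h1 - hs
    · exact hx x hxa
  by_cases hc : 2 * J.card ≤ p.length
  · exact ⟨J, hJ, hall, hc⟩
  · obtain ⟨K, hK⟩ := Multiset.le_iff_exists_add.1 hJ
    refine ⟨K, hK ▸ Multiset.le_add_left _ _, fun x => ?_, ?_⟩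
    · have := parityDeg_walk p x
      rw [hK, parityDeg_add, hall, zmod2_add_self] at this
      linear_combination this - zmod2_add_self (f x)
    · have := congrArg Multiset.card hK
      simp at this
      omega

theorem exists_edge_of_parityDeg {V : Type*} (M : Multiset (Sym2 V)) (x : V)
    (h : parityDeg M x ≠ 0) : ∃ y, s(x, y) ∈ M := by
  by_contra hn
  push Not at hn
  apply h
  apply Multiset.sum_eq_zero
  intro t ht
  obtain ⟨e, he, rfl⟩ := Multiset.mem_map.1 ht
  unfold edgeInd
  rw [if_neg]
  rintro ⟨y, rfl⟩
  exact hn y he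

/-- In an even multigraph, any edge at `x` allows a nontrivial closed walk from `x`. -/
theorem exists_closed {V : Type*} {G : SimpleGraph V} (M : Multiset (Sym2 V))
    (hM : ∀ e ∈ M, e ∈ G.edgeSet) (hev : ∀ x, parityDeg M x = 0) (x y : V) (hxy : s(x, y) ∈ M) :
    ∃ w : G.Walk x x, (w.edges : Multiset (Sym2 V)) ≤ M ∧ 0 < w.length := by
  classical
  by_contra hno
  have key : ∀ k : ℕ, ∃ (z : V) (w : G.Walk x z), (w.edges : Multiset (Sym2 V)) ≤ M ∧
      k < w.length := by
    intro k
    induction k with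
    | zero =>
      have hadj : G.Adj x y := hM s(x, y) hxy
      refine ⟨y, SimpleGraph.Walk.cons hadj .nil, ?_, by simp⟩
      simpa using hxy
    | succ k ih =>
      obtain ⟨z, w, hw, hk⟩ := ih
      by_cases hz : z = x
      · subst hz
        exact absurd ⟨w, hw, by omega⟩ hno
      · obtain ⟨K, hK⟩ := Multiset.le_iff_exists_add.1 hw
        have h1 := hev z
        rw [hK, parityDeg_add, parityDeg_walk] at h1
        obtain ⟨t, ht⟩ := exists_edge_of_parityDeg K z (by
          intro h0; simp [h0, hz] at h1)
        have hzt : G.Adj z t := hM s(z, t) (hK ▸ Multiset.mem_add.2 (Or.inr ht))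
        refine ⟨t, w.concat hzt, ?_, by simp; omega⟩
        rw [SimpleGraph.Walk.edges_concat, List.concat_eq_append, ← Multiset.coe_add, hK]
        simpa using ht
  obtain ⟨z, w, hw, hk⟩ := key M.card
  have := Multiset.card_le_card hw
  simp at this
  omega

theorem euler_tour {V : Type*} {G T : SimpleGraph V} (hT : T.Connected) (M : Multiset (Sym2 V))
    (hM : ∀ e ∈ M, e ∈ G.edgeSet) (hev : ∀ x, parityDeg M x = 0)
    (hTM : ∀ e ∈ T.edgeSet, e ∈ M) :
    ∃ (r : V) (w : G.Walk r r), (∀ x : V, x ∈ w.support) ∧ w.length ≤ M.card := by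
  classical
  by_contra hno
  have key : ∀ k : ℕ, ∃ (z : V) (w : G.Walk z z), (w.edges : Multiset (Sym2 V)) ≤ M ∧
      k ≤ w.length := by
    intro k
    induction k with
    | zero =>
      obtain ⟨r⟩ := hT.nonempty
      exact ⟨r, .nil, by simp, by simp⟩
    | succ k ih =>
      obtain ⟨z, w, hw, hk⟩ := ih
      have hlen : w.length ≤ M.card := by simpa using Multiset.card_le_card hw
      have : ∃ v, v ∉ w.support := by
        by_contra! hcon
        exact hno ⟨z, w, hcon, hlen⟩
      obtain ⟨v, hv⟩ := this
      obtain ⟨q⟩ := hT.preconnected z v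
      obtain ⟨d, hd, hd1, hd2⟩ := q.exists_boundary_dart {x | x ∈ w.support}
        (by simp) hv
      simp only [Set.mem_ofPred_eq] at hd1 hd2
      obtain ⟨K, hK⟩ := Multiset.le_iff_exists_add.1 hw
      have hdM : s(d.fst, d.snd) ∈ M := hTM _ d.adj
      have hdK : s(d.fst, d.snd) ∈ K := by
        rw [hK, Multiset.mem_add] at hdM
        rcases hdM with h | h
        · exact absurd (w.snd_mem_support_of_mem_edges h) hd2
        · exact h
      obtain ⟨w', hw', hpos⟩ := exists_closed (G := G) K
        (fun e he => hM e (hK ▸ Multiset.mem_add.2 (Or.inr he)))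
        (fun x => by
          have := hev x
          rw [hK, parityDeg_add, parityDeg_walk, zmod2_add_self] at this
          simpa using this) _ _ hdK
      refine ⟨d.fst, (w.rotate d.fst hd1).append w', ?_, ?_⟩
      · rw [SimpleGraph.Walk.edges_append, ← Multiset.coe_add, hK]
        have : ((w.rotate d.fst hd1).edges : Multiset (Sym2 V)) = w.edges :=
          Multiset.coe_eq_coe.2 (w.rotate_edges d.fst hd1).perm
        rw [this]
        gcongr
      · have : (w.rotate d.fst hd1).length = w.length := by
          rw [← SimpleGraph.Walk.length_edges, ← SimpleGraph.Walk.length_edges]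
          exact (w.rotate_edges d.fst hd1).perm.length_eq
        simp [this]
        omega
  obtain ⟨z, w, hw, hk⟩ := key (M.card + 1)
  have := Multiset.card_le_card hw
  simp at this
  omega

theorem parityDeg_graph {V : Type*} [Fintype V] (T : SimpleGraph V) [Fintype T.edgeSet] (x : V) :
    parityDeg T.edgeFinset.val x = ((T.neighborSet x).ncard : ZMod 2) := by
  classical
  have h1 : (T.neighborSet x).ncard = T.degree x := by
    rw [Set.ncard_eq_toFinset_card', SimpleGraph.degree, SimpleGraph.neighborFinset]
  rw [h1, ← SimpleGraph.card_incidenceFinset_eq_degree, SimpleGraph.incidenceFinset_eq_filter]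
  change ∑ e ∈ T.edgeFinset, edgeInd x e = _
  unfold edgeInd
  rw [Finset.sum_boole]

/-- If `G` is a connected simple graph on `n` vertices, `T` is a
spanning tree of `G`, and `C` is a simple cycle whose vertex set contains every
vertex of odd degree in `T`, then `G` has a TSP tour of length at most
`(n - 1) + |C|/2`; in particular, if `|C| ≤ 2n/3` then `G` has a TSP tour of
length at most `4n/3`. -/
theorem graphTSP_christofides_with_cycle {V : Type*} [Fintype V]
    (G : SimpleGraph V) (hG : G.Connected)
    (T : SimpleGraph V) (hTG : T ≤ G) (hT : T.IsTree)
    (u : V) (c : G.Walk u u) (hc : c.IsCycle)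
    (hodd : ∀ v : V, Odd (T.neighborSet v).ncard → v ∈ c.support) :
    (∃ (r : V) (w : G.Walk r r), (∀ x : V, x ∈ w.support) ∧
      (w.length : ℚ) ≤ ((Fintype.card V : ℚ) - 1) + (c.length : ℚ) / 2) ∧
    ((c.length : ℚ) ≤ 2 * (Fintype.card V : ℚ) / 3 →
      ∃ (r : V) (w : G.Walk r r), (∀ x : V, x ∈ w.support) ∧
        (w.length : ℚ) ≤ 4 * (Fintype.card V) / 3) := by
  classical
  have main : ∃ (r : V) (w : G.Walk r r), (∀ x : V, x ∈ w.support) ∧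
      (w.length : ℚ) ≤ ((Fintype.card V : ℚ) - 1) + (c.length : ℚ) / 2 := by
    obtain ⟨J, hJ, hpar, hcard⟩ := join_closed c (parityDeg T.edgeFinset.val)
      (fun x hx => hodd x (by
        rw [parityDeg_graph] at hx
        rw [← Nat.not_even_iff_odd]
        intro he
        exact hx ((ZMod.natCast_eq_zero_iff_even).2 he)))
      (parityDeg_sum _ (fun e he => T.not_isDiag_of_mem_edgeSet (by simpa using he)))
    obtain ⟨r, w, hw, hl⟩ := euler_tour (G := G) hT.connected (T.edgeFinset.val + J)
      (fun e he => by
        rcases Multiset.mem_add.1 he with h | h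
        · exact SimpleGraph.edgeSet_mono hTG (by simpa using h)
        · exact c.edges_subset_edgeSet (Multiset.mem_of_le hJ h))
      (fun x => by rw [parityDeg_add, hpar, zmod2_add_self])
      (fun e he => Multiset.mem_add.2 (Or.inl (by simpa using he)))
    refine ⟨r, w, hw, ?_⟩
    have h1 := hT.card_edgeFinset
    rw [Multiset.card_add, Finset.card_val] at hl
    have h2 : 2 * w.length + 2 ≤ 2 * Fintype.card V + c.length := by omega
    have h3 : (2 * w.length + 2 : ℚ) ≤ 2 * Fintype.card V + c.length := by exact_mod_cast h2
    linarith
  refine ⟨main, fun h => ?_⟩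
  obtain ⟨r, w, hw, hl⟩ := main
  exact ⟨r, w, hw, by linarith⟩
end

section
/- Let G be a 2-vertex-connected simple graph on n vertices that contains a Hamiltonian path. Then G has a TSP tour of length at most 4n/3. -/
/-- There is a walk from `u` to `v` of length `L` which visits all `f k`, `k ∈ S`. -/
def TourR {V : Type*} (G : SimpleGraph V) (f : ℕ → V) (u v : V) (L : ℕ) (S : Set ℕ) : Prop :=
  ∃ w : G.Walk u v, w.length = L ∧ ∀ k ∈ S, f k ∈ w.support

theorem TourR.trans {V : Type*} {G : SimpleGraph V} {f : ℕ → V} {u v x : V} {L M : ℕ}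
    {S T : Set ℕ} (h : TourR G f u v L S) (h' : TourR G f v x M T) :
    TourR G f u x (L + M) (S ∪ T) := by
  obtain ⟨w, hw, hS⟩ := h
  obtain ⟨w', hw', hT⟩ := h'
  refine ⟨w.append w', by simp [hw, hw'], ?_⟩
  rintro k (hk | hk)
  · exact (SimpleGraph.Walk.mem_support_append_iff _ _).2 (Or.inl (hS k hk))
  · exact (SimpleGraph.Walk.mem_support_append_iff _ _).2 (Or.inr (hT k hk))

theorem TourR.symm {V : Type*} {G : SimpleGraph V} {f : ℕ → V} {u v : V} {L : ℕ}
    {S : Set ℕ} (h : TourR G f u v L S) : TourR G f v u L S := by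
  obtain ⟨w, hw, hS⟩ := h
  exact ⟨w.reverse, by simp [hw], fun k hk => by simpa using hS k hk⟩

theorem TourR.cast {V : Type*} {G : SimpleGraph V} {f : ℕ → V} {u v : V} {L M : ℕ}
    {S T : Set ℕ} (h : TourR G f u v L S) (hL : L = M) (hT : ∀ k ∈ T, k ∈ S) :
    TourR G f u v M T := by
  obtain ⟨w, hw, hS⟩ := h
  exact ⟨w, hw.trans hL, fun k hk => hS k (hT k hk)⟩

theorem TourR.edge {V : Type*} {G : SimpleGraph V} {f : ℕ → V} {i j : ℕ}
    (h : G.Adj (f i) (f j)) : TourR G f (f i) (f j) 1 {k | k = i ∨ k = j} := by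
  refine ⟨h.toWalk, by simp, ?_⟩
  rintro k (rfl | rfl) <;> simp

theorem TourR.seg {V : Type*} {G : SimpleGraph V} {f : ℕ → V} {N : ℕ}
    (hf : ∀ i < N, G.Adj (f i) (f (i + 1))) (i d : ℕ) (h : i + d ≤ N) :
    TourR G f (f i) (f (i + d)) d {k | i ≤ k ∧ k ≤ i + d} := by
  induction d with
  | zero =>
    refine ⟨SimpleGraph.Walk.nil, by simp, ?_⟩
    rintro k ⟨h1, h2⟩
    obtain rfl : k = i := by omega
    simp
  | succ d ih =>
    refine ((ih (by omega)).trans (TourR.edge (hf (i + d) (by omega)))).cast rfl ?_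
    rintro k ⟨h1, h2⟩
    simp only [Set.mem_union, Set.mem_ofPred_eq]
    omega

theorem TourR.seg' {V : Type*} {G : SimpleGraph V} {f : ℕ → V} {N : ℕ}
    (hf : ∀ i < N, G.Adj (f i) (f (i + 1))) (i j : ℕ) (hij : i ≤ j) (h : j ≤ N) :
    TourR G f (f i) (f j) (j - i) {k | i ≤ k ∧ k ≤ j} := by
  obtain ⟨d, rfl⟩ := Nat.exists_eq_add_of_le hij
  exact (TourR.seg hf i d h).cast (by omega) (fun k hk => hk)

theorem TourR.reach {V : Type*} {G : SimpleGraph V} {f : ℕ → V} {N : ℕ} (r : ℕ)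
    (h : ∃ i j, i < r ∧ j ≤ N ∧ G.Adj (f i) (f j)) :
    ∃ i j, i < r ∧ j ≤ N ∧ G.Adj (f i) (f j) ∧
      ∀ i' j', i' < r → j' ≤ N → G.Adj (f i') (f j') → j' ≤ j := by
  classical
  let P : ℕ → Prop := fun j => ∃ i, i < r ∧ G.Adj (f i) (f j)
  obtain ⟨i, j, hi, hj, hadj⟩ := h
  obtain ⟨i0, hi0, h0⟩ : P (Nat.findGreatest P N) := Nat.findGreatest_spec hj ⟨i, hi, hadj⟩
  exact ⟨i0, _, hi0, Nat.findGreatest_le N, h0, fun i' j' hi' hj' h' =>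
    Nat.le_findGreatest hj' ⟨i', hi', h'⟩⟩

theorem TourR.main {V : Type*} {G : SimpleGraph V} {f : ℕ → V} {N : ℕ}
    (hf : ∀ i < N, G.Adj (f i) (f (i + 1)))
    (hcut : ∀ r, 0 < r → r < N → ∃ i j, i < r ∧ r < j ∧ j ≤ N ∧ G.Adj (f i) (f j))
    (m : ℕ) : ∀ l s r p q w : ℕ, N - r = m → l < s → s < r → r ≤ N → G.Adj (f l) (f r) →
      (∀ i' j', i' < s → j' ≤ N → G.Adj (f i') (f j') → j' ≤ r) →
      TourR G f (f r) (f r) p {k | k ≤ r} → TourR G f (f s) (f s) q {k | k ≤ s} →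
      TourR G f (f l) (f s) w {k | k ≤ l ∨ k = s} → p + q + w = 2 * l + s + r + 3 →
      ∃ t L, TourR G f (f t) (f t) L {k | k ≤ N} ∧ 3 * L ≤ 4 * N + 2 := by
  induction m using Nat.strong_induction_on with
  | _ m ih =>
  intro l s r p q w hm hls hsr hrN hadj hmax hP hQ hW hsum
  have exc : TourR G f (f l) (f l) (2 * (s - 1 - l)) {k | l ≤ k ∧ k ≤ s - 1} :=
    ((TourR.seg' hf l (s - 1) (by omega) (by omega)).trans
      (TourR.seg' hf l (s - 1) (by omega) (by omega)).symm).cast (by omega)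
      (fun k hk => Or.inl hk)
  have base : TourR G f (f s) (f r) (w + 2 * (s - 1 - l) + 1) {k | k ≤ s ∨ k = r} := by
    refine ((hW.symm.trans exc).trans (TourR.edge hadj)).cast rfl ?_
    intro k hk
    simp only [Set.mem_union, Set.mem_ofPred_eq] at hk ⊢
    omega
  by_cases hr : r = N
  · subst hr
    have TD : TourR G f (f s) (f s) (w + 2 * (s - 1 - l) + 1 + (r - s)) {k | k ≤ r} := by
      refine (base.trans (TourR.seg' hf s r (by omega) (by omega)).symm).cast rfl ?_
      intro k hk
      simp only [Set.mem_union, Set.mem_ofPred_eq] at hk ⊢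
      omega
    have TQ : TourR G f (f s) (f s) (q + (r - s) + (r - s)) {k | k ≤ r} := by
      refine ((hQ.trans (TourR.seg' hf s r (by omega) (by omega))).trans
        (TourR.seg' hf s r (by omega) (by omega)).symm).cast rfl ?_
      intro k hk
      simp only [Set.mem_union, Set.mem_ofPred_eq] at hk ⊢
      omega
    by_cases h1 : 3 * p ≤ 4 * r + 2
    · exact ⟨_, _, hP, h1⟩
    by_cases h2 : 3 * (q + (r - s) + (r - s)) ≤ 4 * r + 2
    · exact ⟨_, _, TQ, h2⟩
    exact ⟨_, _, TD, by omega⟩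
  · obtain ⟨i0, j0, hi0, hrj0, hj0, h0⟩ := hcut r (by omega) (by omega)
    obtain ⟨l', r', hl', hr', hadj', hmax'⟩ := TourR.reach (G := G) (f := f) (N := N) r
      ⟨i0, j0, hi0, hj0, h0⟩
    have hrr' : r < r' := lt_of_lt_of_le hrj0 (hmax' _ _ hi0 hj0 h0)
    have hsl' : s ≤ l' := by
      by_contra hc
      have := hmax l' r' (by omega) hr' hadj'
      omega
    refine ih (N - r') (by omega) l' r r' (1 + (l' - s) + q + (l' - s) + (r' - l')) p
      (w + 2 * (s - 1 - l) + 1 + (l' - s)) rfl hl' hrr' hr' hadj' hmax' ?_ hP ?_ (by omega)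
    · refine (((((TourR.edge hadj').symm.trans (TourR.seg' hf s l' hsl' (by omega)).symm).trans
        hQ).trans (TourR.seg' hf s l' hsl' (by omega))).trans
        (TourR.seg' hf l' r' (by omega) (by omega))).cast rfl ?_
      intro k hk
      simp only [Set.mem_union, Set.mem_ofPred_eq] at hk ⊢
      omega
    · refine ((TourR.seg' hf s l' hsl' (by omega)).symm.trans base).cast (by omega) ?_
      intro k hk
      simp only [Set.mem_union, Set.mem_ofPred_eq] at hk ⊢
      omega

theorem TourR.exists_tour {V : Type*} {G : SimpleGraph V} {f : ℕ → V} {N : ℕ} (hN : 2 ≤ N)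
    (hf : ∀ i < N, G.Adj (f i) (f (i + 1)))
    (hcut : ∀ r, 0 < r → r < N → ∃ i j, i < r ∧ r < j ∧ j ≤ N ∧ G.Adj (f i) (f j)) :
    ∃ t L, TourR G f (f t) (f t) L {k | k ≤ N} ∧ 3 * L ≤ 4 * N + 4 := by
  obtain ⟨z, s, hz, hs, hadj, hmax⟩ := TourR.reach (G := G) (f := f) (N := N) 1
    ⟨0, 1, by omega, by omega, hf 0 (by omega)⟩
  obtain rfl : z = 0 := by omega
  have hs1 : 1 ≤ s := hmax 0 1 (by omega) (by omega) (hf 0 (by omega))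
  have hQ : TourR G f (f s) (f s) (1 + s) {k | k ≤ s} := by
    refine ((TourR.edge hadj).symm.trans (TourR.seg' hf 0 s (by omega) (by omega))).cast
      (by omega) ?_
    intro k hk
    simp only [Set.mem_union, Set.mem_ofPred_eq] at hk ⊢
    omega
  by_cases hsN : s = N
  · subst hsN
    exact ⟨_, _, hQ, by omega⟩
  obtain ⟨i0, j0, hi0, hrj0, hj0, h0⟩ := hcut s (by omega) (by omega)
  obtain ⟨l, r, hl, hr, hadj', hmax'⟩ := TourR.reach (G := G) (f := f) (N := N) s
    ⟨i0, j0, hi0, hj0, h0⟩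
  have hsr : s < r := lt_of_lt_of_le hrj0 (hmax' _ _ hi0 hj0 h0)
  have hl0 : 1 ≤ l := by
    by_contra hc
    have := hmax l r (by omega) hr hadj'
    omega
  obtain ⟨t, L, h, h3⟩ := TourR.main hf hcut (N - r) l s r (1 + l + r) (1 + s) (l + 1) rfl hl hsr
    hr hadj' hmax' (by
      refine (((TourR.edge hadj').symm.trans (TourR.seg' hf 0 l (by omega) (by omega)).symm).trans
        (TourR.seg' hf 0 r (by omega) (by omega))).cast (by omega) ?_
      intro k hk
      simp only [Set.mem_union, Set.mem_ofPred_eq] at hk ⊢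
      omega) hQ (by
      refine ((TourR.seg' hf 0 l (by omega) (by omega)).symm.trans (TourR.edge hadj)).cast
        (by omega) ?_
      intro k hk
      simp only [Set.mem_union, Set.mem_ofPred_eq] at hk ⊢
      omega) (by omega)
  exact ⟨t, L, h, by omega⟩

/-- A 2-vertex-connected simple graph on `n` vertices that contains
a Hamiltonian path has a TSP tour of length at most `4n/3`. -/
theorem graphTSP_of_hamiltonian_path {V : Type*} [Fintype V]
    (G : SimpleGraph V)
    (hcard : 3 ≤ Fintype.card V)
    (h2conn : ∀ v : V, (G.induce {v}ᶜ).Connected)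
    (a b : V) (p : G.Walk a b) (hp : p.IsPath) (hspan : ∀ x : V, x ∈ p.support) :
    ∃ (r : V) (w : G.Walk r r), (∀ x : V, x ∈ w.support) ∧
      (w.length : ℚ) ≤ 4 * (Fintype.card V) / 3 := by
  classical
  have hlen : Fintype.card V = p.length + 1 := by
    have h1 : p.support.toFinset = Finset.univ := by
      ext x; simp [hspan x]
    rw [← Finset.card_univ, ← h1, List.toFinset_card_of_nodup hp.support_nodup,
      SimpleGraph.Walk.length_support]
  have hsurj : ∀ x : V, ∃ k, k ≤ p.length ∧ p.getVert k = x := by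
    intro x
    obtain ⟨k, hk, hk'⟩ := SimpleGraph.Walk.mem_support_iff_exists_getVert.1 (hspan x)
    first
      | exact ⟨k, hk', hk⟩
      | exact ⟨k, hk, hk'⟩
  have hinj : ∀ i j, i ≤ p.length → j ≤ p.length → p.getVert i = p.getVert j → i = j :=
    fun i j hi hj h => hp.getVert_injOn hi hj h
  obtain ⟨t, L, ⟨w, hw, hS⟩, h3⟩ := TourR.exists_tour (G := G) (f := p.getVert) (N := p.length)
    (by omega) (fun i hi => p.adj_getVert_succ hi) (by
      intro r hr0 hrN
      have hne : ∀ i, i ≤ p.length → i ≠ r → p.getVert i ∈ ({p.getVert r}ᶜ : Set V) := by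
        intro i hi hir hc
        exact hir (hinj i r hi hrN.le hc)
      obtain ⟨c⟩ := (h2conn (p.getVert r)).preconnected
        ⟨p.getVert 0, hne 0 (by omega) (by omega)⟩
        ⟨p.getVert p.length, hne _ le_rfl (by omega)⟩
      obtain ⟨d, -, hd1, hd2⟩ := c.exists_boundary_dart
        {x | ∃ i, i < r ∧ p.getVert i = x.1} ⟨0, hr0, rfl⟩ (by
          rintro ⟨i, hi, h⟩
          have := hinj i p.length (by omega) le_rfl h
          omega)
      obtain ⟨i, hi, hix⟩ := hd1
      obtain ⟨j, hj, hjx⟩ := hsurj d.snd.1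
      refine ⟨i, j, hi, ?_, hj, ?_⟩
      · by_contra hc
        rcases Nat.lt_or_ge j r with h | h
        · exact hd2 ⟨j, h, hjx⟩
        · obtain rfl : j = r := by omega
          exact d.snd.2 hjx.symm
      · rw [hix, hjx]
        exact d.adj)
  refine ⟨_, w, ?_, ?_⟩
  · intro x
    obtain ⟨k, hk, rfl⟩ := hsurj x
    exact hS k hk
  · rw [hw, hlen, le_div_iff₀ (by norm_num)]
    have : L * 3 ≤ 4 * (p.length + 1) := by omega
    exact_mod_cast this
end

section
/- Let k ≥ 2 and let G be a 2(k-1)-vertex-connected simple graph on n vertices that contains a spanning tree with at most k leaves. Then G has a TSP tour of length at most 4n/3. -/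
namespace KLeaf
open SimpleGraph

theorem reach_closed {V : Type*} {H : SimpleGraph V} (Z : Set V)
    (hZ : ∀ a b, H.Adj a b → a ∈ Z → b ∈ Z) {a b : V} (h : H.Reachable a b) (ha : a ∈ Z) : b ∈ Z := by
  obtain ⟨w⟩ := h
  induction w with
  | nil => exact ha
  | cons h p ih => exact ih (hZ _ _ h ha)

theorem iter_inj {α ι : Type*} (P : Set α) (g : α → α) (hg : Set.InjOn g P) (x : ι → α)
    (hx : Function.Injective x) (hgx : ∀ u ∈ P, ∀ i, g u ≠ x i) (i j : ι) (s : ℕ) :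
    ∀ t : ℕ, (∀ r < s, g^[r] (x i) ∈ P) → (∀ r < t, g^[r] (x j) ∈ P) →
      g^[s] (x i) = g^[t] (x j) → s = t ∧ i = j := by
  induction s with
  | zero =>
    intro t _ ht h
    cases t with
    | zero => exact ⟨rfl, hx h⟩
    | succ t =>
      rw [Function.iterate_succ_apply'] at h
      exact absurd h.symm (hgx _ (ht t (by omega)) i)
  | succ s ih =>
    intro t hs ht h
    cases t with
    | zero =>
      rw [Function.iterate_succ_apply'] at h
      exact absurd h (hgx _ (hs s (by omega)) j)
    | succ t =>
      rw [Function.iterate_succ_apply', Function.iterate_succ_apply'] at h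
      have := hg (hs s (by omega)) (ht t (by omega)) h
      obtain ⟨h1, h2⟩ := ih t (fun r hr => hs r (by omega)) (fun r hr => ht r (by omega)) this
      exact ⟨by omega, h2⟩

open Classical in
theorem fan_hall {V : Type*} [Fintype V] (G : SimpleGraph V) (m : ℕ) (v : V) (B : Finset V)
    (hv : v ∉ B) (hm : m ≤ B.card)
    (hconn : ∀ s : Finset V, s.card < m → (G.induce (↑s : Set V)ᶜ).Connected) :
    ∃ (x : Fin m → V) (g : V → V), Function.Injective x ∧ (∀ i, G.Adj v (x i)) ∧
      Set.InjOn g {u | u ≠ v ∧ u ∉ B} ∧ (∀ u ∈ {u | u ≠ v ∧ u ∉ B}, ∀ i, g u ≠ x i) ∧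
      ∀ u ∈ {u | u ≠ v ∧ u ∉ B}, g u ≠ v ∧ (g u = u ∨ G.Adj u (g u)) := by
  let t : Fin m ⊕ {u // u ≠ v ∧ u ∉ B} → Finset V := fun
    | .inl _ => Finset.univ.filter (fun x => G.Adj v x)
    | .inr u => Finset.univ.filter (fun x => x ≠ v ∧ (x = u.1 ∨ G.Adj u.1 x))
  have hall : ∀ s : Finset (Fin m ⊕ {u // u ≠ v ∧ u ∉ B}), s.card ≤ (s.biUnion t).card := by
    intro s
    set X : Finset V := s.toRight.map (Function.Embedding.subtype _) with hX
    have hXv : ∀ u ∈ X, u ≠ v ∧ u ∉ B := by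
      intro u hu
      simp [hX] at hu
      exact hu.1
    have hXc : X.card = s.toRight.card := by simp [hX]
    have hXs : X ⊆ s.biUnion t := by
      intro u hu
      have := hXv u hu
      simp only [hX, Finset.mem_map, Finset.mem_toRight] at hu
      obtain ⟨a, ha, rfl⟩ := hu
      rw [Finset.mem_biUnion]
      refine ⟨_, ha, ?_⟩
      simp [t]
      exact this.1
    have hsc : s.card = s.toLeft.card + s.toRight.card := by
      rw [Finset.card_toLeft_add_card_toRight]
    by_cases hI : s.toLeft = ∅
    · rw [hsc, hI, Finset.card_empty, zero_add, ← hXc]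
      exact Finset.card_le_card hXs
    obtain ⟨i0, hi0⟩ := Finset.nonempty_iff_ne_empty.mpr hI
    rw [Finset.mem_toLeft] at hi0
    by_contra hlt
    push Not at hlt
    have hl : s.toLeft.card ≤ m := by simpa using Finset.card_le_univ s.toLeft
    set S := s.biUnion t \ X with hS
    have hSc : S.card < m := by
      rw [hS, Finset.card_sdiff_of_subset hXs]
      have := Finset.card_le_card hXs
      omega
    obtain ⟨b, hbB, hbS⟩ : ∃ b ∈ B, b ∉ S := by
      by_contra hcon
      push Not at hcon
      have := Finset.card_le_card (show B ⊆ S from hcon)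
      omega
    have hvS : v ∉ S := by
      intro h
      rw [hS, Finset.mem_sdiff, Finset.mem_biUnion] at h
      obtain ⟨⟨a, _, ha⟩, _⟩ := h
      rcases a with a | a <;> simp [t] at ha
    have hr := (hconn S hSc).preconnected ⟨v, by simpa using hvS⟩ ⟨b, by simpa using hbS⟩
    have := reach_closed {z | z.1 = v ∨ z.1 ∈ X} ?_ hr (Or.inl rfl)
    · rcases this with h | h
      · exact hv (h ▸ hbB)
      · exact (hXv _ h).2 hbB
    · rintro ⟨a, ha⟩ ⟨c, hc⟩ hac haZ
      simp only [SimpleGraph.comap_adj, Function.Embedding.subtype_apply] at hac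
      simp only [Set.mem_ofPred_eq] at haZ ⊢
      by_contra hcon
      push Not at hcon
      apply hc
      simp only [Finset.mem_coe]
      rw [hS, Finset.mem_sdiff, Finset.mem_biUnion]
      refine ⟨?_, hcon.2⟩
      rcases haZ with rfl | haX
      · exact ⟨_, hi0, by simpa [t] using hac⟩
      · simp only [hX, Finset.mem_map, Finset.mem_toRight] at haX
        obtain ⟨a', ha', rfl⟩ := haX
        refine ⟨_, ha', ?_⟩
        simp only [t, Finset.mem_filter, Finset.mem_univ, true_and]
        exact ⟨hcon.1, Or.inr hac⟩
  obtain ⟨f, hf, hft⟩ := (Finset.all_card_le_biUnion_card_iff_exists_injective t).mp hall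
  refine ⟨fun i => f (.inl i), fun u => if h : u ≠ v ∧ u ∉ B then f (.inr ⟨u, h⟩) else u,
    fun i j h => by simpa using hf h, fun i => by simpa [t] using hft (.inl i), ?_, ?_, ?_⟩
  · intro a ha b hb hab
    simp only [Set.mem_ofPred_eq] at ha hb
    simp only [dif_pos ha, dif_pos hb] at hab
    simpa using hf hab
  · intro a ha i hab
    simp only [Set.mem_ofPred_eq] at ha
    simp only [dif_pos ha] at hab
    simpa using hf hab
  · intro a ha
    simp only [Set.mem_ofPred_eq] at ha
    simp only [dif_pos ha]
    simpa [t] using hft (.inr ⟨a, ha⟩)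

theorem fan {V : Type*} [Fintype V] (G : SimpleGraph V) (m : ℕ) (v : V) (B : Finset V)
    (hv : v ∉ B) (hm : m ≤ B.card)
    (hconn : ∀ s : Finset V, s.card < m → (G.induce (↑s : Set V)ᶜ).Connected) :
    ∃ (Q : Fin m → List V) (e : Fin m → V), Function.Injective e ∧ (∀ i, e i ∈ B) ∧
      (∀ i, List.IsChain G.Adj (v :: (Q i ++ [e i]))) ∧ (∀ i, (Q i).Nodup) ∧
      (∀ i, ∀ x ∈ Q i, x ≠ v ∧ x ∉ B) ∧ ∀ i j, i ≠ j → List.Disjoint (Q i) (Q j) := by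
  classical
  obtain ⟨x, g, hx, hadj, hg, hgx, hgu⟩ := fan_hall G m v B hv hm hconn
  set P : Set V := {u | u ≠ v ∧ u ∉ B} with hP
  have key := iter_inj P g hg x hx hgx
  have ex : ∀ i, ∃ n, g^[n] (x i) ∉ P := by
    intro i
    by_contra hcon
    push Not at hcon
    have : Function.Injective (fun n => g^[n] (x i)) := fun s t h =>
      (key i i s t (fun r _ => hcon r) (fun r _ => hcon r) h).1
    exact not_injective_infinite_finite _ this
  let n : Fin m → ℕ := fun i => Nat.find (ex i)
  have hn : ∀ i, g^[n i] (x i) ∉ P := fun i => Nat.find_spec (ex i)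
  have hlt : ∀ i, ∀ r < n i, g^[r] (x i) ∈ P := fun i r hr => by
    simpa using Nat.find_min (ex i) hr
  have hnv : ∀ i, ∀ r ≤ n i, g^[r] (x i) ≠ v := by
    intro i r hr
    cases r with
    | zero => exact (hadj i).ne'
    | succ r =>
      rw [Function.iterate_succ_apply']
      exact (hgu _ (hlt i r (by omega))).1
  have hstep : ∀ i, ∀ r < n i, G.Adj (g^[r] (x i)) (g^[r+1] (x i)) := by
    intro i r hr
    rcases (hgu _ (hlt i r hr)).2 with h | h
    · exfalso
      have := (key i i (r+1) r (fun q hq => hlt i q (by omega)) (fun q hq => hlt i q (by omega))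
        (by rw [Function.iterate_succ_apply']; exact h)).1
      omega
    · rw [Function.iterate_succ_apply']; exact h
  refine ⟨fun i => (List.range (n i)).map (fun r => g^[r] (x i)), fun i => g^[n i] (x i), ?_, ?_, ?_, ?_, ?_, ?_⟩
  · intro i j h
    exact (key i j _ _ (hlt i) (hlt j) h).2
  · intro i
    by_contra h
    exact hn i ⟨hnv i _ le_rfl, h⟩
  · intro i
    have : (List.range (n i)).map (fun r => g^[r] (x i)) ++ [g^[n i] (x i)]
        = (List.range (n i + 1)).map (fun r => g^[r] (x i)) := by
      simp [List.range_succ]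
    rw [this, List.isChain_iff_getElem]
    intro k hk
    simp only [List.length_cons, List.length_map, List.length_range] at hk
    cases k with
    | zero => simpa using hadj i
    | succ k =>
      have := hstep i k (by omega)
      simp only [List.getElem_cons_succ, List.getElem_map, List.getElem_range]
      exact this
  · intro i
    refine List.Nodup.map_on ?_ List.nodup_range
    intro s hs t ht h
    rw [List.mem_range] at hs ht
    exact (key i i s t (fun r hr => hlt i r (by omega)) (fun r hr => hlt i r (by omega)) h).1
  · intro i y hy
    simp only [List.mem_map, List.mem_range] at hy
    obtain ⟨r, hr, rfl⟩ := hy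
    exact hlt i r hr
  · intro i j hij y hy hy'
    simp only [List.mem_map, List.mem_range] at hy hy'
    obtain ⟨r, hr, rfl⟩ := hy
    obtain ⟨s, hs, h⟩ := hy'
    exact hij (key i j r s (fun q hq => hlt i q (by omega)) (fun q hq => hlt j q (by omega)) h.symm).2

theorem gap {V : Type*} (E S : V → Bool) (L : List V) :
    ∀ (e : V) (acc : List V), E e = true → (∀ x ∈ acc, E x = false) →
      (acc ++ L).countP S < L.countP E →
      ∃ l1 e1 m e2 l2, e :: (acc ++ L) = l1 ++ e1 :: (m ++ e2 :: l2) ∧ E e1 = true ∧ E e2 = true ∧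
        ∀ x ∈ m, S x = false ∧ E x = false := by
  induction L with
  | nil => intro e acc _ _ h; simp at h
  | cons x L ih =>
    intro e acc he hacc h
    by_cases hx : E x = true
    · by_cases hS : ∀ y ∈ acc, S y = false
      · exact ⟨[], e, acc, x, L, rfl, he, hx, fun y hy => ⟨hS y hy, hacc y hy⟩⟩
      · push Not at hS
        obtain ⟨y, hy, hSy⟩ := hS
        have h1 : 0 < acc.countP S := List.countP_pos_iff.mpr ⟨y, hy, by simpa using hSy⟩
        obtain ⟨l1, e1, m, e2, l2, heq, h2⟩ := ih x [] hx (by simp) (by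
          rw [List.countP_append] at h
          rw [List.countP_cons, List.countP_cons, if_pos hx] at h
          simp only [List.nil_append]
          omega)
        refine ⟨e :: (acc ++ l1), e1, m, e2, l2, ?_, h2⟩
        simp only [List.nil_append] at heq
        rw [heq]; simp
    · obtain ⟨l1, e1, m, e2, l2, heq, h2⟩ := ih e (acc ++ [x]) he (by
          intro y hy
          simp only [List.mem_append, List.mem_singleton] at hy
          rcases hy with hy | rfl
          · exact hacc y hy
          · simpa using hx) (by
          rw [List.countP_cons, if_neg hx] at h
          simpa using h)
      exact ⟨l1, e1, m, e2, l2, by simpa using heq, h2⟩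

theorem arc {V : Type*} [DecidableEq V] (C : List V) (hC : C.Nodup) (E S : Finset V)
    (hE : ∀ x ∈ E, x ∈ C) (h2 : 2 ≤ E.card) (hS : (S \ E).card < E.card) :
    ∃ a l b m, List.IsRotated (a :: (l ++ [b]) ++ m) C ∧ a ∈ E ∧ b ∈ E ∧ ∀ x ∈ m, x ∉ S := by
  obtain ⟨e, he⟩ := Finset.card_pos.mp (show 0 < E.card by omega)
  obtain ⟨p, q, hpq⟩ := List.append_of_mem (hE e he)
  have hrot : List.IsRotated (e :: (q ++ p)) C := by
    rw [hpq]
    have := List.isRotated_append (l := e :: q) (l' := p)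
    simpa using this
  set L := q ++ p with hL
  have hnd : (e :: L).Nodup := hrot.nodup_iff.mpr hC
  have hrot' : List.IsRotated (L ++ [e]) C := (List.isRotated_append (l := L) (l' := [e])).trans hrot
  have hnd' : (L ++ [e]).Nodup := hrot'.nodup_iff.mpr hC
  have c1 : (L ++ [e]).countP (fun x => decide (x ∈ E)) = E.card := by
    rw [List.countP_eq_length_filter, ← List.toFinset_card_of_nodup (hnd'.filter _)]
    congr 1
    ext x
    simp only [List.mem_toFinset, List.mem_filter, decide_eq_true_eq]
    exact ⟨fun h => h.2, fun h => ⟨hrot'.mem_iff.mpr (hE x h), h⟩⟩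
  have c2 : (L ++ [e]).countP (fun x => decide (x ∈ S \ E)) ≤ (S \ E).card := by
    rw [List.countP_eq_length_filter, ← List.toFinset_card_of_nodup (hnd'.filter _)]
    apply Finset.card_le_card
    intro x
    simp only [List.mem_toFinset, List.mem_filter, decide_eq_true_eq]
    exact fun h => h.2
  obtain ⟨l1, e1, m, e2, l2, heq, he1, he2, hm⟩ := gap (fun x => decide (x ∈ E))
    (fun x => decide (x ∈ S \ E)) (L ++ [e]) e [] (by simpa using he) (by simp)
    (by simp only [List.nil_append]; omega)
  simp only [decide_eq_true_eq, decide_eq_false_iff_not, Finset.mem_sdiff, List.nil_append] at he1 he2 hm heq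
  have hmS : ∀ x ∈ m, x ∉ S := fun x hx hxS => (hm x hx).1 ⟨hxS, (hm x hx).2⟩
  rcases List.eq_nil_or_concat l2 with rfl | ⟨l2', z, rfl⟩
  · have h3 : e :: L = l1 ++ e1 :: m ∧ e = e2 := by
      have : (e :: L) ++ [e] = (l1 ++ e1 :: m) ++ [e2] := by simpa using heq
      simpa using List.append_inj' this rfl
    obtain ⟨h3, rfl⟩ := h3
    cases l1 with
    | nil =>
      exfalso
      simp only [List.nil_append, List.cons.injEq] at h3
      obtain ⟨rfl, rfl⟩ := h3
      have : E ⊆ {e} := by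
        intro x hx
        have := hrot.mem_iff.mpr (hE x hx)
        simp only [List.mem_cons] at this
        rcases this with h | h
        · simpa using h
        · exact absurd hx (hm x h).2
      have := Finset.card_le_card this
      simp at this
      omega
    | cons y l1 =>
      simp only [List.cons_append, List.cons.injEq] at h3
      obtain ⟨rfl, h3⟩ := h3
      refine ⟨e, l1, e1, m, ?_, he, he1, hmS⟩
      rw [h3] at hrot
      simpa using hrot
  · have h3 : e :: L = l1 ++ e1 :: (m ++ e2 :: l2') := by
      have : (e :: L) ++ [e] = (l1 ++ e1 :: (m ++ e2 :: l2')) ++ [z] := by simpa using heq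
      exact (List.append_inj' this rfl).1
    refine ⟨e2, l2' ++ l1, e1, m, ?_, he2, he1, hmS⟩
    refine List.IsRotated.trans ?_ hrot
    rw [h3]
    have := List.isRotated_append (l := e2 :: l2') (l' := l1 ++ e1 :: m)
    simpa using this

theorem dirac {V : Type*} [Fintype V] [DecidableEq V] (G : SimpleGraph V) (c : ℕ) (hc : 2 ≤ c)
    (hcard : c < Fintype.card V)
    (hconn : ∀ s : Finset V, s.card < c → (G.induce (↑s : Set V)ᶜ).Connected) (S : Finset V) :
    S.card ≤ c → ∃ C : List V, C.Nodup ∧ 2 ≤ C.length ∧ Cycle.Chain G.Adj (C : Cycle V) ∧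
      ∀ x ∈ S, x ∈ C := by
  induction S using Finset.induction_on with
  | empty =>
    intro _
    have hG := hconn ∅ (by simp; omega)
    have : Nontrivial ((↑(∅ : Finset V) : Set V)ᶜ : Set V) := by
      have : Nontrivial V := Fintype.one_lt_card_iff_nontrivial.mp (by omega)
      obtain ⟨a, b, hab⟩ := this
      exact ⟨⟨a, by simp⟩, ⟨b, by simp⟩, by simpa using hab⟩
    obtain ⟨⟨a, ha⟩, _⟩ := exists_pair_ne ((↑(∅ : Finset V) : Set V)ᶜ : Set V)
    obtain ⟨b, hb⟩ := hG.preconnected.exists_adj_of_nontrivial ⟨a, ha⟩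
    have hab : G.Adj a b.1 := by simpa using hb
    refine ⟨[a, b.1], by simpa using hab.ne, by simp, ?_, by simp⟩
    rw [Cycle.chain_coe_cons]
    simpa using ⟨hab, hab.symm⟩
  | insert v S hvS ih =>
    intro hS
    rw [Finset.card_insert_of_notMem hvS] at hS
    obtain ⟨C, hnd, hlen, hch, hSC⟩ := ih (by omega)
    by_cases hvC : v ∈ C
    · refine ⟨C, hnd, hlen, hch, ?_⟩
      intro x hx
      rcases Finset.mem_insert.mp hx with rfl | hx
      · exact hvC
      · exact hSC x hx
    have hCc : C.toFinset.card = C.length := List.toFinset_card_of_nodup hnd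
    set m := min c C.length with hm
    obtain ⟨Q, e, he, heB, hQch, hQnd, hQ, hdis⟩ := fan G m v C.toFinset (by simpa using hvC)
      (by rw [hCc]; exact min_le_right _ _)
      (fun s hs => hconn s (lt_of_lt_of_le hs (min_le_left _ _)))
    set E : Finset V := Finset.univ.image e with hE
    have hEc : E.card = m := by rw [hE, Finset.card_image_of_injective _ he]; simp
    have hEC : E ⊆ C.toFinset := by
      intro x hx
      simp only [hE, Finset.mem_image, Finset.mem_univ, true_and] at hx
      obtain ⟨i, rfl⟩ := hx
      exact heB i
    have hSE : (S \ E).card < E.card := by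
      rcases le_total c C.length with h | h
      · rw [min_eq_left h] at hm
        have := Finset.card_le_card (Finset.sdiff_subset (s := S) (t := E))
        omega
      · rw [min_eq_right h] at hm
        have h1 : E = C.toFinset := Finset.eq_of_subset_of_card_le hEC (by omega)
        have h2 : S \ E = ∅ := by
          rw [Finset.sdiff_eq_empty_iff_subset, h1]
          intro x hx
          simpa using hSC x hx
        rw [h2, hEc]; simp; omega
    obtain ⟨a, l, b, r, hrot, haE, hbE, hr⟩ := arc C hnd E S (fun x hx => by simpa using hEC hx)
      (by omega) hSE
    simp only [hE, Finset.mem_image, Finset.mem_univ, true_and] at haE hbE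
    obtain ⟨i, hi⟩ := haE
    obtain ⟨j, hj⟩ := hbE
    have hnd' := hrot.nodup_iff.mpr hnd
    have hDn : (a :: (l ++ [b])).Nodup := (List.nodup_append.mp hnd').1
    have hDC : ∀ x ∈ a :: (l ++ [b]), x ∈ C := fun x hx =>
      hrot.mem_iff.mp (List.mem_append_left _ hx)
    have hij : i ≠ j := by
      rintro rfl
      simp at hDn
      exact hDn.1.2 (hi.symm.trans hj)
    have hch' : List.IsChain G.Adj (a :: (l ++ [b])) := by
      rw [← Cycle.coe_eq_coe.mpr hrot, List.cons_append, Cycle.chain_coe_cons] at hch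
      have : a :: (l ++ [b] ++ r ++ [a]) = (a :: (l ++ [b])) ++ (r ++ [a]) := by simp
      rw [this] at hch
      exact hch.left_of_append
    refine ⟨v :: (Q i ++ (a :: (l ++ [b])) ++ (Q j).reverse), ?_, by simp; omega, ?_, ?_⟩
    · rw [List.nodup_cons]
      constructor
      · intro hv
        simp only [List.mem_append, List.mem_reverse] at hv
        rcases hv with (h | h) | h
        · exact (hQ i v h).1 rfl
        · exact hvC (hDC v (by simpa using h))
        · exact (hQ j v h).1 rfl
      · refine List.Nodup.append (List.Nodup.append (hQnd i) hDn ?_) (List.nodup_reverse.mpr (hQnd j)) ?_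
        · intro x hx hx'
          exact (hQ i x hx).2 (by simpa using hDC x hx')
        · intro x hx hx'
          rw [List.mem_reverse] at hx'
          rw [List.mem_append] at hx
          rcases hx with h | h
          · exact hdis i j hij h hx'
          · exact (hQ j x hx').2 (by simpa using hDC x h)
    · rw [Cycle.chain_coe_cons]
      have e1 : v :: (Q i ++ (a :: (l ++ [b])) ++ (Q j).reverse ++ [v])
        = (v :: Q i) ++ a :: (l ++ b :: ((Q j).reverse ++ [v])) := by simp
      rw [e1, List.isChain_split]
      constructor
      · have := hQch i
        rw [hi] at this
        simpa using this
      · have e2 : a :: (l ++ b :: ((Q j).reverse ++ [v])) = (a :: l) ++ b :: ((Q j).reverse ++ [v]) := by simp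
        rw [e2, List.isChain_split]
        constructor
        · simpa using hch'
        · have := hQch j
          rw [hj] at this
          have e3 : b :: ((Q j).reverse ++ [v]) = (v :: (Q j ++ [b])).reverse := by simp
          rw [e3, List.isChain_reverse]
          exact this.imp (fun _ _ h => h.symm)
    · intro x hx
      rcases Finset.mem_insert.mp hx with rfl | hx
      · simp
      · have h1 := hrot.mem_iff.mpr (hSC x hx)
        rw [List.mem_append] at h1
        rcases h1 with h1 | h1
        · refine List.mem_cons_of_mem _ (List.mem_append_left _ (List.mem_append_right _ h1))
        · exact absurd hx (hr x h1)

theorem chain_walk {V : Type*} {G : SimpleGraph V} (b : V) (l : List V) :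
    ∀ a, List.IsChain G.Adj (a :: (l ++ [b])) → ∃ w : G.Walk a b, w.support = a :: (l ++ [b]) := by
  induction l with
  | nil =>
    intro a h
    have : G.Adj a b := by simpa using h
    exact ⟨.cons this .nil, by simp⟩
  | cons x l ih =>
    intro a h
    rw [List.cons_append, List.isChain_cons_cons] at h
    obtain ⟨w, hw⟩ := ih x h.2
    exact ⟨.cons h.1 w, by simp [hw]⟩

theorem dirac_walk {V : Type*} [Fintype V] [DecidableEq V] (G : SimpleGraph V) (c : ℕ) (hc : 2 ≤ c)
    (hcard : c < Fintype.card V)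
    (hconn : ∀ s : Finset V, s.card < c → (G.induce (↑s : Set V)ᶜ).Connected) (S : Finset V)
    (hS : S.card ≤ c) : ∃ (r : V) (w : G.Walk r r), w.length ≤ w.support.toFinset.card ∧
      ∀ x ∈ S, x ∈ w.support := by
  obtain ⟨C, hnd, hlen, hch, hSC⟩ := dirac G c hc hcard hconn S hS
  cases C with
  | nil => simp at hlen
  | cons a l =>
    rw [Cycle.chain_coe_cons] at hch
    obtain ⟨w, hw⟩ : ∃ w : G.Walk a a, w.support = a :: (l ++ [a]) :=
      chain_walk a l a hch
    have hl : w.length + 1 = l.length + 2 := by rw [← Walk.length_support, hw]; simp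
    refine ⟨a, w, ?_, ?_⟩
    · rw [hw]
      have : (a :: (l ++ [a])).toFinset = (a :: l).toFinset := by ext; simp
      rw [this, List.toFinset_card_of_nodup hnd]
      simp; omega
    · intro x hx
      rw [hw]
      have := hSC x hx
      simp at this ⊢
      tauto

theorem crossing {V : Type*} {H : SimpleGraph V} (hH : H.Preconnected) (U : Set V) {a b : V}
    (ha : a ∈ U) (hb : b ∉ U) : ∃ x ∈ U, ∃ y, y ∉ U ∧ H.Adj x y := by
  by_contra hcon
  push Not at hcon
  exact hb (reach_closed U (fun x y hxy hx => by
    by_contra hy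
    exact hcon x hx y hy hxy) (hH a b) ha)

/-- Incidence parity. -/
def dg {V : Type*} [DecidableEq V] (M : Multiset (Sym2 V)) (x : V) : ZMod 2 :=
  (M.countP (fun e => x ∈ e) : ℕ)

theorem dg_add {V : Type*} [DecidableEq V] (M N : Multiset (Sym2 V)) (x : V) :
    dg (M + N) x = dg M x + dg N x := by
  simp [dg, Multiset.countP_add]

theorem dg_edge {V : Type*} [DecidableEq V] {a b : V} (h : a ≠ b) (x : V) :
    dg {s(a, b)} x = (if x = a then 1 else 0) + (if x = b then 1 else 0) := by
  have : ({s(a, b)} : Multiset (Sym2 V)) = s(a, b) ::ₘ 0 := rfl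
  rw [dg, this, Multiset.countP_cons]
  by_cases h1 : x = a
  · subst h1; simp [h]
  · by_cases h2 : x = b
    · subst h2; simp [h1]
    · simp [h1, h2]

theorem zz (a : ZMod 2) : a + a = 0 := CharTwo.add_self_eq_zero a

theorem dg_walk {V : Type*} [DecidableEq V] {G : SimpleGraph V} {u v : V} (p : G.Walk u v) (x : V) :
    dg (p.edges : Multiset (Sym2 V)) x = (if x = u then 1 else 0) + (if x = v then 1 else 0) := by
  induction p with
  | nil => rw [zz]; simp [dg]
  | @cons u w v h p ih =>
    have : ((Walk.cons h p).edges : Multiset (Sym2 V)) = {s(u, w)} + (p.edges : Multiset (Sym2 V)) := by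
      simp
    rw [this, dg_add, ih, dg_edge h.ne]
    linear_combination zz (if x = w then 1 else 0)

theorem join {V : Type*} [Fintype V] [DecidableEq V] {G : SimpleGraph V} {u v : V} (p : G.Walk u v) :
    ∀ a : V → ZMod 2, (∀ x, a x ≠ 0 → x ∈ p.support) →
      ∃ J : Multiset (Sym2 V), J ≤ (p.edges : Multiset (Sym2 V)) ∧
        ∀ x, dg J x = a x + (∑ y, a y) * (if x = v then 1 else 0) := by
  induction p with
  | @nil u =>
    intro a ha
    refine ⟨0, by simp, fun x => ?_⟩
    have h0 : ∀ y, y ≠ u → a y = 0 := by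
      intro y hy
      by_contra h
      exact hy (by simpa using ha y h)
    rw [Fintype.sum_eq_single u h0]
    by_cases hx : x = u
    · subst hx; simp [dg, zz]
    · simp [dg, hx, h0 x hx]
  | @cons u w v h p ih =>
    intro a ha
    by_cases hu : a u = 0
    · obtain ⟨J, hJ, hd⟩ := ih a (fun x hx => by
        have := ha x hx
        rw [Walk.support_cons, List.mem_cons] at this
        rcases this with rfl | h
        · exact absurd hu hx
        · exact h)
      refine ⟨J, hJ.trans ?_, hd⟩
      rw [Walk.edges_cons]
      exact Multiset.le_cons_self _ _
    · have hu1 : a u = 1 := by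
        revert hu; generalize a u = z; revert z; decide
      obtain ⟨J, hJ, hd⟩ := ih (fun x => a x + ((if x = u then 1 else 0) + (if x = w then 1 else 0)))
        (fun x hx => by
          by_cases h1 : x = u
          · subst h1
            exfalso; apply hx
            simp only [hu1, if_pos, if_neg h.ne]
            decide
          · by_cases h2 : x = w
            · subst h2; exact p.start_mem_support
            · simp only [h1, h2, if_false, add_zero] at hx
              have := ha x hx
              rw [Walk.support_cons, List.mem_cons] at this
              tauto)
      refine ⟨{s(u, w)} + J, ?_, fun x => ?_⟩
      · have : ((Walk.cons h p).edges : Multiset (Sym2 V)) = {s(u, w)} + (p.edges : Multiset (Sym2 V)) := by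
          simp
        rw [this]
        exact add_le_add_right hJ _
      · rw [dg_add, hd, dg_edge h.ne]
        simp only [Finset.sum_add_distrib, Finset.sum_ite_eq', Finset.mem_univ, if_true]
        have h2 : (1 : ZMod 2) + 1 = 0 := by decide
        rw [h2, add_zero]
        linear_combination zz (if x = u then 1 else 0) + zz (if x = w then 1 else 0)

theorem euler {V : Type*} [Fintype V] [DecidableEq V] [Nonempty V] {G : SimpleGraph V}
    (M : Multiset (Sym2 V)) (hM : ∀ e ∈ M, e ∈ G.edgeSet) (hd : ∀ x, dg M x = 0)
    (hcr : ∀ (U : Set V) (a b : V), a ∈ U → b ∉ U → ∃ x ∈ U, ∃ y, y ∉ U ∧ s(x, y) ∈ M) :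
    ∃ (r : V) (w : G.Walk r r), (∀ x, x ∈ w.support) ∧ w.length ≤ M.card := by
  have hle : ∀ {u v : V} (w : G.Walk u v), (w.edges : Multiset (Sym2 V)) ≤ M → w.length ≤ M.card := by
    intro u v w hw
    simpa using Multiset.card_le_card hw
  by_contra hcon
  have hlong : ∀ n : ℕ, ∃ (u v : V) (w : G.Walk u v), (w.edges : Multiset (Sym2 V)) ≤ M ∧ w.length = n := by
    intro n
    induction n with
    | zero =>
      obtain ⟨a⟩ := (inferInstance : Nonempty V)
      exact ⟨a, a, .nil, by simp, rfl⟩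
    | succ n ih =>
      obtain ⟨u, v, w, hw, hn⟩ := ih
      by_cases huv : u = v
      · subst huv
        have : ∃ b, b ∉ w.support := by
          by_contra h
          push Not at h
          exact hcon ⟨u, w, h, hle w hw⟩
        obtain ⟨b, hb⟩ := this
        obtain ⟨x, hx, y, hy, hxy⟩ := hcr {z | z ∈ w.support} u b w.start_mem_support hb
        have hadj : G.Adj y x := (hM _ hxy : G.Adj x y).symm
        refine ⟨y, x, .cons hadj (w.rotate x hx), ?_, ?_⟩
        · have hr : ((w.rotate x hx).edges : Multiset (Sym2 V)) = w.edges :=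
            Multiset.coe_eq_coe.mpr (w.rotate_edges x hx).perm
          have hne : s(y, x) ∉ (w.edges : Multiset (Sym2 V)) := by
            intro h
            exact hy (w.fst_mem_support_of_mem_edges (by simpa using h))
          rw [Walk.edges_cons, ← Multiset.cons_coe, hr]
          rw [Multiset.le_iff_count]
          intro e
          rw [Multiset.count_cons]
          split_ifs with he
          · subst he
            rw [Multiset.count_eq_zero.mpr hne, zero_add, Multiset.one_le_count_iff_mem, Sym2.eq_swap]
            exact hxy
          · simpa using Multiset.le_iff_count.mp hw e
        · have : (w.rotate x hx).edges.length = w.edges.length := (w.rotate_edges x hx).perm.length_eq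
          simp only [Walk.length_edges] at this
          simp [this, hn]
      · obtain ⟨R, hR⟩ := Multiset.le_iff_exists_add.mp hw
        have h1 := hd v
        rw [hR, dg_add, dg_walk, if_neg (Ne.symm huv), if_pos rfl, zero_add] at h1
        have h2 : dg R v ≠ 0 := by
          intro h; rw [h] at h1; exact absurd h1 (by decide)
        have h3 : 0 < R.countP (fun e => v ∈ e) := by
          rcases Nat.eq_zero_or_pos (R.countP (fun e => v ∈ e)) with h | h
          · exact absurd (by simp [dg, h]) h2
          · exact h
        obtain ⟨e, heR, hve⟩ := Multiset.countP_pos.mp h3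
        obtain ⟨b, rfl⟩ := Sym2.mem_iff_exists.mp hve
        have hadj : G.Adj v b := hM _ (by rw [hR]; exact Multiset.mem_add.mpr (Or.inr heR))
        refine ⟨u, b, w.concat hadj, ?_, by simp [hn]⟩
        rw [Walk.edges_concat, List.concat_eq_append, ← Multiset.coe_add, hR]
        refine add_le_add_right ?_ _
        simpa using heR
  obtain ⟨u, v, w, hw, hn⟩ := hlong (M.card + 1)
  have := hle w hw
  omega

theorem extend {V : Type*} [Fintype V] [DecidableEq V] {G : SimpleGraph V} (hG : G.Preconnected)
    (n : ℕ) : ∀ {r : V} (w : G.Walk r r), Fintype.card V ≤ w.support.toFinset.card + n →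
      ∃ (r : V) (w' : G.Walk r r), (∀ x, x ∈ w'.support) ∧ w'.length ≤ w.length + 2 * n := by
  induction n with
  | zero =>
    intro r w hw
    refine ⟨r, w, ?_, by simp⟩
    have := Finset.eq_univ_of_card _ (le_antisymm (Finset.card_le_univ w.support.toFinset) (by simpa using hw))
    intro x
    rw [← List.mem_toFinset, this]
    simp
  | succ n ih =>
    intro r w hw
    by_cases hall : ∀ x, x ∈ w.support
    · exact ⟨r, w, hall, by omega⟩
    push Not at hall
    obtain ⟨b, hb⟩ := hall
    obtain ⟨x, hx, y, hy, hxy⟩ := crossing hG {z | z ∈ w.support} (a := r) (b := b) w.start_mem_support hb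
    let w2 : G.Walk y y := .cons hxy.symm ((w.rotate x hx).concat hxy)
    have hlen : w2.length = w.length + 2 := by
      have : (w.rotate x hx).edges.length = w.edges.length := (w.rotate_edges x hx).perm.length_eq
      simp only [Walk.length_edges] at this
      simp [w2, this]
    have hsub : insert y w.support.toFinset ⊆ w2.support.toFinset := by
      intro z hz
      rw [Finset.mem_insert, List.mem_toFinset] at hz
      rw [List.mem_toFinset]
      rcases hz with rfl | hz
      · exact w2.start_mem_support
      · simp only [w2, Walk.support_cons, Walk.support_concat, List.mem_cons, List.mem_append]
        right; left
        exact (Walk.mem_support_rotate_iff ..).mpr hz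
    have hc := Finset.card_le_card hsub
    rw [Finset.card_insert_of_notMem (by simpa using hy)] at hc
    obtain ⟨r', w', h1, h2⟩ := ih w2 (by omega)
    exact ⟨r', w', h1, by omega⟩

theorem tree_odd {V : Type*} [Fintype V] [DecidableEq V] (T : SimpleGraph V) [DecidableRel T.Adj]
    (hT : T.IsTree) (h2 : 2 ≤ Fintype.card V) :
    (Finset.univ.filter (fun x => (T.degree x : ZMod 2) ≠ 0)).card + 2
      ≤ 2 * (Finset.univ.filter (fun x => T.degree x = 1)).card := by
  have hs := T.sum_degrees_eq_twice_card_edges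
  have he := hT.card_edgeFinset
  have : Nontrivial V := Fintype.one_lt_card_iff_nontrivial.mp (by omega)
  have hpos : ∀ x, 0 < T.degree x := fun x => hT.1.preconnected.degree_pos_of_nontrivial x
  have key : ∀ x, (if (T.degree x : ZMod 2) ≠ 0 then 1 else 0) + 2
      ≤ 2 * (if T.degree x = 1 then 1 else 0) + T.degree x := by
    intro x
    have := hpos x
    by_cases h1 : T.degree x = 1
    · simp [h1]
    · by_cases h2 : T.degree x = 2
      · have : ((2 : ℕ) : ZMod 2) = 0 := by decide
        rw [h2, this]; simp
      · rw [if_neg h1]; split_ifs <;> omega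
  have := Finset.sum_le_sum (fun x (_ : x ∈ Finset.univ) => key x)
  rw [Finset.sum_add_distrib, Finset.sum_add_distrib, ← Finset.mul_sum, ← Finset.card_filter,
    ← Finset.card_filter, hs] at this
  simp only [Finset.sum_const, Finset.card_univ, smul_eq_mul] at this
  omega
end KLeaf

theorem graphTSP_of_k_leaf_spanning_tree {V : Type*} [Fintype V]
    (k : ℕ) (hk : 2 ≤ k)
    (G : SimpleGraph V)
    (hcard : 2 * (k - 1) < Fintype.card V)
    (hconn : ∀ s : Finset V, s.card < 2 * (k - 1) → (G.induce (↑s : Set V)ᶜ).Connected)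
    (T : SimpleGraph V) (hTG : T ≤ G) (hT : T.IsTree)
    (hleaves : {v : V | (T.neighborSet v).ncard = 1}.ncard ≤ k) :
    ∃ (r : V) (w : G.Walk r r), (∀ x : V, x ∈ w.support) ∧
      (w.length : ℚ) ≤ 4 * (Fintype.card V) / 3 := by
  classical
  have hodd := KLeaf.tree_odd T hT (by omega)
  have hl : (Finset.univ.filter (fun x => T.degree x = 1)).card ≤ k := by
    refine le_trans (le_of_eq ?_) hleaves
    rw [← Set.ncard_coe_finset]
    congr 1
    ext x
    have : (T.neighborSet x).ncard = T.degree x := by rw [Set.ncard_eq_toFinset_card']; rfl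
    rw [Finset.mem_coe, Finset.mem_filter, Set.mem_ofPred_eq, this]
    simp
  set O := Finset.univ.filter (fun x => (T.degree x : ZMod 2) ≠ 0) with hO
  obtain ⟨r, c, hc, hOc⟩ := KLeaf.dirac_walk G (2 * (k - 1)) (by omega) hcard hconn O (by omega)
  have hTdg : ∀ x, KLeaf.dg T.edgeFinset.val x = (T.degree x : ZMod 2) := by
    intro x
    rw [KLeaf.dg, Multiset.countP_eq_card_filter, ← SimpleGraph.card_incidenceFinset_eq_degree,
      SimpleGraph.incidenceFinset_eq_filter]
    rfl
  have hsum : ∑ y, (T.degree y : ZMod 2) = 0 := by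
    rw [← Nat.cast_sum, T.sum_degrees_eq_twice_card_edges, Nat.cast_mul]
    have : ((2 : ℕ) : ZMod 2) = 0 := by decide
    rw [this, zero_mul]
  obtain ⟨J, hJ, hJd⟩ := KLeaf.join c (fun x => (T.degree x : ZMod 2))
    (fun x hx => hOc x (by simpa [hO] using hx))
  simp only [hsum, zero_mul, add_zero] at hJd
  have hTpre : T.Preconnected := hT.1.preconnected
  have hGpre : G.Preconnected := hTpre.mono hTG
  have hTE := hT.card_edgeFinset
  have tour : ∀ K : Multiset (Sym2 V), K ≤ (c.edges : Multiset (Sym2 V)) →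
      (∀ x, KLeaf.dg K x = (T.degree x : ZMod 2)) →
      ∃ (r : V) (w : G.Walk r r), (∀ x : V, x ∈ w.support) ∧
        w.length + 1 ≤ Fintype.card V + K.card := by
    intro K hK hKd
    have : Nonempty V := ⟨r⟩
    have main := KLeaf.euler (G := G) (T.edgeFinset.val + K) ?_ ?_ ?_
    · obtain ⟨r', w, h1, h2⟩ := main
      refine ⟨r', w, h1, ?_⟩
      rw [Multiset.card_add, Finset.card_val] at h2
      omega
    · intro e he
      rcases Multiset.mem_add.mp he with h | h
      · exact SimpleGraph.edgeSet_mono hTG (by simpa using h)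
      · exact c.edges_subset_edgeSet (by simpa using Multiset.mem_of_le hK h)
    · intro x
      rw [KLeaf.dg_add, hTdg, hKd, KLeaf.zz]
    · intro U a b ha hb
      obtain ⟨x, hx, y, hy, hxy⟩ := KLeaf.crossing hTpre U ha hb
      exact ⟨x, hx, y, hy, Multiset.mem_add.mpr (Or.inl (by simpa using hxy))⟩
  obtain ⟨R, hR⟩ := Multiset.le_iff_exists_add.mp hJ
  have hcR : c.length = J.card + R.card := by
    have := congrArg Multiset.card hR
    simpa using this
  have hRd : ∀ x, KLeaf.dg R x = (T.degree x : ZMod 2) := by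
    intro x
    have := KLeaf.dg_walk c x
    rw [hR, KLeaf.dg_add, hJd, KLeaf.zz] at this
    linear_combination this - KLeaf.zz (T.degree x : ZMod 2)
  have hRle : R ≤ (c.edges : Multiset (Sym2 V)) := by rw [hR]; exact Multiset.le_add_left _ _
  have fin : ∀ m : ℕ, 3 * m ≤ 4 * Fintype.card V → (m : ℚ) ≤ 4 * (Fintype.card V) / 3 := by
    intro m hm
    have : (3 * m : ℚ) ≤ 4 * Fintype.card V := by exact_mod_cast hm
    linarith
  have hcle : c.support.toFinset.card ≤ Fintype.card V := Finset.card_le_univ _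
  by_cases hbig : 2 * Fintype.card V ≤ 3 * c.length
  · obtain ⟨r', w, h1, h2⟩ := KLeaf.extend hGpre (Fintype.card V - c.support.toFinset.card) c (by omega)
    exact ⟨r', w, h1, fin _ (by omega)⟩
  · rcases le_total J.card R.card with h | h
    · obtain ⟨r', w, h1, h2⟩ := tour J hJ hJd
      exact ⟨r', w, h1, fin _ (by omega)⟩
    · obtain ⟨r', w, h1, h2⟩ := tour R hRle hRd
      exact ⟨r', w, h1, fin _ (by omega)⟩
end

section
/- Let G be a connected simple graph on n vertices, let c be a positive integer, and suppose that every subset X of vertices of G with |X| ≤ c is cyclable in G (i.e., is contained in the vertex set of some simple cycle of G). If G contains a spanning tree with at most c/2 + 1 leaves, then G has a TSP tour of length at most 4n/3. -/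
open Classical in
/-- Degree of a vertex in a multiset of edges. -/
noncomputable def edgeDeg {V : Type*} (M : Multiset (Sym2 V)) (x : V) : ℕ :=
  M.countP (fun e => x ∈ e)

theorem edgeDeg_zero {V : Type*} (x : V) : edgeDeg (0 : Multiset (Sym2 V)) x = 0 := by
  simp [edgeDeg]

theorem edgeDeg_add {V : Type*} (M N : Multiset (Sym2 V)) (x : V) :
    edgeDeg (M + N) x = edgeDeg M x + edgeDeg N x := by
  simp [edgeDeg]

open Classical in
theorem edgeDeg_cons {V : Type*} (a b : V) (M : Multiset (Sym2 V)) (x : V) :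
    edgeDeg (s(a, b) ::ₘ M) x = edgeDeg M x + if x = a ∨ x = b then 1 else 0 := by
  simp [edgeDeg, Multiset.countP_cons]

theorem exists_of_edgeDeg_pos {V : Type*} (M : Multiset (Sym2 V)) (x : V)
    (h : 0 < edgeDeg M x) : ∃ y, s(x, y) ∈ M := by
  classical
  unfold edgeDeg at h
  rw [Multiset.countP_pos] at h
  obtain ⟨e, he, y, rfl⟩ := h
  exact ⟨y, he⟩

theorem edgeDeg_walk {V : Type*} {G : SimpleGraph V} {u v : V} (p : G.Walk u v) (x : V) :
    Even (edgeDeg (p.edges : Multiset (Sym2 V)) x) ↔ (u ≠ v → x ≠ u ∧ x ≠ v) := by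
  classical
  induction p with
  | nil => simp [edgeDeg_zero]
  | @cons a b c h p ih =>
    have hne := h.ne
    rw [SimpleGraph.Walk.edges_cons, ← Multiset.cons_coe, edgeDeg_cons]
    split_ifs with hx
    · rw [Nat.even_add_one, ih]
      grind
    · rw [add_zero, ih]
      grind

theorem sum_edgeDeg {V : Type*} [Fintype V] (M : Multiset (Sym2 V))
    (hM : ∀ e ∈ M, ¬ e.IsDiag) : ∑ x, edgeDeg M x = 2 * M.card := by
  classical
  induction M using Multiset.induction_on with
  | empty => simp [edgeDeg_zero]
  | cons e M ih =>
    have h1 := ih (fun e he => hM e (Multiset.mem_cons_of_mem he))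
    have h2 := hM e (Multiset.mem_cons_self _ _)
    induction e using Sym2.ind with
    | _ a b =>
      have hab : a ≠ b := by simpa using h2
      simp only [edgeDeg_cons, Finset.sum_add_distrib, h1, Multiset.card_cons]
      rw [← Finset.sum_filter, Finset.sum_const]
      have : (Finset.univ.filter (fun x => x = a ∨ x = b)) = {a, b} := by ext; simp
      rw [this, Finset.card_pair hab]
      simp; ring

/-- Enough of Euler's theorem. -/
theorem exists_euler {V : Type*} {G T : SimpleGraph V} (hT : T.Connected)
    (M : Multiset (Sym2 V)) (hMG : ∀ e ∈ M, e ∈ G.edgeSet) (hTM : ∀ e ∈ T.edgeSet, e ∈ M)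
    (hev : ∀ x, Even (edgeDeg M x)) :
    ∃ (r : V) (w : G.Walk r r), (∀ x : V, x ∈ w.support) ∧ w.length ≤ M.card := by
  classical
  let P : ℕ → Prop := fun n => ∃ (u v : V) (p : G.Walk u v),
    (p.edges : Multiset (Sym2 V)) ≤ M ∧ p.length = n
  have hb : ∀ n, P n → n ≤ M.card := by
    rintro n ⟨u, v, p, hp, rfl⟩
    simpa using Multiset.card_le_card hp
  have h0 : P 0 := by
    obtain ⟨u⟩ := hT.nonempty
    exact ⟨u, u, SimpleGraph.Walk.nil, by simp, rfl⟩
  obtain ⟨u, v, p, hp, hpl⟩ := Nat.findGreatest_spec (Nat.zero_le M.card) h0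
  have hmax : ∀ n, P n → n ≤ p.length := by
    intro n hn
    rw [hpl]
    exact Nat.le_findGreatest (hb n hn) hn
  -- no unused edge at the start of a longest walk
  have key : ∀ (a b : V) (q : G.Walk a b), (q.edges : Multiset (Sym2 V)) ≤ M →
      q.length = p.length → ∀ y, s(a, y) ∉ M - (q.edges : Multiset (Sym2 V)) := by
    intro a b q hq hql y hy
    have hadj : G.Adj a y := hMG _ (Multiset.mem_of_le (Multiset.sub_le_self _ _) hy)
    have hle : s(a, y) ::ₘ (q.edges : Multiset (Sym2 V)) ≤ M := by
      have := Multiset.singleton_le.2 hy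
      have h2 := add_le_add_left this (q.edges : Multiset (Sym2 V))
      rw [tsub_add_cancel_of_le hq] at h2
      simpa using h2
    have := hmax (q.length + 1) ⟨y, b, SimpleGraph.Walk.cons hadj.symm q, by
      rw [SimpleGraph.Walk.edges_cons, ← Multiset.cons_coe, Sym2.eq_swap]
      exact hle, by simp⟩
    omega
  have huv : u = v := by
    by_contra hne
    have h1 : ¬ Even (edgeDeg (p.edges : Multiset (Sym2 V)) u) := by
      rw [edgeDeg_walk]; simp [hne]
    have h2 := edgeDeg_add (M - (p.edges : Multiset (Sym2 V))) p.edges u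
    rw [tsub_add_cancel_of_le hp] at h2
    have h3 := hev u
    have h4 : 0 < edgeDeg (M - (p.edges : Multiset (Sym2 V))) u := by
      rcases Nat.eq_zero_or_pos (edgeDeg (M - (p.edges : Multiset (Sym2 V))) u) with h | h
      · rw [h2, h, zero_add] at h3
        exact absurd h3 h1
      · exact h
    obtain ⟨y, hy⟩ := exists_of_edgeDeg_pos _ _ h4
    exact key u v p hp rfl y hy
  subst huv
  refine ⟨u, p, ?_, by simpa using Multiset.card_le_card hp⟩
  by_contra hx
  push Not at hx
  obtain ⟨x, hx⟩ := hx
  obtain ⟨q⟩ := hT.preconnected u x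
  obtain ⟨d, -, hd1, hd2⟩ := q.exists_boundary_dart {y | y ∈ p.support} (by simp) hx
  have hd1' : d.fst ∈ p.support := hd1
  have hd2' : d.snd ∉ p.support := hd2
  have hperm : ((p.rotate d.fst hd1').edges : Multiset (Sym2 V)) = p.edges :=
    Multiset.coe_eq_coe.2 (p.rotate_edges d.fst hd1').perm
  refine key d.fst d.fst (p.rotate d.fst hd1') (hperm ▸ hp) (by simp) d.snd ?_
  rw [hperm, Multiset.mem_sub]
  have h1 : s(d.fst, d.snd) ∈ M := hTM _ d.adj
  have h2 : s(d.fst, d.snd) ∉ (p.edges : Multiset (Sym2 V)) := by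
    intro h
    exact hd2' (p.snd_mem_support_of_mem_edges (by simpa using h))
  rw [Multiset.count_eq_zero_of_notMem h2]
  exact Multiset.count_pos.2 h1

theorem edgeDeg_eq_zero_of_notMem {V : Type*} {G : SimpleGraph V} {u v : V} (p : G.Walk u v)
    (J : Multiset (Sym2 V)) (hJ : J ≤ (p.edges : Multiset (Sym2 V))) (x : V)
    (hx : x ∉ p.support) : edgeDeg J x = 0 := by
  by_contra h
  obtain ⟨y, hy⟩ := exists_of_edgeDeg_pos J x (Nat.pos_of_ne_zero h)
  have := Multiset.mem_of_le hJ hy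
  exact hx (p.fst_mem_support_of_mem_edges (by simpa using this))

theorem exists_join {V : Type*} {G : SimpleGraph V} {u v : V} (p : G.Walk u v) (X : Set V) :
    ∃ J : Multiset (Sym2 V), J ≤ (p.edges : Multiset (Sym2 V)) ∧
      ∀ x ∈ p.support, x ≠ v → (Even (edgeDeg J x) ↔ x ∉ X) := by
  classical
  induction p generalizing X with
  | nil => exact ⟨0, by simp, by simp⟩
  | @cons a b c h p ih =>
    have hne := h.ne
    by_cases hc : a ∉ p.support ∧ a ∈ X
    · obtain ⟨hap, haX⟩ := hc
      obtain ⟨J, hJ, hx⟩ := ih {x | if x = b then x ∉ X else x ∈ X}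
      refine ⟨s(a, b) ::ₘ J, ?_, ?_⟩
      · rw [SimpleGraph.Walk.edges_cons, ← Multiset.cons_coe]
        exact Multiset.cons_le_cons _ hJ
      · intro x hxs hxc
        rw [edgeDeg_cons]
        by_cases hxa : x = a
        · subst hxa
          simp [edgeDeg_eq_zero_of_notMem p J hJ x hap, haX]
        · have hxp : x ∈ p.support := by simpa [hxa] using hxs
          have := hx x hxp hxc
          by_cases hxb : x = b
          · subst hxb
            simp at this
            simp [Nat.even_add_one, ← this]
          · simp [hxa, hxb] at this ⊢
            exact this
    · obtain ⟨J, hJ, hx⟩ := ih X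
      refine ⟨J, ?_, ?_⟩
      · rw [SimpleGraph.Walk.edges_cons, ← Multiset.cons_coe]
        exact hJ.trans (Multiset.le_cons_self _ _)
      · intro x hxs hxc
        by_cases hxp : x ∈ p.support
        · exact hx x hxp hxc
        · have hxa : x = a := by simpa [hxp] using hxs
          subst hxa
          rw [edgeDeg_eq_zero_of_notMem p J hJ x hxp]
          simp only [not_and] at hc
          simpa using hc hxp

open Classical in
theorem exists_extend {V : Type*} [Fintype V] {G : SimpleGraph V} (hG : G.Connected) (k : ℕ) :
    ∀ {u : V} (p : G.Walk u u), p.support.toFinset.card + k = Fintype.card V →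
    ∃ (r : V) (w : G.Walk r r), (∀ x : V, x ∈ w.support) ∧ w.length ≤ p.length + 2 * k := by
  induction k with
  | zero =>
    intro u p hp
    refine ⟨u, p, fun x => ?_, by simp⟩
    have : p.support.toFinset = Finset.univ := Finset.card_eq_iff_eq_univ _ |>.1 (by simpa using hp)
    rw [← List.mem_toFinset, this]
    exact Finset.mem_univ x
  | succ k ih =>
    intro u p hp
    have hx : ∃ x, x ∉ p.support := by
      by_contra h
      push Not at h
      have : p.support.toFinset = Finset.univ := by ext x; simp [h x]
      rw [this, Finset.card_univ] at hp
      omega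
    obtain ⟨x, hx⟩ := hx
    obtain ⟨q⟩ := hG.preconnected u x
    obtain ⟨d, -, hd1, hd2⟩ := q.exists_boundary_dart {y | y ∈ p.support} (by simp) hx
    have hd1' : d.fst ∈ p.support := hd1
    have hd2' : d.snd ∉ p.support := hd2
    let w : G.Walk d.snd d.snd :=
      SimpleGraph.Walk.cons d.adj.symm ((p.rotate d.fst hd1').concat d.adj)
    have hw : w.support.toFinset = insert d.snd p.support.toFinset := by
      ext y
      simp [w, SimpleGraph.Walk.support_concat, SimpleGraph.Walk.mem_support_rotate_iff]
    obtain ⟨r, w', h1, h2⟩ := ih w (by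
      rw [hw, Finset.card_insert_of_notMem (by simpa using hd2')]; omega)
    refine ⟨r, w', h1, h2.trans ?_⟩
    simp [w]
    omega

open Classical in
theorem edgeDeg_graph {V : Type*} [Fintype V] (T : SimpleGraph V) (x : V) :
    edgeDeg T.edgeFinset.val x = T.degree x := by
  rw [← SimpleGraph.card_incidenceFinset_eq_degree, SimpleGraph.incidenceFinset_eq_filter,
    edgeDeg, Multiset.countP_eq_card_filter]
  rfl

open Classical in
theorem card_odd_le {V : Type*} [Fintype V] [Nontrivial V] (T : SimpleGraph V) (hT : T.IsTree) :
    (Finset.univ.filter (fun x => Odd (T.degree x))).card + 2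
      ≤ 2 * (Finset.univ.filter (fun x => T.degree x = 1)).card := by
  have h1 := T.sum_degrees_eq_twice_card_edges
  have h2 := hT.card_edgeFinset
  have h3 : ∑ x : V, ((if Odd (T.degree x) then 1 else 0) + 2)
      ≤ ∑ x : V, (T.degree x + 2 * (if T.degree x = 1 then 1 else 0)) := by
    apply Finset.sum_le_sum
    intro x _
    have hpos := hT.connected.preconnected.degree_pos_of_nontrivial x
    split_ifs with ha hb hb
    · omega
    · have : T.degree x ≠ 2 := by rintro h; rw [h] at ha; exact absurd ha (by decide)
      omega
    · omega
    · omega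
  rw [Finset.sum_add_distrib, Finset.sum_add_distrib, ← Finset.mul_sum, ← Finset.card_filter,
    ← Finset.card_filter, h1] at h3
  simp only [Finset.sum_const, Finset.card_univ, smul_eq_mul] at h3
  omega


/-- Let `G` be a connected simple graph on `n` vertices and `c` a
positive integer such that every set of at most `c` vertices is cyclable in `G`.
If `G` contains a spanning tree with at most `c/2 + 1` leaves, then `G` has a TSP
tour of length at most `4n/3`. -/
theorem graphTSP_of_cyclability {V : Type*} [Fintype V]
    (G : SimpleGraph V) (hG : G.Connected)
    (c : ℕ) (hc : 0 < c)
    (hcyc : ∀ X : Finset V, X.card ≤ c →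
      ∃ (u : V) (p : G.Walk u u), p.IsCycle ∧ ∀ x ∈ X, x ∈ p.support)
    (T : SimpleGraph V) (hTG : T ≤ G) (hT : T.IsTree)
    (hleaves : ({v : V | (T.neighborSet v).ncard = 1}.ncard : ℚ) ≤ (c : ℚ) / 2 + 1) :
    ∃ (r : V) (w : G.Walk r r), (∀ x : V, x ∈ w.support) ∧
      (w.length : ℚ) ≤ 4 * (Fintype.card V) / 3 := by
  classical
  obtain ⟨u0, p0, hp0, -⟩ := hcyc ∅ (by simp)
  have hnt : Nontrivial V := ⟨u0, p0.snd, (p0.adj_snd hp0.not_nil).ne⟩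
  have hodd := card_odd_le T hT
  set X := Finset.univ.filter (fun x => Odd (T.degree x)) with hX
  have hl : {v : V | (T.neighborSet v).ncard = 1}.ncard
      = (Finset.univ.filter (fun x => T.degree x = 1)).card := by
    rw [← Set.ncard_coe_finset]
    congr 1
    ext v
    simp [Set.ncard_eq_toFinset_card', SimpleGraph.degree, SimpleGraph.neighborFinset]
  rw [hl] at hleaves
  have hXc : X.card ≤ c := by
    have : (X.card : ℚ) + 2 ≤ 2 * ((Finset.univ.filter (fun x => T.degree x = 1)).card : ℚ) := by
      exact_mod_cast hodd
    have : (X.card : ℚ) ≤ c := by linarith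
    exact_mod_cast this
  obtain ⟨u, p, hp, hpX⟩ := hcyc X hXc
  have hcard : p.support.toFinset.card = p.length := by
    have h1 : p.support.toFinset = p.support.tail.toFinset := by
      ext x
      rw [List.mem_toFinset, List.mem_toFinset, p.mem_support_iff]
      constructor
      · rintro (rfl | h)
        · exact SimpleGraph.Walk.end_mem_tail_support hp.not_nil
        · exact h
      · exact Or.inr
    rw [h1, List.toFinset_card_of_nodup hp.support_nodup]
    simp
  by_cases hlen : 2 * Fintype.card V ≤ 3 * p.length
  · have hle : p.support.toFinset.card ≤ Fintype.card V := Finset.card_le_univ _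
    obtain ⟨r, w, hw, hwl⟩ := exists_extend hG (Fintype.card V - p.length) p (by omega)
    refine ⟨r, w, hw, ?_⟩
    have : 3 * w.length ≤ 4 * Fintype.card V := by omega
    have : (3 : ℚ) * w.length ≤ 4 * Fintype.card V := by exact_mod_cast this
    linarith
  · obtain ⟨J, hJ, hJx⟩ := exists_join p (X : Set V)
    have hE := hT.card_edgeFinset
    have hmain : ∀ J : Multiset (Sym2 V), J ≤ (p.edges : Multiset (Sym2 V)) →
        (∀ x, Even (edgeDeg (T.edgeFinset.val + J) x)) → 2 * J.card ≤ p.length →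
        ∃ (r : V) (w : G.Walk r r), (∀ x : V, x ∈ w.support) ∧
      (w.length : ℚ) ≤ 4 * (Fintype.card V) / 3 := by
      intro J hJ hev hJc
      obtain ⟨r, w, hw, hwl⟩ := exists_euler (G := G) hT.connected (T.edgeFinset.val + J) (by
        intro e he
        rcases Multiset.mem_add.1 he with h | h
        · exact SimpleGraph.edgeSet_mono hTG (by simpa using h)
        · exact p.edges_subset_edgeSet (by simpa using Multiset.mem_of_le hJ h)) (by
        intro e he
        exact Multiset.mem_add.2 (Or.inl (by simpa using he))) hev
      refine ⟨r, w, hw, ?_⟩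
      rw [Multiset.card_add, Finset.card_val] at hwl
      have : 3 * w.length ≤ 4 * Fintype.card V := by omega
      have : (3 : ℚ) * w.length ≤ 4 * Fintype.card V := by exact_mod_cast this
      linarith
    have hev1 : ∀ x, x ≠ u → Even (edgeDeg (T.edgeFinset.val + J) x) := by
      intro x hxu
      rw [edgeDeg_add, edgeDeg_graph, Nat.even_add]
      have hXx : x ∉ X ↔ Even (T.degree x) := by simp [hX]
      by_cases hxp : x ∈ p.support
      · rw [hJx x hxp hxu, ← hXx]
        simp
      · rw [edgeDeg_eq_zero_of_notMem p J hJ x hxp, ← hXx]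
        simp only [Even.zero, iff_true]
        exact fun h => hxp (hpX x h)
    have hev : ∀ x, Even (edgeDeg (T.edgeFinset.val + J) x) := by
      intro x
      by_cases hxu : x = u
      · subst hxu
        have hs := sum_edgeDeg (T.edgeFinset.val + J) (by
          intro e he
          apply G.not_isDiag_of_mem_edgeSet
          rcases Multiset.mem_add.1 he with h | h
          · exact SimpleGraph.edgeSet_mono hTG (by simpa using h)
          · exact p.edges_subset_edgeSet (by simpa using Multiset.mem_of_le hJ h))
        rw [← Finset.add_sum_erase _ _ (Finset.mem_univ x)] at hs
        have h2 : Even (∑ y ∈ Finset.univ.erase x, edgeDeg (T.edgeFinset.val + J) y) :=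
          Finset.even_sum _ (fun y hy => hev1 y (Finset.ne_of_mem_erase hy))
        have h3 := even_two_mul (T.edgeFinset.val + J).card
        rw [← hs, Nat.even_add] at h3
        exact h3.2 h2
      · exact hev1 x hxu
    have hsplit : ((p.edges : Multiset (Sym2 V)) - J) + J = p.edges := tsub_add_cancel_of_le hJ
    have hc2 := congrArg Multiset.card hsplit
    rw [Multiset.card_add, Multiset.coe_card, SimpleGraph.Walk.length_edges] at hc2
    by_cases hJc : 2 * J.card ≤ p.length
    · exact hmain J hJ hev hJc
    · refine hmain _ (Multiset.sub_le_self _ J) (fun x => ?_) (by omega)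
      have h1 := hev x
      have h2 : Even (edgeDeg (p.edges : Multiset (Sym2 V)) x) := by simp [edgeDeg_walk]
      rw [← hsplit, edgeDeg_add, Nat.even_add] at h2
      rw [edgeDeg_add, Nat.even_add] at h1 ⊢
      rw [h1, h2]
end

section
/- Let G be a 3-vertex-connected cubic (3-regular) simple graph on n vertices that contains a spanning tree with at most five leaves. Then G has a TSP tour of length at most 4n/3. -/
set_option linter.unusedSectionVars false
set_option linter.unusedSimpArgs false
set_option linter.unusedVariables false

namespace TJ
open Finset

section
variable {V E : Type*} [DecidableEq E]

/-- boundary of an edge set tested against a function -/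
def bd (s t : E → V) (F : Finset E) (S : V → ZMod 2) : ZMod 2 := ∑ e ∈ F, (S (s e) + S (t e))

def Jn (s t : E → V) (F : Finset E) (a b : V) : Prop := ∀ S, bd s t F S = S a + S b

lemma z2 (x : ZMod 2) : x + x = 0 := CharTwo.add_self_eq_zero x

lemma z2cases (x : ZMod 2) : x = 0 ∨ x = 1 := by revert x; decide

lemma z2ne (x y : ZMod 2) : x + y = 1 ↔ x ≠ y := by revert x y; decide

lemma bd_disj (s t : E → V) {F F' : Finset E} (h : Disjoint F F') (S : V → ZMod 2) :
    bd s t (F ∪ F') S = bd s t F S + bd s t F' S := sum_union h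

lemma bd_sdiff (s t : E → V) {F Y : Finset E} (h : Y ⊆ F) (S : V → ZMod 2) :
    bd s t (F \ Y) S = bd s t F S + bd s t Y S := by
  have := sum_sdiff (f := fun e => S (s e) + S (t e)) h
  unfold bd
  rw [← this, add_assoc, z2, add_zero]

lemma bd_erase (s t : E → V) {F : Finset E} {e : E} (h : e ∈ F) (S : V → ZMod 2) :
    bd s t (F.erase e) S = bd s t F S + (S (s e) + S (t e)) := by
  have := sum_erase_add F (fun e => S (s e) + S (t e)) h
  unfold bd
  rw [← this, add_assoc, z2, add_zero]

lemma bd_insert (s t : E → V) {F : Finset E} {e : E} (h : e ∉ F) (S : V → ZMod 2) :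
    bd s t (insert e F) S = (S (s e) + S (t e)) + bd s t F S := sum_insert h

lemma bd_symm (s t : E → V) (F Y : Finset E) (S : V → ZMod 2) :
    bd s t (symmDiff F Y) S = bd s t F S + bd s t Y S := by
  have h1 : symmDiff F Y = (F \ Y) ∪ (Y \ F) := rfl
  have h2 : Disjoint (F \ Y) (Y \ F) := by
    rw [Finset.disjoint_left]; intro x; simp; tauto
  rw [h1, bd_disj s t h2]
  have h3 : F \ Y = F \ (F ∩ Y) := by ext; simp
  have h4 : Y \ F = Y \ (F ∩ Y) := by ext; simp
  rw [h3, h4, bd_sdiff s t inter_subset_left, bd_sdiff s t inter_subset_right]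
  linear_combination z2 (bd s t (F ∩ Y) S)

lemma Jn.symm {s t : E → V} {F : Finset E} {a b : V} (h : Jn s t F a b) : Jn s t F b a := by
  intro S; rw [h S, add_comm]

/-- reachability -/
def Rch (s t : E → V) (X : Finset E) (a v : V) : Prop := ∃ Y ⊆ X, Jn s t Y a v

lemma Rch_refl (s t : E → V) (X : Finset E) (a : V) : Rch s t X a a :=
  ⟨∅, by simp, fun S => by simp [bd, z2]⟩

lemma Rch_step (s t : E → V) (X : Finset E) (a : V) {e : E} (he : e ∈ X) :
    Rch s t X a (s e) ↔ Rch s t X a (t e) := by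
  constructor
  · rintro ⟨Y, hY, h⟩
    refine ⟨symmDiff Y {e}, ?_, ?_⟩
    · intro x hx
      simp [mem_symmDiff] at hx
      rcases hx with hx | hx
      · exact hY hx.1
      · rw [hx.1]; exact he
    · intro S; rw [bd_symm, h S]; simp [bd]; linear_combination z2 (S (s e))
  · rintro ⟨Y, hY, h⟩
    refine ⟨symmDiff Y {e}, ?_, ?_⟩
    · intro x hx
      simp [mem_symmDiff] at hx
      rcases hx with hx | hx
      · exact hY hx.1
      · rw [hx.1]; exact he
    · intro S; rw [bd_symm, h S]; simp [bd]; linear_combination z2 (S (t e))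

open Classical in
noncomputable def ind (P : V → Prop) : V → ZMod 2 := fun v => if P v then 1 else 0

lemma bd_Rch (s t : E → V) (X : Finset E) (a : V) : bd s t X (ind (Rch s t X a)) = 0 := by
  apply sum_eq_zero
  intro e he
  have := Rch_step s t X a he
  unfold ind
  by_cases h : Rch s t X a (s e)
  · rw [if_pos h, if_pos (this.1 h), z2]
  · rw [if_neg h, if_neg (fun h' => h (this.2 h')), z2]

lemma ind_eq_one {P : V → Prop} {v : V} : ind P v = 1 ↔ P v := by
  unfold ind; split_ifs <;> simp_all

lemma ind_eq_zero {P : V → Prop} {v : V} : ind P v = 0 ↔ ¬ P v := by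
  unfold ind; split_ifs <;> simp_all

/-- linking lemma -/
lemma link (s t : E → V) (X : Finset E) (b z p q : V)
    (h : ∀ S, bd s t X S = S b + S z + S p + S q) :
    Rch s t X b z ∨ Rch s t X b p ∨ Rch s t X b q := by
  by_contra hc
  push Not at hc
  have := h (ind (Rch s t X b))
  rw [bd_Rch, ind_eq_one.2 (Rch_refl s t X b), ind_eq_zero.2 hc.1, ind_eq_zero.2 hc.2.1,
    ind_eq_zero.2 hc.2.2] at this
  simp at this

lemma bd_decomp [Fintype V] (s t : E → V) (F : Finset E) (S : V → ZMod 2) :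
    bd s t F S = ∑ v, S v * bd s t F (ind (· = v)) := by
  classical
  unfold bd
  simp_rw [mul_sum]
  rw [sum_comm]
  apply sum_congr rfl
  intro e _
  simp [ind, mul_add, sum_add_distrib]

/-- edges non-loop incident with b -/
def inc (s t : E → V) (b : V) (e : E) : Prop := (s e = b ∧ t e ≠ b) ∨ (s e ≠ b ∧ t e = b)

lemma inc_other {s t : E → V} {b : V} {e : E} (h : inc s t b e) :
    ∃ x, x ≠ b ∧ ∀ S : V → ZMod 2, S (s e) + S (t e) = S b + S x := by
  rcases h with ⟨h1, h2⟩ | ⟨h1, h2⟩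
  · exact ⟨t e, h2, fun S => by rw [h1]⟩
  · exact ⟨s e, h1, fun S => by rw [h2, add_comm]⟩

lemma bd_single_of_no_inc {s t : E → V} {F : Finset E} {b : V} (h : ∀ e ∈ F, ¬ inc s t b e) :
    bd s t F (ind (· = b)) = 0 := by
  apply sum_eq_zero
  intro e he
  have := h e he
  unfold inc at this
  unfold ind
  by_cases h1 : s e = b <;> by_cases h2 : t e = b <;> simp_all [z2]

def nb (s t : E → V) (b v : V) : Prop :=
  v ≠ b ∧ ∃ e, inc s t b e ∧ ∀ S : V → ZMod 2, S (s e) + S (t e) = S b + S v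

lemma wsum_sdiff (w : E → ℤ) {F Y : Finset E} (h : Y ⊆ F) :
    ∑ e ∈ F \ Y, w e = ∑ e ∈ F, w e - ∑ e ∈ Y, w e := by
  have := sum_sdiff (f := w) h
  omega

/-- choice of the lexicographically minimal path -/
lemma exists_F [Fintype V] [Fintype E] (s t : E → V) (w : E → ℤ)
    (hl : ∀ e, s e = t e → w e = 0) {e1 : E} (he1 : w e1 = -1) :
    ∃ (a b : V) (F : Finset E), Jn s t F a b ∧ ∑ e ∈ F, w e < 0 ∧
      (∀ a' b' F', Jn s t F' a' b' → ∑ e ∈ F, w e ≤ ∑ e ∈ F', w e) ∧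
      (∀ a' b' F', Jn s t F' a' b' → ∑ e ∈ F', w e ≤ ∑ e ∈ F, w e → F.card ≤ F'.card) := by
  classical
  have h1 : Jn s t {e1} (s e1) (t e1) := fun S => by simp [bd]
  obtain ⟨x, hx, hmin⟩ := Finset.exists_min_image
    (univ.filter (fun x : V × V × Finset E => Jn s t x.2.2 x.1 x.2.1))
    (fun x => toLex (∑ e ∈ x.2.2, w e, x.2.2.card)) ⟨(s e1, t e1, {e1}), by simpa using h1⟩
  simp only [mem_filter, mem_univ, true_and] at hx hmin
  have key : ∀ a' b' F', Jn s t F' a' b' → ∑ e ∈ x.2.2, w e < ∑ e ∈ F', w e ∨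
      (∑ e ∈ x.2.2, w e = ∑ e ∈ F', w e ∧ x.2.2.card ≤ F'.card) := by
    intro a' b' F' h
    have := hmin (a', b', F') h
    rw [Prod.Lex.le_iff] at this
    simpa using this
  refine ⟨x.1, x.2.1, x.2.2, hx, ?_, ?_, ?_⟩
  · have := key _ _ _ h1
    simp [he1] at this
    omega
  · intro a' b' F' h
    have := key _ _ _ h
    omega
  · intro a' b' F' h h'
    have := key _ _ _ h
    omega

lemma star [Fintype V] [Fintype E] (s t : E → V) (w : E → ℤ) (c : V → ZMod 2)
    (hw : ∀ e, s e ≠ t e → w e = 1 ∨ w e = -1) (hl : ∀ e, s e = t e → w e = 0)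
    (hc : ∀ e, s e ≠ t e → c (s e) ≠ c (t e))
    (hcons : ∀ F : Finset E, (∀ S, bd s t F S = 0) → 0 ≤ ∑ e ∈ F, w e)
    {e1 : E} (he1 : w e1 = -1) :
    ∃ (b : V) (e0 : E), inc s t b e0 ∧ w e0 = -1 ∧ (∀ e, inc s t b e → w e = -1 → e = e0) ∧
      ∀ C : Finset E, (∀ e ∈ C, ¬ inc s t b e) →
        (∀ S : V → ZMod 2, (∀ v, nb s t b v → S v = S b) → bd s t C S = 0) →
        0 ≤ ∑ e ∈ C, w e := by
  classical
  obtain ⟨a, b, F, hF, hneg, hmin, hcard⟩ := exists_F s t w hl he1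
  have hab : a ≠ b := by
    rintro rfl
    have := hcons F (fun S => by rw [hF S, z2])
    omega
  have incne : ∀ e, inc s t b e → s e ≠ t e := by
    rintro e (⟨h1, h2⟩ | ⟨h1, h2⟩) h <;> simp_all
  -- edges at b in F are negative
  have hin : ∀ e ∈ F, inc s t b e → w e = -1 := by
    intro e he hi
    obtain ⟨x, hxb, hx⟩ := inc_other hi
    have h1 : Jn s t (F.erase e) a x := by
      intro S
      rw [bd_erase s t he, hF S, hx S]
      linear_combination z2 (S b)
    have h2 := hmin _ _ _ h1
    have h3 := sum_erase_add F w he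
    rcases hw e (incne e hi) with h | h
    · omega
    · exact h
  have hout : ∀ e, inc s t b e → w e = -1 → e ∈ F := by
    intro e hi hwe
    by_contra he
    obtain ⟨x, hxb, hx⟩ := inc_other hi
    have h1 : Jn s t (insert e F) a x := by
      intro S
      rw [bd_insert s t he, hF S, hx S]
      linear_combination z2 (S b)
    have h2 := hmin _ _ _ h1
    rw [sum_insert he] at h2
    omega
  -- removing a cycle from F
  have hsub : ∀ Y ⊆ F, Jn s t Y a b → Y = F := by
    intro Y hY hJ
    have h1 := hcons (F \ Y) (fun S => by rw [bd_sdiff s t hY, hF S, hJ S, z2])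
    rw [wsum_sdiff w hY] at h1
    have := hcard _ _ _ hJ (by omega)
    exact Finset.eq_of_subset_of_card_le hY this
  -- exactly one edge
  have hone : ∃ e0 ∈ F, inc s t b e0 ∧ ∀ e ∈ F, inc s t b e → e = e0 := by
    set X := F.filter (fun e => ¬ inc s t b e) with hX
    set D := F.filter (fun e => inc s t b e) with hD
    have hXb : ¬ Rch s t X a b := by
      rintro ⟨Y, hY, hJ⟩
      have h1 := hJ (ind (· = b))
      rw [bd_single_of_no_inc (fun e he => (mem_filter.1 (hY he)).2)] at h1
      simp [ind, hab] at h1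
    have h1 : bd s t F (ind (Rch s t X a)) = 1 := by
      rw [hF, ind_eq_one.2 (Rch_refl s t X a), ind_eq_zero.2 hXb, add_zero]
    have h2 : bd s t F (ind (Rch s t X a)) =
        bd s t D (ind (Rch s t X a)) + bd s t X (ind (Rch s t X a)) :=
      (sum_filter_add_sum_filter_not F _ _).symm
    rw [bd_Rch, add_zero, h1] at h2
    have h3 : ∃ e ∈ D, ind (Rch s t X a) (s e) + ind (Rch s t X a) (t e) ≠ 0 := by
      by_contra hcon
      push Not at hcon
      have : bd s t D (ind (Rch s t X a)) = 0 := sum_eq_zero hcon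
      rw [this] at h2
      exact one_ne_zero h2
    obtain ⟨e, he, hne⟩ := h3
    rw [hD, mem_filter] at he
    obtain ⟨x, hxb, hx⟩ := inc_other he.2
    rw [hx, ind_eq_zero.2 hXb, zero_add] at hne
    have hxR : Rch s t X a x := by
      by_contra h; exact hne (ind_eq_zero.2 h)
    obtain ⟨Y, hY, hJ⟩ := hxR
    have heY : e ∉ Y := fun h => (mem_filter.1 (hY h)).2 he.2
    have h4 : insert e Y = F := by
      apply hsub
      · intro z hz
        rcases mem_insert.1 hz with rfl | hz
        · exact he.1
        · exact (mem_filter.1 (hY hz)).1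
      · intro S
        rw [bd_insert s t heY, hJ S, hx S]
        linear_combination z2 (S x)
    refine ⟨e, he.1, he.2, ?_⟩
    intro e' he' hi'
    rw [← h4] at he'
    rcases mem_insert.1 he' with h | h
    · exact h
    · exact absurd hi' (mem_filter.1 (hY h)).2
  obtain ⟨e0, he0F, he0i, he0u⟩ := hone
  refine ⟨b, e0, he0i, hin e0 he0F he0i, fun e hi hwe => he0u e (hout e hi hwe) hi, ?_⟩
  -- main part
  by_contra hbad
  push Not at hbad
  obtain ⟨C, hC, hCmin⟩ := Finset.exists_min_image
    (univ.filter (fun C : Finset E => (∀ e ∈ C, ¬ inc s t b e) ∧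
      (∀ S : V → ZMod 2, (∀ v, nb s t b v → S v = S b) → bd s t C S = 0) ∧ ∑ e ∈ C, w e < 0))
    Finset.card (by obtain ⟨C, h⟩ := hbad; exact ⟨C, by simpa using h⟩)
  simp only [mem_filter, mem_univ, true_and] at hC hCmin
  obtain ⟨hCb, hCcyc, hCneg⟩ := hC
  -- sub-cycles
  have hCsub : ∀ P ⊆ C, P.Nonempty →
      (∀ S : V → ZMod 2, (∀ v, nb s t b v → S v = S b) → bd s t P S = 0) → P = C := by
    intro P hP hne hPc
    by_contra hPC
    have hlt : P.card < C.card := Finset.card_lt_card (hP.ssubset_of_ne hPC)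
    have hlt2 : (C \ P).card < C.card := by
      have := Finset.card_sdiff_add_card_eq_card hP
      have := hne.card_pos
      omega
    have h1 : ¬ ∑ e ∈ P, w e < 0 := fun h => by
      have := hCmin P ⟨fun e he => hCb e (hP he), hPc, h⟩
      omega
    have h2 : ¬ ∑ e ∈ C \ P, w e < 0 := fun h => by
      have := hCmin (C \ P) ⟨fun e he => hCb e (mem_sdiff.1 he).1, fun S hS => by
        rw [bd_sdiff s t hP, hCcyc S hS, hPc S hS, add_zero], h⟩
      omega
    rw [wsum_sdiff w hP] at h2
    omega
  -- an odd vertex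
  have hodd : ∃ x, bd s t C (ind (· = x)) ≠ 0 := by
    by_contra hcon
    push Not at hcon
    have := hcons C (fun S => by
      rw [bd_decomp]; apply sum_eq_zero; intro v _; rw [hcon v, mul_zero])
    omega
  have hoddnb : ∀ x, bd s t C (ind (· = x)) ≠ 0 → nb s t b x := by
    intro x hx
    by_contra hnb
    by_cases hxb : x = b
    · subst hxb; exact hx (bd_single_of_no_inc hCb)
    · apply hx
      apply hCcyc
      intro v hv
      have h1 : ¬ v = x := by rintro rfl; exact hnb hv
      simp [ind, h1, Ne.symm hxb]
  obtain ⟨x, hx⟩ := hodd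
  have hxnb := hoddnb x hx
  have hy : ∃ y, y ≠ x ∧ Rch s t C x y ∧ bd s t C (ind (· = y)) ≠ 0 := by
    by_contra hcon
    push Not at hcon
    have h1 := bd_Rch s t C x
    rw [bd_decomp, Finset.sum_eq_single x] at h1
    · rw [ind_eq_one.2 (Rch_refl s t C x), one_mul] at h1
      exact hx h1
    · intro y _ hyx
      by_cases hr : Rch s t C x y
      · rw [hcon y hyx hr, mul_zero]
      · rw [ind_eq_zero.2 hr, zero_mul]
    · simp
  obtain ⟨y, hyx, ⟨P, hPC, hPJ⟩, hyo⟩ := hy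
  have hynb := hoddnb y hyo
  have hPne : P.Nonempty := by
    rw [Finset.nonempty_iff_ne_empty]
    rintro rfl
    have := hPJ (ind (· = x))
    simp [bd, ind, hyx] at this
  obtain rfl : P = C := hCsub P hPC hPne (fun S hS => by
    rw [hPJ S, hS x hxnb, hS y hynb, z2])
  -- all edges of P are reachable from x
  have hreach : ∀ e ∈ P, Rch s t P x (s e) := by
    set P0 := P.filter (fun e => Rch s t P x (s e)) with hP0
    have hbd0 : ∀ S, bd s t P0 S = S x + S y := by
      intro S
      have h1 := hPJ (fun v => ind (Rch s t P x) v * S v)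
      rw [ind_eq_one.2 (Rch_refl s t P x), ind_eq_one.2 (show Rch s t P x y from ⟨P, hPC, hPJ⟩),
        one_mul, one_mul] at h1
      rw [← h1]
      unfold bd
      rw [hP0, sum_filter]
      apply sum_congr rfl
      intro e he
      have h2 := Rch_step s t P x he
      beta_reduce
      by_cases h : Rch s t P x (s e)
      · rw [if_pos h, ind_eq_one.2 h, ind_eq_one.2 (h2.1 h), one_mul, one_mul]
      · rw [if_neg h, ind_eq_zero.2 h, ind_eq_zero.2 (fun h' => h (h2.2 h')), zero_mul, zero_mul,
          add_zero]
    have hne : P0.Nonempty := by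
      rw [Finset.nonempty_iff_ne_empty]
      intro h
      have := hbd0 (ind (· = x))
      simp [h, bd, ind, hyx] at this
    have := hCsub P0 (filter_subset _ _) hne (fun S hS => by
      rw [hbd0 S, hS x hxnb, hS y hynb, z2])
    intro e he
    rw [← this] at he
    exact (mem_filter.1 he).2
  -- parity
  have hpar : ((∑ e ∈ P, w e : ℤ) : ZMod 2) = 0 := by
    have h1 : ∀ v, nb s t b v → c v = c b + 1 := by
      rintro v ⟨hv, e, hi, hS⟩
      have h2 := hS c
      rw [(z2ne _ _).2 (hc e (incne e hi))] at h2
      rw [h2]; linear_combination -z2 (c b)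
    have h3 := hPJ c
    rw [h1 x hxnb, h1 y hynb, z2] at h3
    rw [← h3]
    push_cast
    unfold bd
    apply sum_congr rfl
    intro e _
    by_cases h : s e = t e
    · rw [hl e h, h, z2]; simp
    · rw [(z2ne _ _).2 (hc e h)]
      rcases hw e h with h | h <;> rw [h] <;> decide
  have heven : (2 : ℤ) ∣ ∑ e ∈ P, w e := (ZMod.intCast_zmod_eq_zero_iff_dvd _ 2).1 hpar
  obtain ⟨hxb, ex, hexi, hex⟩ := hxnb
  obtain ⟨hyb, ey, heyi, hey⟩ := hynb
  have hexy : ex ≠ ey := by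
    rintro rfl
    have h1 := hex (ind (· = x))
    rw [hey] at h1
    simp [ind, hyx, Ne.symm hxb] at h1
  have hexP : ex ∉ P := fun h => hCb ex h hexi
  have heyP : ey ∉ P := fun h => hCb ey h heyi
  have hcyc := hcons (insert ex (insert ey P)) (fun S => by
    rw [bd_insert s t (by simp [hexy, hexP]), bd_insert s t heyP, hPJ S, hex S, hey S]
    linear_combination z2 (S b) + z2 (S x) + z2 (S y))
  rw [sum_insert (by simp [hexy, hexP]), sum_insert heyP] at hcyc
  have h01 : w ex = 1 ∧ w ey = 1 := by
    rcases hw ex (incne ex hexi) with h1 | h1 <;> rcases hw ey (incne ey heyi) with h2 | h2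
    · exact ⟨h1, h2⟩
    · exfalso; omega
    · exfalso; omega
    · exfalso; omega
  obtain ⟨hwx, hwy⟩ := h01
  have hP2 : ∑ e ∈ P, w e = -2 := by omega
  have hexF : ex ∉ F := fun h => by have := hin ex h hexi; omega
  have heyF : ey ∉ F := fun h => by have := hin ey h heyi; omega
  have hbP : ¬ Rch s t P x b := by
    rintro ⟨Q, hQ, hJ⟩
    have h1 := hJ (ind (· = b))
    rw [bd_single_of_no_inc (fun e he => hCb e (hQ he))] at h1
    simp [ind, hxb] at h1
  by_cases hcand : ∃ Y ⊆ F, ∃ z, Rch s t P x z ∧ Jn s t Y b z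
  · obtain ⟨Y, hY, hYmin⟩ := Finset.exists_min_image
      (univ.filter (fun Y : Finset E => Y ⊆ F ∧ ∃ z, Rch s t P x z ∧ Jn s t Y b z))
      Finset.card (by obtain ⟨Y, h1, h2⟩ := hcand; exact ⟨Y, by simpa using ⟨h1, h2⟩⟩)
    simp only [mem_filter, mem_univ, true_and] at hY hYmin
    obtain ⟨hYF, z, hz, hYJ⟩ := hY
    have hdisj : Disjoint Y P := by
      rw [Finset.disjoint_left]
      intro e heY heP
      have hl := link s t (Y.erase e) b z (s e) (t e) (fun S => by
        rw [bd_erase s t heY, hYJ S]; ring)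
      have hlt : (Y.erase e).card < Y.card := Finset.card_erase_lt_of_mem heY
      have : ∃ z, Rch s t P x z ∧ Rch s t (Y.erase e) b z := by
        rcases hl with h | h | h
        · exact ⟨z, hz, h⟩
        · exact ⟨s e, hreach e heP, h⟩
        · exact ⟨t e, (Rch_step s t P x heP).1 (hreach e heP), h⟩
      obtain ⟨z', hz', Y', hY', hJ'⟩ := this
      have h1 := hYmin Y' ⟨fun i hi => hYF (mem_of_mem_erase (hY' hi)), z', hz', hJ'⟩
      have := Finset.card_le_card hY'
      omega
    obtain ⟨Q, hQP, hQJ⟩ := hz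
    have hYQ : Disjoint Y Q := hdisj.mono_right hQP
    have hYQ' : Disjoint Y (P \ Q) := hdisj.mono_right sdiff_subset
    have e1 := hcons (insert ex (Y ∪ Q)) (fun S => by
      rw [bd_insert s t (by simp only [mem_union]; rintro (h | h); exacts [hexF (hYF h), hexP (hQP h)]),
        bd_disj s t hYQ, hYJ S, hQJ S, hex S]
      linear_combination z2 (S b) + z2 (S x) + z2 (S z))
    have e2 := hcons (insert ey (Y ∪ (P \ Q))) (fun S => by
      rw [bd_insert s t (by simp only [mem_union]; rintro (h | h); exacts [heyF (hYF h), heyP (sdiff_subset h)]),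
        bd_disj s t hYQ', hYJ S, bd_sdiff s t hQP, hPJ S, hQJ S, hey S]
      linear_combination z2 (S b) + z2 (S x) + z2 (S z) + z2 (S y))
    rw [sum_insert (by simp only [mem_union]; rintro (h | h); exacts [hexF (hYF h), hexP (hQP h)]),
      sum_union hYQ] at e1
    rw [sum_insert (by simp only [mem_union]; rintro (h | h); exacts [heyF (hYF h), heyP (sdiff_subset h)]),
      sum_union hYQ', wsum_sdiff w hQP] at e2
    have hw0 : 0 ≤ ∑ e ∈ Y, w e := by omega
    have h3 := hcard a z (F \ Y) (fun S => by
      rw [bd_sdiff s t hYF, hF S, hYJ S]; linear_combination z2 (S b)) (by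
      rw [wsum_sdiff w hYF]; omega)
    have hYne : Y.Nonempty := by
      rw [Finset.nonempty_iff_ne_empty]
      rintro rfl
      apply hbP
      have hzb : z = b := by
        by_contra hzb
        have := hYJ (ind (· = b))
        simp [bd, ind, hzb] at this
      rw [← hzb]
      exact ⟨Q, hQP, hQJ⟩
    have h4 := Finset.card_sdiff_add_card_eq_card hYF
    have := hYne.card_pos
    omega
  · have hdisj : Disjoint F P := by
      rw [Finset.disjoint_left]
      intro e heF heP
      have hl := link s t (F.erase e) b a (s e) (t e) (fun S => by
        rw [bd_erase s t heF, hF S]; ring)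
      rcases hl with ⟨Y, hY, hJ⟩ | ⟨Y, hY, hJ⟩ | ⟨Y, hY, hJ⟩
      · have := hsub Y (hY.trans (erase_subset _ _)) hJ.symm
        rw [← this] at heF
        exact absurd (hY heF) (by simp)
      · exact hcand ⟨Y, hY.trans (erase_subset _ _), _, hreach e heP, hJ⟩
      · exact hcand ⟨Y, hY.trans (erase_subset _ _), _,
          (Rch_step s t P x heP).1 (hreach e heP), hJ⟩
    have h1 := hmin a y (insert ex (F ∪ P)) (fun S => by
      rw [bd_insert s t (by simp [hexF, hexP]), bd_disj s t hdisj, hF S, hPJ S, hex S]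
      linear_combination z2 (S b) + z2 (S x))
    rw [sum_insert (by simp [hexF, hexP]), sum_union hdisj] at h1
    omega

lemma ind_ne_iff_inc {s t : E → V} {b : V} {e : E} :
    ind (· = b) (s e) ≠ ind (· = b) (t e) ↔ inc s t b e := by
  unfold ind inc
  by_cases h3 : s e = b <;> by_cases h4 : t e = b <;> simp [h3, h4]

set_option maxHeartbeats 1000000 in
open Classical in
theorem tjoin [Fintype V] [Fintype E] (N : ℕ) : ∀ (s t : E → V) (w : E → ℤ) (c : V → ZMod 2)
    (hw : ∀ e, s e ≠ t e → w e = 1 ∨ w e = -1) (hl : ∀ e, s e = t e → w e = 0)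
    (hc : ∀ e, s e ≠ t e → c (s e) ≠ c (t e))
    (hcons : ∀ F : Finset E, (∀ S, bd s t F S = 0) → 0 ≤ ∑ e ∈ F, w e)
    (hcut : ∀ S : V → ZMod 2, Odd (univ.filter (fun e => w e = -1 ∧ S (s e) ≠ S (t e))).card →
      3 ≤ (univ.filter (fun e => S (s e) ≠ S (t e))).card)
    (hN : (univ.filter (fun e => s e ≠ t e)).card ≤ N),
    3 * (univ.filter (fun e => w e = -1)).card ≤ (univ.filter (fun e => s e ≠ t e)).card := by
  induction N with
  | zero =>
    intro s t w c hw hl hc hcons hcut hN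
    have h1 : (univ.filter (fun e => w e = -1)) ⊆ (univ.filter (fun e => s e ≠ t e)) := by
      intro e he
      simp only [mem_filter, mem_univ, true_and] at he ⊢
      intro h
      have := hl e h
      omega
    have := card_le_card h1
    omega
  | succ N ih =>
    intro s t w c hw hl hc hcons hcut hN
    by_cases hex : ∃ e1, w e1 = -1
    swap
    · push Not at hex
      rw [filter_false_of_mem (fun e _ => hex e)]
      simp
    obtain ⟨e1, he1⟩ := hex
    obtain ⟨b, e0, hi0, hw0, hu0, hcy⟩ := star s t w c hw hl hc hcons he1
    have incne : ∀ e, inc s t b e → s e ≠ t e := by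
      rintro e (⟨h1, h2⟩ | ⟨h1, h2⟩) h <;> simp_all
    set f : V → V := fun v => if nb s t b v then b else v with hf
    have hfb : f b = b := by simp [hf]
    have hfnb : ∀ v, nb s t b v → f v = b := fun v hv => by simp [hf, hv]
    have hfn : ∀ v, ¬ nb s t b v → f v = v := fun v hv => by simp [hf, hv]
    have hcnb : ∀ v, nb s t b v → c v = c b + 1 := by
      rintro v ⟨hv, e, hi, hS⟩
      have h2 := hS c
      rw [(z2ne _ _).2 (hc e (incne e hi))] at h2
      rw [h2]; linear_combination -z2 (c b)
    have hinc_nb : ∀ e, inc s t b e → f (s e) = b ∧ f (t e) = b := by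
      rintro e hi
      rcases id hi with ⟨h1, h2⟩ | ⟨h1, h2⟩
      · refine ⟨by rw [h1, hfb], hfnb _ ⟨h2, e, hi, fun S => by rw [h1]⟩⟩
      · refine ⟨hfnb _ ⟨h1, e, hi, fun S => by rw [h2, add_comm]⟩, by rw [h2, hfb]⟩
    -- new loops
    have hloop : ∀ e, s e ≠ t e → ¬ inc s t b e → f (s e) ≠ f (t e) := by
      intro e hne hni heq
      have hs : s e ≠ b := fun h => hni (Or.inl ⟨h, fun h' => hne (h.trans h'.symm)⟩)
      have ht : t e ≠ b := fun h => hni (Or.inr ⟨fun h' => hne (h'.trans h.symm), h⟩)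
      by_cases h1 : nb s t b (s e) <;> by_cases h2 : nb s t b (t e)
      · exact hc e hne ((hcnb _ h1).trans (hcnb _ h2).symm)
      · rw [hfnb _ h1, hfn _ h2] at heq; exact ht heq.symm
      · rw [hfn _ h1, hfnb _ h2] at heq; exact hs heq
      · rw [hfn _ h1, hfn _ h2] at heq; exact hne heq
    have hnl : ∀ e, f (s e) ≠ f (t e) ↔ s e ≠ t e ∧ ¬ inc s t b e := by
      intro e
      constructor
      · intro h
        exact ⟨fun h' => h (by rw [h']), fun h' => h (by rw [(hinc_nb e h').1, (hinc_nb e h').2])⟩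
      · rintro ⟨h1, h2⟩; exact hloop e h1 h2
    set w' : E → ℤ := fun e => if inc s t b e then 0 else w e with hw'
    set c' : V → ZMod 2 := fun v => if v = b then c b + 1 else c v with hc'
    have hc'f : ∀ v, v ≠ b → c' (f v) = c v := by
      intro v hv
      by_cases h : nb s t b v
      · rw [hfnb v h, hcnb v h]; simp [hc']
      · rw [hfn v h]; simp [hc', hv]
    have hwneg : ∀ e, w' e = -1 ↔ w e = -1 ∧ ¬ inc s t b e := by
      intro e
      by_cases h : inc s t b e <;> simp [hw', h]
    have key := ih (fun e => f (s e)) (fun e => f (t e)) w' c' ?_ ?_ ?_ ?_ ?_ ?_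
    · have h3 := hcut (ind (· = b)) (by
        have : (univ.filter (fun e => w e = -1 ∧ ind (· = b) (s e) ≠ ind (· = b) (t e))) = {e0} := by
          ext e
          simp only [mem_filter, mem_univ, true_and, mem_singleton]
          constructor
          · rintro ⟨h1, h2⟩
            exact hu0 e (ind_ne_iff_inc.1 h2) h1
          · rintro rfl
            exact ⟨hw0, ind_ne_iff_inc.2 hi0⟩
        rw [this]; simp)
      have e1 : (univ.filter (fun e => ind (· = b) (s e) ≠ ind (· = b) (t e)))
          = univ.filter (fun e => inc s t b e) := by
        ext e
        simp only [mem_filter, mem_univ, true_and]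
        exact ind_ne_iff_inc
      rw [e1] at h3
      have e2 : (univ.filter (fun e => s e ≠ t e)) =
          (univ.filter (fun e => inc s t b e)) ∪ (univ.filter (fun e => f (s e) ≠ f (t e))) := by
        ext e
        simp only [mem_filter, mem_univ, true_and, mem_union, hnl]
        have := incne e
        tauto
      have e3 : Disjoint (univ.filter (fun e => inc s t b e))
          (univ.filter (fun e => f (s e) ≠ f (t e))) := by
        rw [Finset.disjoint_left]
        intro e
        simp only [mem_filter, mem_univ, true_and, hnl]
        tauto
      have e4 : (univ.filter (fun e => w e = -1)) =
          insert e0 (univ.filter (fun e => w' e = -1)) := by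
        ext e
        simp only [mem_filter, mem_univ, true_and, mem_insert, hwneg]
        constructor
        · intro h
          by_cases hi : inc s t b e
          · exact Or.inl (hu0 e hi h)
          · exact Or.inr ⟨h, hi⟩
        · rintro (rfl | h)
          · exact hw0
          · exact h.1
      rw [e2, card_union_of_disjoint e3, e4]
      have := card_insert_le e0 (univ.filter (fun e => w' e = -1))
      omega
    · intro e he
      obtain ⟨h1, h2⟩ := (hnl e).1 he
      simp only [hw', h2, if_false]
      exact hw e h1
    · intro e he
      by_cases hi : inc s t b e
      · simp [hw', hi]
      · simp only [hw', hi, if_false]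
        apply hl
        by_contra h
        exact (hnl e).2 ⟨h, hi⟩ he
    · intro e he
      obtain ⟨h1, h2⟩ := (hnl e).1 he
      have hs : s e ≠ b := fun h => h2 (Or.inl ⟨h, fun h' => h1 (h.trans h'.symm)⟩)
      have ht : t e ≠ b := fun h => h2 (Or.inr ⟨fun h' => h1 (h'.trans h.symm), h⟩)
      simp only [hc'f _ hs, hc'f _ ht]
      exact hc e h1
    · intro C hC
      have h1 := hcy (C.filter (fun e => ¬ inc s t b e)) (fun e he => (mem_filter.1 he).2) (by
        intro S hS
        have h2 := hC S
        have hSf : ∀ v, S (f v) = S v := by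
          intro v
          by_cases h : nb s t b v
          · rw [hfnb v h, hS v h]
          · rw [hfn v h]
        unfold bd at h2 ⊢
        simp only [hSf] at h2
        rw [← h2, sum_filter]
        apply sum_congr rfl
        intro e _
        by_cases hi : inc s t b e
        · obtain ⟨h3, h4⟩ := hinc_nb e hi
          rw [← hSf (s e), ← hSf (t e), h3, h4, z2]; simp
        · simp [hi])
      rw [sum_filter] at h1
      simpa [hw'] using h1
    · intro S hS
      have h1 := hcut (fun v => S (f v)) (by
        convert hS using 2
        ext e
        simp only [mem_filter, mem_univ, true_and]
        rw [hwneg]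
        have := hinc_nb e
        constructor
        · rintro ⟨h1, h2⟩
          exact ⟨⟨h1, fun h => h2 (by rw [(this h).1, (this h).2])⟩, h2⟩
        · rintro ⟨h1, h2⟩
          exact ⟨h1.1, h2⟩)
      exact h1
    · have : (univ.filter (fun e => f (s e) ≠ f (t e))) ⊂ (univ.filter (fun e => s e ≠ t e)) := by
        rw [Finset.ssubset_iff_of_subset]
        · exact ⟨e0, by simpa using incne e0 hi0, by simp [hnl, hi0]⟩
        · intro e
          simp only [mem_filter, mem_univ, true_and, hnl]
          exact fun h => h.1
      have := card_lt_card this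
      omega

lemma telescope (g : ℕ → ZMod 2) (L : ℕ) : ∑ i ∈ range L, (g i + g (i + 1)) = g 0 + g L := by
  induction L with
  | zero => simp [z2]
  | succ L ih => rw [sum_range_succ, ih]; linear_combination z2 (g L)

/-- nodes of the subdivision -/
def node (s t : E → V) (k : E → ℕ) (e : E) (i : ℕ) : V ⊕ (Σ e : E, Fin (2 * k e)) :=
  if i = 0 then Sum.inl (s e) else
    if h : i < 2 * k e then Sum.inr ⟨e, ⟨i, h⟩⟩ else Sum.inl (t e)

def s' (s t : E → V) (k : E → ℕ) (x : Σ e : E, Fin (2 * k e)) := node s t k x.1 x.2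
def t' (s t : E → V) (k : E → ℕ) (x : Σ e : E, Fin (2 * k e)) := node s t k x.1 (x.2 + 1)

def col (k : E → ℕ) : V ⊕ (Σ e : E, Fin (2 * k e)) → ZMod 2 :=
  Sum.elim (fun _ => 0) (fun x => ((x.2 : ℕ) : ZMod 2))

lemma col_node (s t : E → V) (k : E → ℕ) (e : E) (i : ℕ) (hi : i ≤ 2 * k e) :
    col k (node s t k e i) = i := by
  unfold node col
  split_ifs with h1 h2
  · simp [h1]
  · simp
  · have : i = 2 * k e := by omega
    rw [this]
    have h2 : (2 : ZMod 2) = 0 := rfl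
    push_cast
    simp [h2]

lemma node_zero (s t : E → V) (k : E → ℕ) (e : E) : node s t k e 0 = Sum.inl (s e) := by
  simp [node]

lemma node_last (s t : E → V) (k : E → ℕ) (hk : ∀ e, 1 ≤ k e) (e : E) :
    node s t k e (2 * k e) = Sum.inl (t e) := by
  have := hk e
  unfold node
  rw [if_neg (by omega), dif_neg (by omega)]

lemma node_inr (s t : E → V) (k : E → ℕ) (e e' : E) (i j : ℕ) (h : i + 1 < 2 * k e) :
    node s t k e' j = Sum.inr ⟨e, ⟨i + 1, h⟩⟩ ↔ e' = e ∧ j = i + 1 := by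
  unfold node
  split_ifs with h1 h2
  · simp; omega
  · constructor
    · intro hh
      have h3 := Sum.inr.inj hh
      have h4 : e' = e := congrArg Sigma.fst h3
      subst h4
      simpa using h3
    · rintro ⟨rfl, rfl⟩; rfl
  · simp only [reduceCtorEq, false_iff]
    rintro ⟨rfl, rfl⟩
    omega

lemma col_ne (s t : E → V) (k : E → ℕ) (x : Σ e : E, Fin (2 * k e)) :
    col k (s' s t k x) ≠ col k (t' s t k x) := by
  unfold s' t'
  have := x.2.2
  rw [col_node s t k _ _ (by omega), col_node s t k _ _ (by omega), ← z2ne]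
  push_cast
  linear_combination z2 ((x.2 : ℕ) : ZMod 2)

lemma bd_sigma (s t : E → V) (k : E → ℕ) (hk : ∀ e, 1 ≤ k e) (C : Finset E)
    (S : V ⊕ (Σ e : E, Fin (2 * k e)) → ZMod 2) :
    bd (s' s t k) (t' s t k) (C.sigma (fun _ => univ)) S = bd s t C (fun v => S (Sum.inl v)) := by
  unfold bd
  rw [sum_sigma]
  apply sum_congr rfl
  intro e _
  unfold s' t'
  have := Fin.sum_univ_eq_sum_range
    (fun i => S (node s t k e i) + S (node s t k e (i + 1))) (2 * k e)
  dsimp only at this ⊢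
  rw [this, telescope (fun i => S (node s t k e i)), node_zero, node_last s t k hk]

lemma cycle_unif (s t : E → V) (k : E → ℕ) (C : Finset (Σ e : E, Fin (2 * k e)))
    (hC : ∀ S, bd (s' s t k) (t' s t k) C S = 0) (e : E) (i : ℕ) (h : i + 1 < 2 * k e) :
    (⟨e, ⟨i, by omega⟩⟩ : Σ e : E, Fin (2 * k e)) ∈ C ↔
      (⟨e, ⟨i + 1, h⟩⟩ : Σ e : E, Fin (2 * k e)) ∈ C := by
  classical
  have h1 := hC (ind (· = Sum.inr ⟨e, ⟨i + 1, h⟩⟩))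
  unfold bd at h1
  have h2 : ∀ x ∈ C, (ind (· = Sum.inr ⟨e, ⟨i + 1, h⟩⟩) (s' s t k x) +
      ind (· = Sum.inr ⟨e, ⟨i + 1, h⟩⟩) (t' s t k x) : ZMod 2) =
      (if x = ⟨e, ⟨i + 1, h⟩⟩ then 1 else 0) + (if x = ⟨e, ⟨i, by omega⟩⟩ then 1 else 0) := by
    rintro ⟨e', j, hj⟩ _
    unfold ind s' t'
    simp only [node_inr]
    congr 1
    · congr 1
      rw [eq_iff_iff]
      constructor
      · rintro ⟨rfl, h9⟩; simpa using h9
      · intro h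
        have : e' = e := congrArg Sigma.fst h
        subst this
        simpa using h
    · congr 1
      rw [eq_iff_iff]
      constructor
      · rintro ⟨rfl, h9⟩; simpa using h9
      · intro h
        have : e' = e := congrArg Sigma.fst h
        subst this
        simpa using h
  rw [sum_congr rfl h2, sum_add_distrib, sum_ite_eq', sum_ite_eq'] at h1
  by_cases ha : (⟨e, ⟨i, by omega⟩⟩ : Σ e : E, Fin (2 * k e)) ∈ C <;>
  by_cases hb : (⟨e, ⟨i + 1, h⟩⟩ : Σ e : E, Fin (2 * k e)) ∈ C <;> simp_all

lemma symm_weight (k : E → ℕ) (J C : Finset E) :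
    ((∑ e ∈ symmDiff J C, k e : ℕ) : ℤ) =
      ∑ e ∈ J, (k e : ℤ) + ∑ e ∈ C, (if e ∈ J then -(k e : ℤ) else k e) := by
  have h1 : symmDiff J C = (J \ C) ∪ (C \ J) := rfl
  have h2 : Disjoint (J \ C) (C \ J) := by
    rw [Finset.disjoint_left]; intro x; simp; tauto
  rw [h1, sum_union h2]
  push_cast
  have h3 := sum_inter_add_sum_sdiff J C (fun e => (k e : ℤ))
  have h4 := sum_inter_add_sum_sdiff C J (fun e => (if e ∈ J then -(k e : ℤ) else k e))
  have h5 : ∑ e ∈ C ∩ J, (if e ∈ J then -(k e : ℤ) else k e) = - ∑ e ∈ J ∩ C, (k e : ℤ) := by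
    rw [inter_comm, ← sum_neg_distrib]
    apply sum_congr rfl
    intro e he
    rw [if_pos (mem_inter.1 he).1]
  have h6 : ∑ e ∈ C \ J, (if e ∈ J then -(k e : ℤ) else k e) = ∑ e ∈ C \ J, (k e : ℤ) := by
    apply sum_congr rfl
    intro e he
    rw [if_neg (mem_sdiff.1 he).2]
  rw [← h3, ← h4, h5, h6]
  ring

open Classical in
theorem wjoin [Fintype V] [Fintype E] (s t : E → V) (k : E → ℕ) (hk : ∀ e, 1 ≤ k e)
    (τ : (V → ZMod 2) → ZMod 2) (J : Finset E) (hJ : ∀ S, bd s t J S = τ S)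
    (hmin : ∀ J', (∀ S, bd s t J' S = τ S) → ∑ e ∈ J, k e ≤ ∑ e ∈ J', k e)
    (hcut : ∀ S, τ S = 1 → 3 ≤ (univ.filter (fun e => S (s e) ≠ S (t e))).card) :
    3 * ∑ e ∈ J, k e ≤ ∑ e, k e := by
  set w : (Σ e : E, Fin (2 * k e)) → ℤ := fun x => if x.1 ∈ J then -1 else 1 with hwdef
  have hne : ∀ x, s' s t k x ≠ t' s t k x := fun x h => col_ne s t k x (by rw [h])
  have hneg : (univ.filter (fun x => w x = -1)) = J.sigma (fun e => (univ : Finset (Fin (2 * k e)))) := by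
    ext x
    by_cases h : x.1 ∈ J <;> simp [hwdef, h]
  have key := tjoin (Fintype.card (Σ e : E, Fin (2 * k e))) (s' s t k) (t' s t k) w
    (col k) ?_ ?_ ?_ ?_ ?_ (card_le_univ _)
  · have key := key.trans (card_le_univ _)
    rw [hneg, card_sigma, Fintype.card_sigma] at key
    simp only [card_univ, Fintype.card_fin, ← mul_sum] at key
    omega
  · intro x _
    by_cases h : x.1 ∈ J <;> simp [hwdef, h]
  · intro x h
    exact absurd h (hne x)
  · intro x _
    exact col_ne s t k x
  · intro C hC
    set C0 : Finset E := univ.filter (fun e => (⟨e, ⟨0, by have := hk e; omega⟩⟩ : Σ e : E, Fin (2 * k e)) ∈ C) with hC0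
    have hall : ∀ e i (h : i < 2 * k e), (⟨e, ⟨i, h⟩⟩ : Σ e : E, Fin (2 * k e)) ∈ C ↔ e ∈ C0 := by
      intro e i
      induction i with
      | zero => intro h; simp [hC0]
      | succ i ih =>
        intro h
        rw [← cycle_unif s t k C hC e i h]
        exact ih _
    have hCeq : C = C0.sigma (fun e => (univ : Finset (Fin (2 * k e)))) := by
      ext ⟨e, i, hi⟩
      rw [hall e i hi]; simp
    have hC0c : ∀ S, bd s t C0 S = 0 := by
      intro S
      have := hC (Sum.elim S (fun _ => 0))
      rw [hCeq, bd_sigma s t k hk] at this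
      simpa using this
    have h1 := hmin (symmDiff J C0) (fun S => by rw [bd_symm, hC0c, add_zero, hJ])
    have h2 := symm_weight k J C0
    have h3 : ∑ x ∈ C, w x = 2 * ∑ e ∈ C0, (if e ∈ J then -(k e : ℤ) else k e) := by
      rw [hCeq, sum_sigma, mul_sum]
      apply sum_congr rfl
      intro e _
      by_cases h : e ∈ J <;> simp [hwdef, h]
    have h4 : ((∑ e ∈ J, k e : ℕ) : ℤ) ≤ ((∑ e ∈ symmDiff J C0, k e : ℕ) : ℤ) := by exact_mod_cast h1
    rw [h2] at h4
    push_cast at h4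
    omega
  · intro S hS
    have h1 : bd (s' s t k) (t' s t k) (J.sigma (fun e => (univ : Finset (Fin (2 * k e))))) S = 1 := by
      rw [← hneg]
      have h2 : (((univ.filter (fun x => w x = -1 ∧ S (s' s t k x) ≠ S (t' s t k x))).card : ℕ) : ZMod 2) = 1 :=
        (ZMod.natCast_eq_one_iff_odd).2 hS
      rw [← h2, ← filter_filter, card_filter]
      unfold bd
      push_cast
      apply sum_congr rfl
      intro x _
      split_ifs with h
      · exact (z2ne _ _).2 h
      · push Not at h; rw [h, z2]
    rw [bd_sigma s t k hk, hJ] at h1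
    refine (hcut _ h1).trans ?_
    apply card_le_card_of_surjOn Sigma.fst
    intro e he
    simp only [coe_filter, mem_univ, true_and, Set.mem_ofPred_eq] at he
    simp only [coe_filter, mem_univ, true_and, Set.mem_image, Set.mem_ofPred_eq]
    by_contra hcon
    push Not at hcon
    have h3 := bd_sigma s t k hk {e} S
    have h4 : bd s t {e} (fun v => S (Sum.inl v)) = 1 := by
      simp only [bd, sum_singleton]; exact (z2ne _ _).2 he
    rw [h4] at h3
    have h5 : bd (s' s t k) (t' s t k) (({e} : Finset E).sigma (fun e => (univ : Finset (Fin (2 * k e))))) S = 0 := by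
      apply sum_eq_zero
      intro x hx
      have hx1 : x.1 = e := by simpa using hx
      have : S (s' s t k x) = S (t' s t k x) := by
        by_contra hh
        exact hcon x hh hx1
      rw [this, z2]
    rw [h5] at h3
    exact zero_ne_one h3

lemma trail_aux (G : SimpleGraph V) (s t : E → V) (hadj : ∀ e, G.Adj (s e) (t e)) (N : ℕ) :
    ∀ (X : Finset E) (v u : V), X.card ≤ N → Jn s t X v u →
      ∃ Y ⊆ X, Jn s t Y v u ∧ ∃ p : G.Walk v u, p.length = Y.card ∧
        ∀ e ∈ Y, s e ∈ p.support ∧ t e ∈ p.support := by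
  classical
  induction N with
  | zero =>
    intro X v u hX hJ
    have hX0 : X = ∅ := by simpa using hX
    subst hX0
    have : v = u := by
      by_contra h
      have := hJ (ind (· = u))
      simp [bd, ind, h] at this
    subst this
    exact ⟨∅, by simp, fun S => by simp [bd, z2], SimpleGraph.Walk.nil, by simp, by simp⟩
  | succ N ih =>
    intro X v u hX hJ
    by_cases hvu : v = u
    · subst hvu
      exact ⟨∅, by simp, fun S => by simp [bd, z2], SimpleGraph.Walk.nil, by simp, by simp⟩
    have h1 : ∃ e ∈ X, inc s t v e := by
      by_contra hcon
      push Not at hcon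
      have h2 := hJ (ind (· = v))
      rw [bd_single_of_no_inc hcon] at h2
      simp [ind, Ne.symm hvu] at h2
    obtain ⟨e, he, hi⟩ := h1
    have h2 : ∃ x, G.Adj v x ∧ ((s e = v ∧ t e = x) ∨ (s e = x ∧ t e = v)) := by
      rcases hi with ⟨h, _⟩ | ⟨_, h⟩
      · exact ⟨t e, h ▸ hadj e, Or.inl ⟨h, rfl⟩⟩
      · exact ⟨s e, h ▸ (hadj e).symm, Or.inr ⟨rfl, h⟩⟩
    obtain ⟨x, hvx, hx⟩ := h2
    obtain ⟨Y, hY, hYJ, p, hp, hs⟩ := ih (X.erase e) x u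
      (by rw [card_erase_of_mem he]; omega) (fun S => by
        rw [bd_erase s t he, hJ S]
        rcases hx with ⟨h1, h2⟩ | ⟨h1, h2⟩ <;> rw [h1, h2] <;> linear_combination z2 (S v))
    have heY : e ∉ Y := fun h => absurd (hY h) (by simp)
    refine ⟨insert e Y, ?_, ?_, SimpleGraph.Walk.cons hvx p, ?_, ?_⟩
    · intro z hz
      rcases mem_insert.1 hz with rfl | hz
      · exact he
      · exact mem_of_mem_erase (hY hz)
    · intro S
      rw [bd_insert s t heY, hYJ S]
      rcases hx with ⟨h1, h2⟩ | ⟨h1, h2⟩ <;> rw [h1, h2] <;> linear_combination z2 (S x)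
    · rw [card_insert_of_notMem heY, SimpleGraph.Walk.length_cons, hp]
    · intro z hz
      rw [SimpleGraph.Walk.support_cons]
      rcases mem_insert.1 hz with rfl | hz
      · rcases hx with ⟨h1, h2⟩ | ⟨h1, h2⟩ <;> rw [h1, h2] <;> simp
      · have := hs z hz
        exact ⟨List.mem_cons_of_mem _ this.1, List.mem_cons_of_mem _ this.2⟩

theorem euler (G : SimpleGraph V) (s t : E → V) (hadj : ∀ e, G.Adj (s e) (t e)) (A : Finset E)
    (hev : ∀ S, bd s t A S = 0) (r : V)
    (hcon : ∀ K : V → Prop, K r → (∀ e ∈ A, K (s e) ↔ K (t e)) → ∀ v, K v) :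
    ∃ p : G.Walk r r, (∀ x, x ∈ p.support) ∧ p.length ≤ A.card := by
  classical
  obtain ⟨B, hB, hmax⟩ := Finset.exists_max_image
    (A.powerset.filter (fun B => (∀ S, bd s t B S = 0) ∧ ∃ p : G.Walk r r, p.length = B.card ∧
        ∀ e ∈ B, s e ∈ p.support ∧ t e ∈ p.support)) Finset.card
    ⟨∅, by
      simp only [mem_filter, mem_powerset, empty_subset, true_and]
      exact ⟨by simp [bd], SimpleGraph.Walk.nil, by simp, by simp⟩⟩
  simp only [mem_filter, mem_powerset] at hB hmax
  obtain ⟨hBA, hBev, p, hp, hsup⟩ := hB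
  have key : ∀ e ∈ A, e ∉ B → ∀ u x, u ∈ p.support → G.Adj u x →
      ((s e = u ∧ t e = x) ∨ (s e = x ∧ t e = u)) → False := by
    intro e heA heB u x hu hux hx
    have heD : e ∈ A \ B := mem_sdiff.2 ⟨heA, heB⟩
    obtain ⟨Y, hY, hYJ, q, hq, hqs⟩ := trail_aux G s t hadj _ ((A \ B).erase e) x u le_rfl (fun S => by
      rw [bd_erase s t heD, bd_sdiff s t hBA, hev, hBev]
      rcases hx with ⟨h1, h2⟩ | ⟨h1, h2⟩ <;> rw [h1, h2] <;> ring)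
    have heY : e ∉ Y := fun h => absurd (hY h) (by simp)
    have hYD : Y ⊆ A \ B := hY.trans (erase_subset _ _)
    obtain ⟨p1, p2, hp12⟩ := SimpleGraph.Walk.mem_support_iff_exists_append.1 hu
    have heBY : e ∉ B ∪ Y := by simp [heB, heY]
    have hdis : Disjoint B Y := by
      rw [Finset.disjoint_right]; intro z hz; exact (mem_sdiff.1 (hYD hz)).2
    have hmem : ∀ z, z ∈ (p1.append ((SimpleGraph.Walk.cons hux q).append p2)).support ↔
        z ∈ p.support ∨ z ∈ q.support := by
      intro z
      rw [hp12]
      simp only [SimpleGraph.Walk.mem_support_append_iff, SimpleGraph.Walk.support_cons,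
        List.mem_cons]
      constructor
      · rintro (h | (h | h) | h)
        · exact Or.inl (Or.inl h)
        · rw [h]; exact Or.inl (Or.inl (SimpleGraph.Walk.end_mem_support p1))
        · exact Or.inr h
        · exact Or.inl (Or.inr h)
      · tauto
    have := hmax (insert e (B ∪ Y)) ⟨?_, ?_, p1.append ((SimpleGraph.Walk.cons hux q).append p2), ?_, ?_⟩
    · rw [card_insert_of_notMem heBY, card_union_of_disjoint hdis] at this
      omega
    · intro z hz
      rcases mem_insert.1 hz with rfl | hz
      · exact heA
      · rcases mem_union.1 hz with hz | hz
        · exact hBA hz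
        · exact (mem_sdiff.1 (hYD hz)).1
    · intro S
      rw [bd_insert s t heBY, bd_disj s t hdis, hBev, hYJ S]
      rcases hx with ⟨h1, h2⟩ | ⟨h1, h2⟩ <;> rw [h1, h2] <;>
        linear_combination z2 (S x) + z2 (S u)
    · have h3 := congrArg SimpleGraph.Walk.length hp12
      rw [SimpleGraph.Walk.length_append] at h3
      rw [card_insert_of_notMem heBY, card_union_of_disjoint hdis]
      simp only [SimpleGraph.Walk.length_append, SimpleGraph.Walk.length_cons]
      omega
    · intro z hz
      rw [hmem, hmem]
      rcases mem_insert.1 hz with rfl | hz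
      · have hxq : x ∈ q.support := SimpleGraph.Walk.start_mem_support q
        rcases hx with ⟨h1, h2⟩ | ⟨h1, h2⟩ <;> rw [h1, h2]
        · exact ⟨Or.inl hu, Or.inr hxq⟩
        · exact ⟨Or.inr hxq, Or.inl hu⟩
      · rcases mem_union.1 hz with hz | hz
        · exact ⟨Or.inl (hsup z hz).1, Or.inl (hsup z hz).2⟩
        · exact ⟨Or.inr (hqs z hz).1, Or.inr (hqs z hz).2⟩
  refine ⟨p, ?_, hp ▸ card_le_card hBA⟩
  apply hcon
  · exact SimpleGraph.Walk.start_mem_support p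
  · intro e he
    by_cases heB : e ∈ B
    · have := hsup e heB
      tauto
    · constructor
      · intro h
        exact (key e he heB _ _ h (hadj e) (Or.inl ⟨rfl, rfl⟩)).elim
      · intro h
        exact (key e he heB _ _ h (hadj e).symm (Or.inr ⟨rfl, rfl⟩)).elim

/-- rooted spanning tree given by parent function and depth -/
structure RT (G : SimpleGraph V) (r : V) (p : V → V) (d : V → ℕ) : Prop where
  pr : p r = r
  dr : d r = 0
  adj : ∀ v, v ≠ r → G.Adj v (p v)
  dp : ∀ v, v ≠ r → d v = d (p v) + 1

lemma RT.exists (G : SimpleGraph V) (hG : G.Connected) (r : V) : ∃ p d, RT G r p d := by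
  classical
  have h : ∀ v, v ≠ r → ∃ x, G.Adj v x ∧ G.dist v r = G.dist x r + 1 := by
    intro v hv
    obtain ⟨q, hq⟩ := hG.exists_walk_length_eq_dist v r
    cases q with
    | nil => exact absurd rfl hv
    | cons hvx q' =>
      rename_i x
      refine ⟨x, hvx, ?_⟩
      rw [SimpleGraph.Walk.length_cons] at hq
      have h1 := SimpleGraph.dist_le q'
      have h2 := hG.dist_triangle (u := v) (v := x) (w := r)
      rw [SimpleGraph.dist_eq_one_iff_adj.2 hvx] at h2
      omega
  choose! f hf using h
  refine ⟨fun v => if v = r then r else f v, fun v => G.dist v r, ?_, ?_, ?_, ?_⟩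
  · simp
  · simp
  · intro v hv; simp [hv, (hf v hv).1]
  · intro v hv; simp [hv, (hf v hv).2]

lemma RT.exists_depth {G : SimpleGraph V} {r : V} {p : V → V} {d : V → ℕ} (h : RT G r p d)
    (m : ℕ) : ∀ v, d v = m → ∀ i ≤ m, ∃ u, d u = i := by
  induction m with
  | zero => intro v hv i hi; exact ⟨v, by omega⟩
  | succ m ih =>
    intro v hv i hi
    by_cases hi' : i = m + 1
    · exact ⟨v, by omega⟩
    · have hvr : v ≠ r := by rintro rfl; have := h.dr; omega
      have := h.dp v hvr
      exact ih (p v) (by omega) i (by omega)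

lemma RT.bound [Fintype V] {G : SimpleGraph V} {r : V} {p : V → V} {d : V → ℕ} (h : RT G r p d)
    (v : V) : d v ≤ Fintype.card V := by
  classical
  have h1 : range (d v + 1) ⊆ univ.image d := by
    intro i hi
    simp only [mem_range] at hi
    obtain ⟨u, hu⟩ := h.exists_depth (d v) v rfl i (by omega)
    exact mem_image.2 ⟨u, mem_univ _, hu⟩
  have h2 := card_le_card h1
  have h3 := card_image_le (s := (univ : Finset V)) (f := d)
  rw [card_range] at h2
  rw [card_univ] at h3
  omega

lemma RT.iter_root {G : SimpleGraph V} {r : V} {p : V → V} {d : V → ℕ} (h : RT G r p d) (k : ℕ) :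
    p^[k] r = r := Function.iterate_fixed h.pr k

lemma RT.to_root {G : SimpleGraph V} {r : V} {p : V → V} {d : V → ℕ} (h : RT G r p d) (m : ℕ) :
    ∀ v, d v = m → ∃ k, p^[k] v = r := by
  induction m with
  | zero =>
    intro v hv
    by_cases hvr : v = r
    · exact ⟨0, hvr⟩
    · have := h.dp v hvr; omega
  | succ m ih =>
    intro v hv
    have hvr : v ≠ r := by rintro rfl; have := h.dr; omega
    have := h.dp v hvr
    obtain ⟨k, hk⟩ := ih (p v) (by omega)
    exact ⟨k + 1, by rwa [Function.iterate_succ_apply]⟩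

theorem exists_dfs [Fintype V] (G : SimpleGraph V) (hG : G.Connected) (r : V) :
    ∃ p d, RT G r p d ∧ ∀ x y, G.Adj x y → d y ≤ d x → ∃ k, p^[k] x = y := by
  classical
  let P : ℕ → Prop := fun m => ∃ p d, RT G r p d ∧ ∑ v, d v = m
  have hb : ∀ m, P m → m ≤ Fintype.card V * Fintype.card V := by
    rintro m ⟨p, d, h, rfl⟩
    calc ∑ v, d v ≤ ∑ _v : V, Fintype.card V := sum_le_sum (fun v _ => h.bound v)
      _ = _ := by simp
  obtain ⟨p0, d0, h0⟩ := RT.exists G hG r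
  have hP0 : P (∑ v, d0 v) := ⟨p0, d0, h0, rfl⟩
  have hg := Nat.findGreatest_spec (P := P) (hb _ hP0) hP0
  obtain ⟨p, d, h, hsum⟩ := hg
  refine ⟨p, d, h, ?_⟩
  intro x y hxy hd
  by_contra hanc
  have hyr : y ≠ r := by
    rintro rfl
    exact hanc (h.to_root _ x rfl)
  let D : V → Prop := fun u => ∃ k, p^[k] u = y
  have hDstep : ∀ u, u ≠ y → (D u ↔ D (p u)) := by
    intro u hu
    constructor
    · rintro ⟨k, hk⟩
      cases k with
      | zero => exact absurd hk hu
      | succ k => exact ⟨k, by rwa [Function.iterate_succ_apply] at hk⟩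
    · rintro ⟨k, hk⟩
      exact ⟨k + 1, by rwa [Function.iterate_succ_apply]⟩
  have hDr : ¬ D r := by
    rintro ⟨k, hk⟩
    rw [h.iter_root] at hk
    exact hyr hk.symm
  have hDy : D y := ⟨0, rfl⟩
  have hDx : ¬ D x := hanc
  let p' : V → V := fun u => if u = y then x else p u
  let d' : V → ℕ := fun u => if D u then d u + (d x + 1 - d y) else d u
  have h' : RT G r p' d' := by
    refine ⟨?_, ?_, ?_, ?_⟩
    · simp only [p', if_neg (Ne.symm hyr), h.pr]
    · simp only [d', if_neg hDr, h.dr]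
    · intro v hv
      by_cases hvy : v = y
      · subst hvy; simp only [p', if_true]; exact hxy.symm
      · simp only [p', if_neg hvy]; exact h.adj v hv
    · intro v hv
      by_cases hvy : v = y
      · subst hvy
        simp only [p', if_true, d', if_pos hDy, if_neg hDx]
        omega
      · simp only [p', if_neg hvy, d']
        have h1 := h.dp v hv
        by_cases hDv : D v
        · rw [if_pos hDv, if_pos ((hDstep v hvy).1 hDv)]; omega
        · rw [if_neg hDv, if_neg (fun hh => hDv ((hDstep v hvy).2 hh))]; omega
  have hlt : ∑ v, d v < ∑ v, d' v := by
    apply sum_lt_sum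
    · intro v _
      simp only [d']; split_ifs <;> omega
    · exact ⟨y, mem_univ _, by simp only [d', if_pos hDy]; omega⟩
  have hP' : P (∑ v, d' v) := ⟨p', d', h', rfl⟩
  have := Nat.le_findGreatest (hb _ hP') hP'
  omega

def att (s t : E → V) (v : V) (e : E) : Prop := s e = v ∨ t e = v

open Classical in
lemma bd_ind (s t : E → V) (hne : ∀ e, s e ≠ t e) (F : Finset E) (v : V) :
    bd s t F (ind (· = v)) = ((F.filter (att s t v)).card : ZMod 2) := by
  rw [card_filter]
  push_cast
  apply sum_congr rfl
  intro e _
  have := hne e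
  unfold ind att
  by_cases h1 : s e = v <;> by_cases h2 : t e = v
  · exact absurd (h1.trans h2.symm) this
  all_goals simp [h1, h2]

open Classical in
lemma deg_sum [Fintype V] (s t : E → V) (hne : ∀ e, s e ≠ t e) (F : Finset E) :
    ∑ v, (F.filter (att s t v)).card = 2 * F.card := by
  simp_rw [card_filter]
  rw [sum_comm]
  have : ∀ e ∈ F, ∑ v, (if att s t v e then 1 else 0) = 2 := by
    intro e _
    rw [← card_filter]
    have h1 : (univ.filter (fun v => att s t v e)) = {s e, t e} := by
      ext v; simp [att, eq_comm]
    rw [h1, card_pair (hne e)]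
  rw [sum_congr rfl this]
  simp [mul_comm]

lemma wt_sum (K : ℤ) (R F : Finset E) :
    ∑ e ∈ F, (if e ∈ R then K - 1 else K + 1) = K * F.card + (F \ R).card - (F ∩ R).card := by
  have h1 := sum_inter_add_sum_sdiff F R (fun e => (if e ∈ R then K - 1 else K + 1))
  rw [← h1, sum_congr rfl (fun e he => if_pos (mem_inter.1 he).2),
    sum_congr rfl (fun e he => if_neg (mem_sdiff.1 he).2)]
  have h2 := card_inter_add_card_sdiff F R
  simp only [sum_const, nsmul_eq_mul]
  rw [← h2]
  push_cast
  ring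

open Classical in
theorem pm [Fintype V] [Fintype E] (s t : E → V) (hne : ∀ e, s e ≠ t e)
    (hdeg : ∀ v, (univ.filter (att s t v)).card = 3)
    (hcut : ∀ S : V → ZMod 2, ∑ v, S v = 1 →
      3 ≤ (univ.filter (fun e => S (s e) ≠ S (t e))).card) (R : Finset E) :
    ∃ M : Finset E, (∀ S, bd s t M S = ∑ v, S v) ∧ (∀ v, (M.filter (att s t v)).card = 1) ∧
      3 * ((M \ R).card : ℤ) - 3 * (M ∩ R).card ≤ (univ \ R).card - R.card := by
  set k : E → ℕ := fun e => if e ∈ R then 2 * Fintype.card E + 1 else 2 * Fintype.card E + 3 with hk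
  have hkz : ∀ F : Finset E, ((∑ e ∈ F, k e : ℕ) : ℤ) =
      (2 * Fintype.card E + 2) * F.card + (F \ R).card - (F ∩ R).card := by
    intro F
    rw [← wt_sum]
    push_cast
    apply sum_congr rfl
    intro e _
    simp only [hk]
    split_ifs <;> push_cast <;> ring
  have huniv : ∀ S, bd s t univ S = ∑ v, S v := by
    intro S
    rw [bd_decomp]
    apply sum_congr rfl
    intro v _
    rw [bd_ind s t hne, hdeg]
    have : ((3 : ℕ) : ZMod 2) = 1 := rfl
    rw [this, mul_one]
  obtain ⟨J, hJ, hmin⟩ := Finset.exists_min_image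
    (univ.filter (fun F : Finset E => ∀ S, bd s t F S = ∑ v, S v)) (fun F => ∑ e ∈ F, k e)
    ⟨univ, by simpa using huniv⟩
  simp only [mem_filter, mem_univ, true_and] at hJ hmin
  have key := wjoin s t k (fun e => by simp only [hk]; split_ifs <;> omega) (fun S => ∑ v, S v) J hJ
    hmin hcut
  have hodd : ∀ v, Odd (J.filter (att s t v)).card := by
    intro v
    rw [← ZMod.natCast_eq_one_iff_odd, ← bd_ind s t hne, hJ]
    simp [ind]
  have hE := deg_sum s t hne univ
  simp only [hdeg, sum_const, card_univ, smul_eq_mul] at hE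
  have hJs := deg_sum s t hne J
  have keyz : 3 * ((∑ e ∈ J, k e : ℕ) : ℤ) ≤ ((∑ e, k e : ℕ) : ℤ) := by exact_mod_cast key
  rw [hkz, hkz, card_univ, univ_inter] at keyz
  have hJ1 := card_inter_add_card_sdiff J R
  have hE1 := card_sdiff_add_card_eq_card (subset_univ R)
  rw [card_univ] at hE1
  have hone : ∀ v, (J.filter (att s t v)).card = 1 := by
    by_contra hcon
    push Not at hcon
    obtain ⟨v0, hv0⟩ := hcon
    have h3 : 3 ≤ (J.filter (att s t v0)).card := by
      obtain ⟨m, hm⟩ := hodd v0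
      omega
    have h4 : ∑ v : V, (if v = v0 then 3 else 1) ≤ ∑ v, (J.filter (att s t v)).card := by
      apply sum_le_sum
      intro v _
      split_ifs with h
      · rw [h]; exact h3
      · exact (hodd v).pos
    have h5 : ∑ v : V, (if v = v0 then 3 else 1) = Fintype.card V + 2 := by
      have : ∀ v : V, (if v = v0 then 3 else 1) = 1 + (if v = v0 then 2 else 0) := by
        intro v; split_ifs <;> rfl
      simp_rw [this, sum_add_distrib]
      simp
    have h6 : Fintype.card E + 3 ≤ 3 * J.card := by omega
    have h7 : J.card ≤ Fintype.card E := card_le_univ J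
    have h8 : ((Fintype.card E : ℤ) + 3) ≤ 3 * J.card := by exact_mod_cast h6
    have h9 : (2 * (Fintype.card E : ℤ) + 2) * ((Fintype.card E : ℤ) + 3) ≤
        (2 * (Fintype.card E : ℤ) + 2) * (3 * J.card) :=
      mul_le_mul_of_nonneg_left h8 (by positivity)
    have h10 : (2 * (Fintype.card E : ℤ) + 2) * ((Fintype.card E : ℤ) + 3) =
      (2 * (Fintype.card E : ℤ) + 2) * (Fintype.card E : ℤ) + 6 * Fintype.card E + 6 := by ring
    have h11 : (2 * (Fintype.card E : ℤ) + 2) * (3 * J.card) =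
      3 * ((2 * (Fintype.card E : ℤ) + 2) * J.card) := by ring
    rw [h10, h11] at h9
    generalize (2 * (Fintype.card E : ℤ) + 2) * J.card = a at *
    generalize (2 * (Fintype.card E : ℤ) + 2) * (Fintype.card E : ℤ) = b at *
    omega
  refine ⟨J, hJ, hone, ?_⟩
  simp only [hone, sum_const, card_univ, smul_eq_mul, mul_one] at hJs
  have h6 : (Fintype.card E : ℤ) = 3 * J.card := by omega
  have h7 : (2 * (Fintype.card E : ℤ) + 2) * (Fintype.card E : ℤ) =
      3 * ((2 * (Fintype.card E : ℤ) + 2) * J.card) := by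
    conv_lhs => rw [mul_comm, h6]
    rw [h6]; ring
  rw [h7] at keyz
  generalize (2 * (Fintype.card E : ℤ) + 2) * J.card = a at *
  omega

end

section
variable {V : Type*}

open Classical in
lemma deg_edges [Fintype V] (G : SimpleGraph V) (hcubic : ∀ v : V, (G.neighborSet v).ncard = 3)
    (s t : G.edgeSet → V) (hst : ∀ e, e.1 = s(s e, t e)) (v : V) :
    (univ.filter (att s t v)).card = 3 := by
  rw [← hcubic v, ← Nat.card_coe_set_eq, ← Nat.card_congr (G.incidenceSetEquivNeighborSet v),
    Nat.card_coe_set_eq, ← Set.ncard_coe_finset,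
    ← Set.ncard_image_of_injective _ (Subtype.val_injective : Function.Injective (Subtype.val : G.edgeSet → Sym2 V))]
  congr 1
  ext e
  simp only [coe_filter, mem_univ, true_and, Set.mem_image, SimpleGraph.incidenceSet, att]
  constructor
  · rintro ⟨e', he', rfl⟩
    refine ⟨e'.2, ?_⟩
    rw [hst e', Sym2.mem_iff]
    rcases he' with h | h
    · exact Or.inl h.symm
    · exact Or.inr h.symm
  · rintro ⟨h1, h2⟩
    refine ⟨⟨e, h1⟩, ?_, rfl⟩
    have := hst ⟨e, h1⟩
    simp only at this
    rw [this, Sym2.mem_iff] at h2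
    rcases h2 with h | h
    · exact Or.inl h.symm
    · exact Or.inr h.symm

open Classical in
lemma cut3 [Fintype V] (G : SimpleGraph V) (hcubic : ∀ v : V, (G.neighborSet v).ncard = 3)
    (hconn : ∀ s : Finset V, s.card < 3 → (G.induce (↑s : Set V)ᶜ).Connected)
    (s t : G.edgeSet → V) (hst : ∀ e, e.1 = s(s e, t e)) (hne : ∀ e, s e ≠ t e)
    (S : V → ZMod 2) (hS : ∑ v, S v = 1) :
    3 ≤ (univ.filter (fun e => S (s e) ≠ S (t e))).card := by
  have hdeg := deg_edges G hcubic s t hst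
  have huniv : bd s t univ S = 1 := by
    rw [bd_decomp, ← hS]
    apply sum_congr rfl
    intro v _
    rw [bd_ind s t hne, hdeg]
    have : ((3 : ℕ) : ZMod 2) = 1 := rfl
    rw [this, mul_one]
  have hodd : Odd (univ.filter (fun e => S (s e) ≠ S (t e))).card := by
    rw [← ZMod.natCast_eq_one_iff_odd, ← huniv, card_filter]
    unfold bd
    push_cast
    apply sum_congr rfl
    intro e _
    split_ifs with h
    · exact ((z2ne _ _).2 h).symm
    · push Not at h; rw [h, z2]
  by_contra hlt
  have hcard1 : (univ.filter (fun e => S (s e) ≠ S (t e))).card = 1 := by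
    obtain ⟨m, hm⟩ := hodd; omega
  obtain ⟨e0, he0⟩ := card_eq_one.1 hcard1
  have hmem0 : S (s e0) ≠ S (t e0) := by
    have : e0 ∈ univ.filter (fun e => S (s e) ≠ S (t e)) := by rw [he0]; simp
    simpa using this
  have huniq : ∀ u v, G.Adj u v → S u ≠ S v → s(u, v) = e0.1 := by
    intro u v huv hS'
    have : (⟨s(u, v), huv⟩ : G.edgeSet) ∈ univ.filter (fun e => S (s e) ≠ S (t e)) := by
      simp only [mem_filter, mem_univ, true_and]
      have := hst ⟨s(u, v), huv⟩
      simp only [Sym2.eq_iff] at this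
      rcases this with ⟨h1, h2⟩ | ⟨h1, h2⟩
      · rw [← h1, ← h2]; exact hS'
      · rw [← h1, ← h2]; exact hS'.symm
    rw [he0, mem_singleton] at this
    rw [← this]
  have hxy : ∃ x y, e0.1 = s(x, y) ∧ S x = 1 ∧ S y = 0 := by
    rcases z2cases (S (s e0)) with h1 | h1 <;> rcases z2cases (S (t e0)) with h2 | h2
    · rw [h1, h2] at hmem0; exact absurd rfl hmem0
    · exact ⟨t e0, s e0, by rw [hst e0, Sym2.eq_swap], h2, h1⟩
    · exact ⟨s e0, t e0, hst e0, h1, h2⟩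
    · rw [h1, h2] at hmem0; exact absurd rfl hmem0
  obtain ⟨x, y, he, hx, hy⟩ := hxy
  have hyx : y ≠ x := by rintro rfl; rw [hx] at hy; exact one_ne_zero hy
  by_cases hex : ∃ x', x' ≠ x ∧ S x' = 1
  · obtain ⟨x', hx', hSx'⟩ := hex
    have hc := hconn {x} (by simp)
    have hreach := hc.preconnected ⟨x', by simpa using hx'⟩ ⟨y, by simpa using hyx⟩
    obtain ⟨q⟩ := hreach
    have : ∀ (a b : ↥((↑({x} : Finset V) : Set V)ᶜ)) (q : (G.induce (↑({x} : Finset V) : Set V)ᶜ).Walk a b),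
        S a.1 = S b.1 := by
      intro a b q
      induction q with
      | nil => rfl
      | cons h q ih =>
        rename_i a b c
        rw [← ih]
        by_contra hab
        have h1 := huniq a.1 b.1 h hab
        rw [he] at h1
        have ha : a.1 ≠ x := by simpa using a.2
        have hb : b.1 ≠ x := by simpa using b.2
        rcases Sym2.eq_iff.1 h1 with h | h
        · exact ha h.1
        · exact hb h.2
    have := this _ _ q
    simp only [hSx', hy] at this
    exact one_ne_zero this
  · push Not at hex
    obtain ⟨y', hy', hne'⟩ := Set.exists_ne_of_one_lt_ncard (s := G.neighborSet x)
      (by rw [hcubic]; norm_num) y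
    have hadj : G.Adj x y' := hy'
    have h1 := huniq x y' hadj (by rw [hx]; exact (hex y' hadj.ne').symm)
    rw [he] at h1
    rcases Sym2.eq_iff.1 h1 with h | h
    · exact hne' h.2
    · exact hadj.ne' h.2

end
end TJ

namespace TJ
open Finset
section
variable {V : Type*} {E : Type*}

open Classical in
lemma card_R [Fintype V] [Fintype E] {G : SimpleGraph V} {r : V} {p : V → V} {d : V → ℕ}
    (h : RT G r p d) (s t : E → V) (hne : ∀ e, s e ≠ t e)
    (hst : ∀ e e', s e = s e' → t e = t e' → e = e')
    (hdfs : ∀ e, ∃ k, p^[k] (s e) = t e)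
    (hdeg : ∀ v, (univ.filter (att s t v)).card = 3)
    (hcard : 1 < Fintype.card V)
    (tau : V → E) (hts : ∀ v, v ≠ r → s (tau v) = v) (htt : ∀ v, v ≠ r → t (tau v) = p v)
    (B : Finset E) (hB : ∀ e, e ∈ B ↔ ∀ v, v ≠ r → e ≠ tau v)
    (Q : Finset V) (hQ : ∀ v, v ∈ Q ↔ (v ≠ r ∧ ∃ e ∈ B, t e = p v ∧ ∃ j, p^[j] (s e) = v)) :
    Fintype.card V ≤ (B ∪ Q.image tau).card := by
  have hinj : Set.InjOn tau {v | v ≠ r} := by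
    intro v hv w hw hvw
    rw [← hts v hv, ← hts w hw, hvw]
  have hd : Disjoint B (Q.image tau) := by
    rw [Finset.disjoint_left]
    intro e he he'
    obtain ⟨v, hv, rfl⟩ := mem_image.1 he'
    exact (hB _).1 he v ((hQ v).1 hv).1 rfl
  rw [card_union_of_disjoint hd, card_image_of_injOn
    (hinj.mono (fun v hv => ((hQ v).1 (by simpa using hv)).1))]
  have hE : 2 * Fintype.card E = 3 * Fintype.card V := by
    have := deg_sum s t hne univ
    rw [sum_congr rfl (fun v _ => hdeg v)] at this
    simp at this
    omega
  have hBc : Bᶜ = (univ.erase r).image tau := by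
    ext e
    simp only [mem_compl, hB, mem_image, mem_erase, mem_univ, and_true]
    push Not
    constructor
    · rintro ⟨v, hv, rfl⟩; exact ⟨v, hv, rfl⟩
    · rintro ⟨v, hv, rfl⟩; exact ⟨v, hv, rfl⟩
  have hBcard : Bᶜ.card = Fintype.card V - 1 := by
    rw [hBc, card_image_of_injOn (hinj.mono (by intro v hv; simpa using hv)),
      card_erase_of_mem (mem_univ _), card_univ]
  have hBc2 := card_compl_add_card B
  have h2 : (B.filter (fun e => t e = r)).card ≤ 2 := by
    obtain ⟨x, hx⟩ := Fintype.exists_ne_of_one_lt_card hcard r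
    have hx1 : 1 ≤ d x := by rw [h.dp x hx]; omega
    obtain ⟨u, hu⟩ := h.exists_depth (d x) x rfl 1 hx1
    have hur : u ≠ r := by rintro rfl; rw [h.dr] at hu; omega
    have hpu : p u = r := by
      by_contra hc
      have a1 := h.dp u hur
      have a2 := h.dp _ hc
      omega
    have hsub : B.filter (fun e => t e = r) ⊆ (univ.filter (att s t r)).erase (tau u) := by
      intro e he
      rw [mem_filter] at he
      rw [mem_erase, mem_filter]
      exact ⟨(hB e).1 he.1 u hur, mem_univ _, Or.inr he.2⟩
    have := card_le_card hsub
    rw [card_erase_of_mem (by rw [mem_filter]; exact ⟨mem_univ _, Or.inr ((htt u hur).trans hpu)⟩), hdeg] at this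
    exact this
  have h3 : (B.filter (fun e => ¬ t e = r)).card ≤ Q.card := by
    have hg : ∀ e, ∃ v, e ∈ B → t e ≠ r → v ≠ r ∧ p v = t e ∧ ∃ j, p^[j] (s e) = v := by
      intro e
      by_cases hc : t e = r
      · exact ⟨r, fun _ h => absurd hc h⟩
      obtain ⟨k, hk⟩ := hdfs e
      cases k with
      | zero => exact absurd hk (hne e)
      | succ j =>
        refine ⟨p^[j] (s e), fun _ _ => ⟨?_, ?_, j, rfl⟩⟩
        · intro hr
          rw [Function.iterate_succ_apply', hr, h.pr] at hk
          exact hc hk.symm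
        · rw [← hk, Function.iterate_succ_apply']
    choose g hg using hg
    apply card_le_card_of_injOn g
    · intro e he
      obtain ⟨he, hr⟩ := mem_filter.1 (mem_coe.1 he)
      obtain ⟨a, b, c⟩ := hg e he hr
      exact mem_coe.2 ((hQ _).2 ⟨a, e, he, b.symm, c⟩)
    · intro e he e' he' hee
      obtain ⟨he, hr⟩ := mem_filter.1 (mem_coe.1 he)
      obtain ⟨he', hr'⟩ := mem_filter.1 (mem_coe.1 he')
      obtain ⟨a, b, -⟩ := hg e he hr
      obtain ⟨a', b', -⟩ := hg e' he' hr'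
      rw [← hee] at b'
      by_contra hne'
      have hvw : g e ≠ t e := by
        intro hc
        have := h.dp _ a
        rw [b, ← hc] at this
        omega
      have hsub : ({e, e', tau (g e), tau (t e)} : Finset E) ⊆ univ.filter (att s t (t e)) := by
        intro f hf
        simp only [mem_insert, mem_singleton] at hf
        rw [mem_filter]
        refine ⟨mem_univ _, ?_⟩
        rcases hf with rfl | rfl | rfl | rfl
        · exact Or.inr rfl
        · exact Or.inr (b'.symm.trans b)
        · exact Or.inr ((htt _ a).trans b)
        · exact Or.inl (hts _ hr)
      have hc := card_le_card hsub
      rw [hdeg, card_insert_of_notMem, card_insert_of_notMem, card_insert_of_notMem,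
        card_singleton] at hc
      · omega
      · rw [mem_singleton]
        intro hc; exact hvw (hinj a hr hc)
      · simp only [mem_insert, mem_singleton, not_or]
        exact ⟨(hB _).1 he' _ a, (hB _).1 he' _ hr⟩
      · simp only [mem_insert, mem_singleton, not_or]
        exact ⟨hne', (hB _).1 he _ a, (hB _).1 he _ hr⟩
  have h4 := card_filter_add_card_filter_not (s := B) (fun e => t e = r)
  omega

open Classical in
lemma conn_A [Fintype V] [Fintype E] {G : SimpleGraph V} {r : V} {p : V → V} {d : V → ℕ}
    (h : RT G r p d) (s t : E → V)
    (tau : V → E) (hts : ∀ v, v ≠ r → s (tau v) = v) (htt : ∀ v, v ≠ r → t (tau v) = p v)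
    (B : Finset E) (hB : ∀ e, e ∈ B ↔ ∀ v, v ≠ r → e ≠ tau v)
    (Q : Finset V) (hQ : ∀ v, v ∈ Q ↔ (v ≠ r ∧ ∃ e ∈ B, t e = p v ∧ ∃ j, p^[j] (s e) = v))
    (M : Finset E) (hM : ∀ v, (M.filter (att s t v)).card = 1)
    (K : V → Prop) (hr : K r)
    (hK : ∀ e, ¬ (e ∈ M ∧ e ∈ B ∪ Q.image tau) → (K (s e) ↔ K (t e))) : ∀ v, K v := by
  have key : ∀ m v, v ≠ r → Fintype.card V < d v + m → (K v ↔ K (p v)) := by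
    intro m
    induction m with
    | zero => intro v hv hlt; have := h.bound v; omega
    | succ m ih =>
      intro v hv hlt
      by_cases hc : tau v ∈ M ∧ tau v ∈ B ∪ Q.image tau
      · obtain ⟨hm, hR⟩ := hc
        have hvQ : v ∈ Q := by
          rcases mem_union.1 hR with hb | hq
          · exact absurd rfl ((hB _).1 hb v hv)
          · obtain ⟨u, hu, huv⟩ := mem_image.1 hq
            have : u = v := by
              rw [← hts v hv, ← huv, hts u ((hQ u).1 hu).1]
            rwa [← this]
        obtain ⟨-, e, heB, hte, j, hj⟩ := (hQ v).1 hvQ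
        have heM : e ∉ M := by
          intro heM
          obtain ⟨f, hf⟩ := card_eq_one.1 (hM (p v))
          have h1 : e ∈ M.filter (att s t (p v)) := mem_filter.2 ⟨heM, Or.inr hte⟩
          have h2 : tau v ∈ M.filter (att s t (p v)) := mem_filter.2 ⟨hm, Or.inr (htt v hv)⟩
          rw [hf, mem_singleton] at h1 h2
          exact (hB e).1 heB v hv (h1.trans h2.symm)
        have he := hK e (fun hh => heM hh.1)
        rw [hte] at he
        rw [← he]
        have chain : ∀ j x, p^[j] x = v → d v ≤ d x ∧ (K v ↔ K x) := by
          intro j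
          induction j with
          | zero => rintro x rfl; exact ⟨le_rfl, Iff.rfl⟩
          | succ j ihj =>
            intro x hx
            rw [Function.iterate_succ_apply] at hx
            obtain ⟨h1, h2⟩ := ihj _ hx
            have hxr : x ≠ r := by
              rintro rfl
              rw [h.pr, h.iter_root] at hx
              exact hv hx.symm
            have h3 := h.dp x hxr
            exact ⟨by omega, h2.trans (ih x hxr (by omega)).symm⟩
        exact (chain j _ hj).2
      · have := hK _ hc
        rwa [hts v hv, htt v hv] at this
  have fin : ∀ m v, d v = m → K v := by
    intro m
    induction m with
    | zero =>
      intro v hv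
      by_cases hvr : v = r
      · rwa [hvr]
      · have := h.dp v hvr; omega
    | succ m ih =>
      intro v hv
      by_cases hvr : v = r
      · rwa [hvr]
      · have := h.dp v hvr
        exact (key (Fintype.card V + 1) v hvr (by omega)).2 (ih _ (by omega))
  intro v
  exact fin _ v rfl

open Classical in
lemma tour [Fintype V] [Fintype E] {G : SimpleGraph V} {r : V} {p : V → V} {d : V → ℕ}
    (h : RT G r p d) (s t : E → V) (hadj : ∀ e, G.Adj (s e) (t e))
    (hst : ∀ e e', s e = s e' → t e = t e' → e = e')
    (hdfs : ∀ e, ∃ k, p^[k] (s e) = t e)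
    (hdeg : ∀ v, (univ.filter (att s t v)).card = 3)
    (hcut : ∀ S : V → ZMod 2, ∑ v, S v = 1 →
      3 ≤ (univ.filter (fun e => S (s e) ≠ S (t e))).card)
    (hcard : 1 < Fintype.card V)
    (tau : V → E) (hts : ∀ v, v ≠ r → s (tau v) = v) (htt : ∀ v, v ≠ r → t (tau v) = p v) :
    ∃ w : G.Walk r r, (∀ x, x ∈ w.support) ∧ 3 * w.length ≤ 4 * Fintype.card V := by
  have hne : ∀ e, s e ≠ t e := fun e => (hadj e).ne
  set B : Finset E := univ.filter (fun e => ∀ v, v ≠ r → e ≠ tau v) with hBdef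
  have hB : ∀ e, e ∈ B ↔ ∀ v, v ≠ r → e ≠ tau v := fun e => by simp [hBdef]
  set Q : Finset V := univ.filter (fun v => v ≠ r ∧ ∃ e ∈ B, t e = p v ∧ ∃ j, p^[j] (s e) = v) with hQdef
  have hQ : ∀ v, v ∈ Q ↔ (v ≠ r ∧ ∃ e ∈ B, t e = p v ∧ ∃ j, p^[j] (s e) = v) := fun v => by
    rw [hQdef, mem_filter]; exact ⟨fun h => h.2, fun h => ⟨mem_univ _, h⟩⟩
  have hRc := card_R h s t hne hst hdfs hdeg hcard tau hts htt B hB Q hQ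
  have hcon := conn_A h s t tau hts htt B hB Q hQ
  generalize hR : B ∪ Q.image tau = R at hRc hcon
  obtain ⟨M, hM1, hM2, hM3⟩ := pm s t hne hdeg hcut R
  have hE : 2 * Fintype.card E = 3 * Fintype.card V := by
    have := deg_sum s t hne univ
    rw [sum_congr rfl (fun v _ => hdeg v)] at this
    simp at this
    omega
  have hMc : 2 * M.card = Fintype.card V := by
    have := deg_sum s t hne M
    rw [sum_congr rfl (fun v _ => hM2 v)] at this
    simp at this
    omega
  have hU : ∀ S, bd s t univ S = ∑ v, S v := by
    intro S
    rw [bd_decomp]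
    apply sum_congr rfl
    intro v _
    rw [bd_ind s t hne, hdeg]
    have : ((3 : ℕ) : ZMod 2) = 1 := rfl
    rw [this, mul_one]
  set A : Finset (E × Bool) := (Mᶜ ×ˢ {false}) ∪ ((M \ R) ×ˢ univ) with hA
  have hdisj : Disjoint (Mᶜ ×ˢ ({false} : Finset Bool)) ((M \ R) ×ˢ univ) := by
    rw [Finset.disjoint_left]
    rintro ⟨e, b⟩ h1 h2
    rw [mem_product] at h1 h2
    exact (mem_compl.1 h1.1) (mem_sdiff.1 h2.1).1
  obtain ⟨w, hw1, hw2⟩ := euler G (fun e : E × Bool => s e.1) (fun e => t e.1)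
    (fun e => hadj e.1) A (by
      intro S
      rw [bd_disj _ _ hdisj]
      have h1 : bd (fun e : E × Bool => s e.1) (fun e => t e.1) (Mᶜ ×ˢ {false}) S = 0 := by
        unfold bd
        rw [sum_product]
        simp only [sum_singleton]
        have := bd_sdiff s t (subset_univ M) S
        rw [hU, hM1, z2] at this
        exact this
      have h2 : bd (fun e : E × Bool => s e.1) (fun e => t e.1) ((M \ R) ×ˢ univ) S = 0 := by
        unfold bd
        rw [sum_product]
        apply sum_eq_zero
        intro e _
        simp only [Fintype.sum_bool]
        exact z2 _
      rw [h1, h2, add_zero]) r (by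
      intro K hKr hK
      apply hcon M hM2 K hKr
      intro e he
      apply hK (e, false)
      rw [hA, mem_union, mem_product, mem_product]
      by_cases hm : e ∈ M
      · exact Or.inr ⟨mem_sdiff.2 ⟨hm, fun hr => he ⟨hm, hr⟩⟩, mem_univ _⟩
      · exact Or.inl ⟨mem_compl.2 hm, mem_singleton_self _⟩)
  refine ⟨w, hw1, ?_⟩
  have hAc : A.card = Mᶜ.card + (M \ R).card * 2 := by
    rw [hA, card_union_of_disjoint hdisj, card_product, card_product]
    simp
  have c1 := card_compl_add_card M
  have c2 := card_inter_add_card_sdiff M R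
  have c3 : (univ \ R).card + R.card = Fintype.card E := by
    rw [card_sdiff_add_card_eq_card (subset_univ R)]; rfl
  omega

end
end TJ

theorem graphTSP_of_cubic_three_connected {V : Type*} [Fintype V]
    (G : SimpleGraph V)
    (hcubic : ∀ v : V, (G.neighborSet v).ncard = 3)
    (hcard : 3 < Fintype.card V)
    (hconn : ∀ s : Finset V, s.card < 3 → (G.induce (↑s : Set V)ᶜ).Connected)
    (T : SimpleGraph V) (hTG : T ≤ G) (hT : T.IsTree)
    (hleaves : {v : V | (T.neighborSet v).ncard = 1}.ncard ≤ 5) :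
    ∃ (r : V) (w : G.Walk r r), (∀ x : V, x ∈ w.support) ∧
      (w.length : ℚ) ≤ 4 * (Fintype.card V) / 3 := by
  classical
  have hG : G.Connected := hT.connected.mono hTG
  obtain ⟨r⟩ := hG.nonempty
  obtain ⟨p, d, h, hdfs⟩ := TJ.exists_dfs G hG r
  have hor : ∀ e : G.edgeSet, ∃ x y, e.1 = s(x, y) ∧ d y ≤ d x := by
    rintro ⟨e, he⟩
    induction e with
    | _ x y =>
      rcases le_total (d y) (d x) with hl | hl
      · exact ⟨x, y, rfl, hl⟩
      · exact ⟨y, x, Sym2.eq_swap, hl⟩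
  choose s t hst hle using hor
  have hadj : ∀ e, G.Adj (s e) (t e) := by
    intro e
    have := e.2
    rw [hst e] at this
    exact this
  have htau : ∀ v, ∃ e : G.edgeSet, v ≠ r → s e = v ∧ t e = p v := by
    intro v
    by_cases hv : v = r
    · obtain ⟨y, hy⟩ : (G.neighborSet r).Nonempty := by
        rw [← Set.ncard_pos, hcubic]; norm_num
      exact ⟨⟨s(r, y), hy⟩, fun hh => absurd hv hh⟩
    · refine ⟨⟨s(v, p v), h.adj v hv⟩, fun _ => ?_⟩
      have h1 := hst ⟨s(v, p v), h.adj v hv⟩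
      have h2 := hle ⟨s(v, p v), h.adj v hv⟩
      have h3 := h.dp v hv
      rcases Sym2.eq_iff.1 h1 with h4 | h4
      · exact ⟨h4.1.symm, h4.2.symm⟩
      · rw [← h4.1, ← h4.2] at h2; omega
  choose tau htau using htau
  obtain ⟨w, hw1, hw2⟩ := TJ.tour h s t hadj
    (fun e e' h1 h2 => Subtype.ext (by rw [hst e, hst e', h1, h2]))
    (fun e => hdfs _ _ (hadj e) (hle e))
    (fun v => by convert TJ.deg_edges G hcubic s t hst v)
    (fun S hS => by convert TJ.cut3 G hcubic hconn s t hst (fun e => (hadj e).ne) S hS)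
    (by omega) tau (fun v hv => (htau v hv).1) (fun v hv => (htau v hv).2)
  refine ⟨r, w, hw1, ?_⟩
  rw [le_div_iff₀ (by norm_num)]
  have : (3 : ℚ) * w.length ≤ 4 * Fintype.card V := by exact_mod_cast hw2
  linarith
end
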